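/- Let p ≥ 0 be a real number and let Ω ⊂ ℝ² be any bounded open set with piecewise C¹ boundary. Then (|Ω|/π)^((p+1)/2) ≤ (1/(2π)) ∫_{∂Ω} |x|^p dσ(x). -/

import Mathlib

open MeasureTheory Metric Real

/-- `Ω ⊂ ℝ²` has piecewise `C¹` boundary: its topological boundary is a finite
union of images of `C¹` curves. -/
def HasPiecewiseC1Boundary (Ω : Set (EuclideanSpace ℝ (Fin 2))) : Prop :=
  ∃ (n : ℕ) (γ : Fin n → ℝ → EuclideanSpace ℝ (Fin 2)),
    (∀ i, ContDiff ℝ 1 (γ i)) ∧ frontier Ω = ⋃ i, γ i '' Set.Icc (0 : ℝ) 1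

section PartA0
open MeasureTheory Metric Real Set

theorem ftc_nn {g g' : ℝ → ℝ} {a b : ℝ} (hab : a ≤ b) (hc : ContinuousOn g (Icc a b))
    (hd : ∀ x ∈ Ioo a b, HasDerivAt g (g' x) x) (h0 : ∀ x ∈ Ioo a b, 0 ≤ g' x) :
    ∫⁻ x in Ioo a b, ENNReal.ofReal (g' x) = ENNReal.ofReal (g b - g a) := by
  have hi : IntegrableOn g' (Ioc a b) := intervalIntegral.integrableOn_deriv_of_nonneg hc hd h0
  have h1 := intervalIntegral.integral_eq_sub_of_hasDerivAt_of_le hab hc hd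
    ((intervalIntegrable_iff_integrableOn_Ioc_of_le hab).2 hi)
  rw [← h1, intervalIntegral.integral_of_le hab, integral_Ioc_eq_integral_Ioo,
    ofReal_integral_eq_lintegral_ofReal]
  · exact hi.mono_set Ioo_subset_Ioc_self
  · exact (ae_restrict_iff' measurableSet_Ioo).2 (Filter.Eventually.of_forall h0)

theorem arcsin_int {w0 : ℝ} (h0 : 0 ≤ w0) (h1 : w0 < 1) :
    ∫⁻ τ in Ioo w0 1, ENNReal.ofReal (τ / √(1 - τ^2) * (2 / √(τ^2 - w0^2))) = ENNReal.ofReal π := by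
  have hk : 0 < 1 - w0^2 := by nlinarith
  have := ftc_nn (g := fun τ => arcsin ((2*τ^2 - 1 - w0^2)/(1 - w0^2)))
    (g' := fun τ => τ / √(1 - τ^2) * (2 / √(τ^2 - w0^2))) h1.le
    (by fun_prop) (by
      intro τ ⟨ha, hb⟩
      have e1 : 0 < 1 - τ^2 := by nlinarith
      have e2 : 0 < τ^2 - w0^2 := by nlinarith
      have e3 : 1 - ((2*τ^2 - 1 - w0^2)/(1 - w0^2))^2 =
        (2 * √(1 - τ^2) * √(τ^2 - w0^2) / (1 - w0^2))^2 := by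
        rw [div_pow, div_pow, mul_pow, mul_pow, sq_sqrt e1.le, sq_sqrt e2.le]
        field_simp; ring
      have e4 : 0 < 2 * √(1 - τ^2) * √(τ^2 - w0^2) / (1 - w0^2) := by positivity
      have e5 : ((2*τ^2 - 1 - w0^2)/(1 - w0^2))^2 < 1 := by
        have := pow_pos e4 2
        linarith
      have e6 := abs_lt.1 ((sq_lt_one_iff_abs_lt_one _).1 e5)
      have d1 : HasDerivAt (fun τ : ℝ => (2*τ^2 - 1 - w0^2)/(1 - w0^2)) (4*τ/(1 - w0^2)) τ := by
        have := (((((hasDerivAt_id τ).pow 2).const_mul 2).sub_const 1).sub_const (w0^2)).div_const (1 - w0^2)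
        refine HasDerivAt.congr_deriv this ?_
        simp; ring
      have := (Real.hasDerivAt_arcsin (ne_of_gt e6.1) (ne_of_lt e6.2)).comp τ d1
      refine HasDerivAt.congr_deriv this ?_
      rw [e3, sqrt_sq e4.le]
      have := (sqrt_pos.2 e1).ne'
      have := (sqrt_pos.2 e2).ne'
      field_simp; ring)
    (by
      intro τ ⟨ha, hb⟩
      have : 0 ≤ τ := h0.trans ha.le
      positivity)
  rw [this]
  congr 1
  have : (2*1^2 - 1 - w0^2)/(1 - w0^2) = 1 := by field_simp; ring
  simp only [this]
  have : (2*w0^2 - 1 - w0^2)/(1 - w0^2) = -1 := by field_simp; ring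
  simp only [this]
  simp

theorem key_alg {τ w0 p1 q1 p2 q2 : ℝ} (hp1 : 0 ≤ p1) (hp2 : 0 ≤ p2) (hq1 : 0 ≤ q1) (hq2 : 0 ≤ q2)
    (hτ : 0 < τ) (e1 : p1^2 + q1^2 = τ) (e2 : p2^2+q2^2 = τ) (h0 : 0 ≤ w0) (h : w0 ≤ p1*p2+q1*q2) :
    (q1^2 - q2^2)^2 ≤ τ^2 - w0^2 := by
  have a1 : τ^2 - (p1*p2+q1*q2)^2 = (q1*p2-p1*q2)^2 := by
    calc _ = (p1^2+q1^2)*(p2^2+q2^2) - (p1*p2+q1*q2)^2 := by rw [e1, e2]; ring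
      _ = _ := by ring
  have a2 : τ * (q1^2 - q2^2) = (q1*p2-p1*q2)*(q1*p2+p1*q2) := by
    calc _ = q1^2 * (p2^2+q2^2) - q2^2*(p1^2+q1^2) := by rw [e1, e2]; ring
      _ = _ := by ring
  have a3 : q1*p2+p1*q2 ≤ τ := by nlinarith [sq_nonneg (q1-p2), sq_nonneg (p1-q2)]
  have a4 : 0 ≤ q1*p2+p1*q2 := by positivity
  have a5 : τ^2 * (q1^2-q2^2)^2 ≤ τ^2 * (q1*p2-p1*q2)^2 := by
    calc _ = (τ * (q1^2-q2^2))^2 := by ring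
      _ = (q1*p2-p1*q2)^2 * (q1*p2+p1*q2)^2 := by rw [a2]; ring
      _ ≤ (q1*p2-p1*q2)^2 * τ^2 := by gcongr
      _ = _ := by ring
  have a6 := le_of_mul_le_mul_left a5 (by positivity)
  have : w0^2 ≤ (p1*p2+q1*q2)^2 := by gcongr
  linarith

end PartA0

section PartA1
open MeasureTheory Metric Real Set

/-- the radial profile -/
noncomputable def Wf (p c d r : ℝ) : ℝ := c * r ^ (1 - p) + d * r ^ (-(1 + p))

theorem Wf_hasDerivAt (p c d : ℝ) {r : ℝ} (hr : 0 < r) :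
    HasDerivAt (Wf p c d) (((1 - p) * Wf p c d r - 2 * (d * r ^ (-(1+p)))) / r) r := by
  have h1 := (Real.hasDerivAt_rpow_const (x := r) (p := 1 - p) (Or.inl hr.ne')).const_mul c
  have h2 := (Real.hasDerivAt_rpow_const (x := r) (p := -(1 + p)) (Or.inl hr.ne')).const_mul d
  refine HasDerivAt.congr_deriv (h1.add h2) ?_
  rw [rpow_sub_one hr.ne', rpow_sub_one hr.ne', Wf]
  field_simp; ring

theorem Wf_contOn (p c d : ℝ) : ContinuousOn (Wf p c d) (Ioi 0) :=
  fun _ hr => (Wf_hasDerivAt p c d hr).continuousAt.continuousWithinAt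

theorem Wf_deriv_eq {p c d r : ℝ} (hr : 0 < r) :
    (1 - p) * Wf p c d r - 2 * (d * r ^ (-(1+p))) = r ^ (-(1+p)) * ((1-p)*c*r^2 - (1+p)*d) := by
  have : r ^ (1-p) = r ^ (-(1+p)) * r^2 := by
    rw [← rpow_natCast, ← rpow_add hr]; congr 1; push_cast; ring
  rw [Wf, this]; ring

noncomputable def rst (p c d : ℝ) : ℝ := √((1+p)*d/((1-p)*c))

section
variable {p c d : ℝ} (hp0 : 0 ≤ p) (hp1 : p < 1) (hc : 0 < c) (hd : 0 < d)

theorem rst_pos (hp0 : 0 ≤ p) (hp1 : p < 1) (hc : 0 < c) (hd : 0 < d) : 0 < rst p c d := by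
  have : 0 < 1 - p := by linarith
  unfold rst; positivity

theorem rst_sq (hp0 : 0 ≤ p) (hp1 : p < 1) (hc : 0 < c) (hd : 0 < d) :
    (1-p)*c*(rst p c d)^2 = (1+p)*d := by
  have : 0 < 1 - p := by linarith
  unfold rst; rw [sq_sqrt (by positivity)]; field_simp

theorem Wd_pos (hp0 : 0 ≤ p) (hp1 : p < 1) (hc : 0 < c) (hd : 0 < d) {r : ℝ} (hr : rst p c d < r) :
    0 < (1 - p) * Wf p c d r - 2 * (d * r ^ (-(1+p))) := by
  have h0 := rst_pos hp0 hp1 hc hd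
  have hr0 : 0 < r := h0.trans hr
  rw [Wf_deriv_eq hr0]
  apply mul_pos (by positivity)
  rw [← rst_sq hp0 hp1 hc hd]
  have : (rst p c d)^2 < r^2 := by gcongr
  have h1 : 0 < (1-p)*c := mul_pos (by linarith) hc
  nlinarith

theorem Wd_neg (hp0 : 0 ≤ p) (hp1 : p < 1) (hc : 0 < c) (hd : 0 < d) {r : ℝ} (hr0 : 0 < r)
    (hr : r < rst p c d) :
    (1 - p) * Wf p c d r - 2 * (d * r ^ (-(1+p))) < 0 := by
  rw [Wf_deriv_eq hr0]
  apply mul_neg_of_pos_of_neg (by positivity)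
  rw [← rst_sq hp0 hp1 hc hd]
  have : r^2 < (rst p c d)^2 := by gcongr
  have h1 : 0 < (1-p)*c := mul_pos (by linarith) hc
  nlinarith

theorem Wf_mono (hp0 : 0 ≤ p) (hp1 : p < 1) (hc : 0 < c) (hd : 0 < d) :
    StrictMonoOn (Wf p c d) (Ici (rst p c d)) := by
  have h0 := rst_pos hp0 hp1 hc hd
  apply strictMonoOn_of_deriv_pos (convex_Ici _)
    ((Wf_contOn p c d).mono fun r hr => h0.trans_le hr)
  intro r hr
  rw [interior_Ici] at hr
  have hr0 : 0 < r := h0.trans hr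
  rw [(Wf_hasDerivAt p c d hr0).deriv]
  exact div_pos (Wd_pos hp0 hp1 hc hd hr) hr0

theorem Wf_anti (hp0 : 0 ≤ p) (hp1 : p < 1) (hc : 0 < c) (hd : 0 < d) :
    StrictAntiOn (Wf p c d) (Ioc 0 (rst p c d)) := by
  apply strictAntiOn_of_deriv_neg (convex_Ioc _ _)
    ((Wf_contOn p c d).mono fun r hr => hr.1)
  intro r hr
  rw [interior_Ioc] at hr
  rw [(Wf_hasDerivAt p c d hr.1).deriv]
  exact div_neg_of_neg_of_pos (Wd_neg hp0 hp1 hc hd hr.1 hr.2) hr.1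

theorem Wf_min (hp0 : 0 ≤ p) (hp1 : p < 1) (hc : 0 < c) (hd : 0 < d) {r : ℝ} (hr : 0 < r) :
    Wf p c d (rst p c d) ≤ Wf p c d r := by
  have h0 := rst_pos hp0 hp1 hc hd
  rcases le_total (rst p c d) r with h | h
  · exact (Wf_mono hp0 hp1 hc hd).monotoneOn self_mem_Ici h h
  · exact (Wf_anti hp0 hp1 hc hd).antitoneOn ⟨hr, h⟩ ⟨h0, le_rfl⟩ h

theorem exR (hp0 : 0 ≤ p) (hp1 : p < 1) (hc : 0 < c) (hd : 0 < d) {τ : ℝ}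
    (h1 : Wf p c d (rst p c d) < τ) (h2 : τ < 1) : ∃ r, rst p c d < r ∧ Wf p c d r = τ := by
  have h0 := rst_pos hp0 hp1 hc hd
  set M := max (rst p c d) ((1/c) ^ (1/(1-p)))
  have hM0 : 0 < M := h0.trans_le (le_max_left _ _)
  have hM : 1 ≤ Wf p c d M := by
    have : 1/c ≤ M ^ (1-p) := by
      calc 1/c = ((1/c) ^ (1/(1-p))) ^ (1-p) := by
            rw [← rpow_mul (by positivity)]
            rw [one_div_mul_cancel (by linarith), rpow_one]
        _ ≤ _ := by
          apply rpow_le_rpow (by positivity) (le_max_right _ _) (by linarith)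
    rw [div_le_iff₀ hc] at this
    have h3 : 0 ≤ d * M ^ (-(1+p)) := by positivity
    rw [Wf]; linarith
  obtain ⟨r, hr, e⟩ := intermediate_value_Icc (le_max_left _ _ : rst p c d ≤ M)
    ((Wf_contOn p c d).mono fun r hr => h0.trans_le hr.1) ⟨h1.le, h2.le.trans hM⟩
  refine ⟨r, lt_of_le_of_ne hr.1 ?_, e⟩
  rintro rfl; linarith

theorem exL (hp0 : 0 ≤ p) (hp1 : p < 1) (hc : 0 < c) (hd : 0 < d) {τ : ℝ}
    (h1 : Wf p c d (rst p c d) < τ) (h2 : τ < 1) : ∃ r, 0 < r ∧ r < rst p c d ∧ Wf p c d r = τ := by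
  have h0 := rst_pos hp0 hp1 hc hd
  set M := min (rst p c d) (d ^ (1/(1+p)))
  have hM0 : 0 < M := lt_min h0 (by positivity)
  have hM : 1 ≤ Wf p c d M := by
    have : M ^ (1+p) ≤ d := by
      calc M ^ (1+p) ≤ (d ^ (1/(1+p))) ^ (1+p) :=
          rpow_le_rpow hM0.le (min_le_right _ _) (by linarith)
        _ = d := by
            rw [← rpow_mul (by positivity)]
            rw [one_div_mul_cancel (by linarith), rpow_one]
    have h3 : 0 ≤ c * M ^ (1-p) := by positivity
    have h4 : 1 ≤ d * M ^ (-(1+p)) := by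
      rw [rpow_neg hM0.le, ← div_eq_mul_inv, one_le_div (by positivity)]; exact this
    rw [Wf]; linarith
  obtain ⟨r, hr, e⟩ := intermediate_value_Icc' (min_le_left _ _ : M ≤ rst p c d)
    ((Wf_contOn p c d).mono fun r hr => hM0.trans_le hr.1) ⟨h1.le, h2.le.trans hM⟩
  refine ⟨r, hM0.trans_le hr.1, lt_of_le_of_ne hr.2 ?_, e⟩
  rintro rfl; linarith

theorem pair_bound (hp0 : 0 ≤ p) (hp1 : p < 1) (hc : 0 < c) (hd : 0 < d) {τ r1 r2 : ℝ}
    (hr1 : 0 < r1) (hr1' : r1 < rst p c d) (hr2 : rst p c d < r2)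
    (e1 : Wf p c d r1 = τ) (e2 : Wf p c d r2 = τ) :
    2 / √(τ^2 - (Wf p c d (rst p c d))^2) ≤
     1 / ((1 - p) * τ - 2 * (d * r2 ^ (-(1+p)))) + 1 / (2 * (d * r1 ^ (-(1+p))) - (1-p) * τ) := by
  have h0 := rst_pos hp0 hp1 hc hd
  have hr2' := h0.trans hr2
  have AR := Wd_pos hp0 hp1 hc hd hr2
  have AL := Wd_neg hp0 hp1 hc hd hr1 hr1'
  rw [e1] at AL
  rw [e2] at AR
  have hmin : Wf p c d (rst p c d) < τ := by
    rw [← e2]; exact Wf_mono hp0 hp1 hc hd self_mem_Ici hr2.le hr2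
  have hw0 : 0 < Wf p c d (rst p c d) := by unfold Wf; positivity
  set w0 := Wf p c d (rst p c d) with hw0d
  have hs : 0 < √(r1*r2) := by positivity
  have hm := Wf_min hp0 hp1 hc hd hs
  rw [← hw0d] at hm
  have hq : √(d * r1 ^ (-(1+p))) * √(d * r2 ^ (-(1+p))) = d * √(r1*r2) ^ (-(1+p)) := by
    rw [← sqrt_mul (by positivity), sqrt_eq_iff_mul_self_eq (by positivity) (by positivity),
      mul_mul_mul_comm, mul_mul_mul_comm _ (√(r1*r2) ^ _), ← mul_rpow hs.le hs.le, mul_self_sqrt (by positivity), mul_rpow hr1.le hr2'.le]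
  have hpp : √(c * r1 ^ (1-p)) * √(c * r2 ^ (1-p)) = c * √(r1*r2) ^ (1-p) := by
    rw [← sqrt_mul (by positivity), sqrt_eq_iff_mul_self_eq (by positivity) (by positivity),
      mul_mul_mul_comm, mul_mul_mul_comm _ (√(r1*r2) ^ _), ← mul_rpow hs.le hs.le, mul_self_sqrt (by positivity), mul_rpow hr1.le hr2'.le]
  have key := key_alg (τ := τ) (w0 := w0) (sqrt_nonneg (c * r1 ^ (1-p))) (sqrt_nonneg (c * r2 ^ (1-p)))
    (sqrt_nonneg (d * r1 ^ (-(1+p)))) (sqrt_nonneg (d * r2 ^ (-(1+p)))) (hw0.trans hmin)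
    (by rw [sq_sqrt (by positivity), sq_sqrt (by positivity)]; exact e1)
    (by rw [sq_sqrt (by positivity), sq_sqrt (by positivity)]; exact e2) hw0.le
    (by rw [hq, hpp]; exact hm)
  rw [sq_sqrt (by positivity), sq_sqrt (by positivity)] at key
  set Q1 := d * r1 ^ (-(1+p))
  set Q2 := d * r2 ^ (-(1+p))
  have hle := abs_le_sqrt key
  have hpos : 0 < Q1 - Q2 := by linarith
  rw [abs_of_pos hpos] at hle
  have AL' : 0 < 2 * Q1 - (1-p)*τ := by linarith
  calc 2 / √(τ^2 - w0^2) ≤ 2 / (Q1 - Q2) := by gcongr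
    _ ≤ _ := by
      rw [div_add_div _ _ AR.ne' AL'.ne', div_le_div_iff₀ hpos (by positivity)]
      nlinarith [sq_nonneg (((1 - p) * τ - 2 * Q2) - (2 * Q1 - (1-p)*τ))]

/-- sweep lemma -/
theorem sweep (hp0 : 0 ≤ p) (hp1 : p < 1) (hc : 0 < c) (hd : 0 < d) {R : ℝ} (hR : 0 < R)
    (hRw : Wf p c d R < 1) :
    ENNReal.ofReal π ≤ ∫⁻ r in {r | 0 < r ∧ Wf p c d r < 1},
      ENNReal.ofReal (Wf p c d r / √(1 - (Wf p c d r)^2) / r) := by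
  have h0 := rst_pos hp0 hp1 hc hd
  have hmin : Wf p c d (rst p c d) < 1 := (Wf_min hp0 hp1 hc hd hR).trans_lt hRw
  have hw0 : 0 < Wf p c d (rst p c d) := by unfold Wf; positivity
  set w0 := Wf p c d (rst p c d) with hw0d
  have hER : ∀ τ : ℝ, ∃ r, τ ∈ Ioo w0 1 → rst p c d < r ∧ Wf p c d r = τ := by
    intro τ
    by_cases h : τ ∈ Ioo w0 1
    · obtain ⟨r, hr⟩ := exR hp0 hp1 hc hd h.1 h.2
      exact ⟨r, fun _ => hr⟩
    · exact ⟨0, fun h' => absurd h' h⟩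
  have hEL : ∀ τ : ℝ, ∃ r, τ ∈ Ioo w0 1 → 0 < r ∧ r < rst p c d ∧ Wf p c d r = τ := by
    intro τ
    by_cases h : τ ∈ Ioo w0 1
    · obtain ⟨r, hr⟩ := exL hp0 hp1 hc hd h.1 h.2
      exact ⟨r, fun _ => hr⟩
    · exact ⟨0, fun h' => absurd h' h⟩
  choose rR hrR using hER
  choose rL hrL using hEL
  have hmR : MonotoneOn rR (Ioo w0 1) := by
    intro a ha b hb hab
    refine ((Wf_mono hp0 hp1 hc hd).le_iff_le (hrR a ha).1.le (hrR b hb).1.le).1 ?_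
    rwa [(hrR a ha).2, (hrR b hb).2]
  set SR := {r | rst p c d < r ∧ Wf p c d r < 1} with hSR
  set SL := {r | (0 < r ∧ r < rst p c d) ∧ Wf p c d r < 1} with hSL
  have hoR : IsOpen SR := by
    have := ((Wf_contOn p c d).mono (Ioi_subset_Ioi h0.le)).isOpen_inter_preimage isOpen_Ioi
      (isOpen_Iio (a := (1:ℝ)))
    exact this
  have hoL : IsOpen SL := by
    have := ((Wf_contOn p c d).mono (fun r (hr : r ∈ Ioo 0 (rst p c d)) => hr.1)).isOpen_inter_preimage isOpen_Ioo
      (isOpen_Iio (a := (1:ℝ)))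
    exact this
  have hiR : Wf p c d '' SR = Ioo w0 1 := by
    ext τ; constructor
    · rintro ⟨r, hr, rfl⟩
      exact ⟨Wf_mono hp0 hp1 hc hd self_mem_Ici hr.1.le hr.1, hr.2⟩
    · intro h
      exact ⟨rR τ, ⟨(hrR τ h).1, by rw [(hrR τ h).2]; exact h.2⟩, (hrR τ h).2⟩
  have hiL : Wf p c d '' SL = Ioo w0 1 := by
    ext τ; constructor
    · rintro ⟨r, hr, rfl⟩
      exact ⟨Wf_anti hp0 hp1 hc hd ⟨hr.1.1, hr.1.2.le⟩ ⟨h0, le_rfl⟩ hr.1.2, hr.2⟩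
    · intro h
      exact ⟨rL τ, ⟨⟨(hrL τ h).1, (hrL τ h).2.1⟩, by rw [(hrL τ h).2.2]; exact h.2⟩, (hrL τ h).2.2⟩
  have injR : InjOn (Wf p c d) SR := (Wf_mono hp0 hp1 hc hd).injOn.mono fun r hr => hr.1.le
  have injL : InjOn (Wf p c d) SL := (Wf_anti hp0 hp1 hc hd).injOn.mono fun r (hr : r ∈ SL) => (⟨hr.1.1, hr.1.2.le⟩ : r ∈ Ioc 0 (rst p c d))
  let GRf : ℝ → ENNReal := fun τ => ENNReal.ofReal (τ / √(1 - τ^2) * (1 / ((1 - p) * τ - 2 * (d * (rR τ) ^ (-(1+p))))))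
  let GLf : ℝ → ENNReal := fun τ => ENNReal.ofReal (τ / √(1 - τ^2) * (1 / (2 * (d * (rL τ) ^ (-(1+p))) - (1-p) * τ)))
  have cR := lintegral_image_eq_lintegral_abs_deriv_mul hoR.measurableSet
    (fun r hr => (Wf_hasDerivAt p c d (h0.trans hr.1)).hasDerivWithinAt) injR GRf
  have cL := lintegral_image_eq_lintegral_abs_deriv_mul hoL.measurableSet
    (fun r hr => (Wf_hasDerivAt p c d hr.1.1).hasDerivWithinAt) injL GLf
  rw [hiR] at cR
  rw [hiL] at cL
  have mGR : AEMeasurable GRf (volume.restrict (Ioo w0 1)) := by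
    have := aemeasurable_restrict_of_monotoneOn (μ := volume) measurableSet_Ioo hmR
    fun_prop
  have step1 : ENNReal.ofReal π ≤ (∫⁻ τ in Ioo w0 1, GRf τ) + ∫⁻ τ in Ioo w0 1, GLf τ := by
    rw [← lintegral_add_left' mGR, ← arcsin_int hw0.le hmin]
    refine setLIntegral_mono' measurableSet_Ioo fun τ hτ => ?_
    have hτ0 : 0 < τ := hw0.trans hτ.1
    obtain ⟨a1, a2⟩ := hrR τ hτ
    obtain ⟨b0, b1, b2⟩ := hrL τ hτ
    have A1 := Wd_pos hp0 hp1 hc hd a1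
    have A2 := Wd_neg hp0 hp1 hc hd b0 b1
    rw [a2] at A1
    rw [b2] at A2
    have A2' : 0 ≤ 2 * (d * (rL τ) ^ (-(1+p))) - (1-p) * τ := by linarith
    simp only [GRf, GLf]
    rw [← ENNReal.ofReal_add (by positivity) (by positivity)]
    apply ENNReal.ofReal_le_ofReal
    rw [← mul_add]
    apply mul_le_mul_of_nonneg_left _ (by positivity)
    exact pair_bound hp0 hp1 hc hd b0 b1 a1 b2 a2
  refine step1.trans ?_
  rw [cR, cL]
  have hdis : Disjoint SR SL := by
    rw [Set.disjoint_left]; intro r h1 h2; exact lt_asymm h1.1 h2.1.2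
  have hsub : SR ∪ SL ⊆ {r | 0 < r ∧ Wf p c d r < 1} := by
    rintro r (h | h)
    · exact ⟨h0.trans h.1, h.2⟩
    · exact ⟨h.1.1, h.2⟩
  refine le_trans ?_ (lintegral_mono_set hsub)
  rw [lintegral_union hoL.measurableSet hdis]
  refine add_le_add ?_ ?_
  · refine (setLIntegral_mono' hoR.measurableSet fun r hr => ?_)
    have hr0 := h0.trans hr.1
    have hτ : Wf p c d r ∈ Ioo w0 1 := hiR ▸ mem_image_of_mem _ hr
    have hrr : rR (Wf p c d r) = r := (Wf_mono hp0 hp1 hc hd).injOn (hrR _ hτ).1.le hr.1.le (hrR _ hτ).2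
    have A1 := Wd_pos hp0 hp1 hc hd hr.1
    simp only [GRf]
    rw [hrr, abs_of_pos (by positivity), ← ENNReal.ofReal_mul (by positivity)]
    apply le_of_eq; congr 1
    generalize (1 - p) * Wf p c d r - 2 * (d * r ^ (-(1 + p))) = A at A1 ⊢
    field_simp
  · refine (setLIntegral_mono' hoL.measurableSet fun r hr => ?_)
    have hr0 := hr.1.1
    have hτ : Wf p c d r ∈ Ioo w0 1 := hiL ▸ mem_image_of_mem _ hr
    have hrr : rL (Wf p c d r) = r := (Wf_anti hp0 hp1 hc hd).injOn ⟨(hrL _ hτ).1, (hrL _ hτ).2.1.le⟩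
      ⟨hr0, hr.1.2.le⟩ (hrL _ hτ).2.2
    have A1 := Wd_neg hp0 hp1 hc hd hr0 hr.1.2
    simp only [GLf]
    rw [hrr, abs_of_neg (div_neg_of_neg_of_pos A1 hr0), ← neg_sub (2 * _), neg_div, neg_neg,
      ← ENNReal.ofReal_mul (by apply div_nonneg _ hr0.le; linarith)]
    have A2 : 0 < 2 * (d * r ^ (-(1 + p))) - (1 - p) * Wf p c d r := by linarith
    apply le_of_eq; congr 1
    generalize 2 * (d * r ^ (-(1 + p))) - (1 - p) * Wf p c d r = A at A2 ⊢
    field_simp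
end

end PartA1

section PartA2
open MeasureTheory Metric Real Set

theorem Wf_lt_one_iff {p c d r : ℝ} (hr : 0 < r) : Wf p c d r < 1 ↔ d < r ^ (p+1) - c * r^2 := by
  have e : Wf p c d r = (c * r^2 + d) / r^(p+1) := by
    have : r ^ (1-p) = r ^ (-(1+p)) * r^2 := by
      rw [← rpow_natCast, ← rpow_add hr]; congr 1; push_cast; ring
    rw [Wf, this, show -(1+p) = -(p+1) by ring, rpow_neg hr.le]; field_simp
  rw [e, div_lt_one (by positivity)]
  constructor <;> intro h <;> linarith

theorem inner_F {p c d r : ℝ} (hc : 0 < c) (hd : 0 ≤ d) (hr : 0 < r)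
    (hw : Wf p c d r < 1) :
    ∫⁻ e in Ioo d (r ^ (p+1) - c * r^2), ENNReal.ofReal (Wf p c e r / √(1 - (Wf p c e r)^2) / r)
      = ENNReal.ofReal (r ^ p * √(1 - (Wf p c d r)^2)) := by
  have hD := (Wf_lt_one_iff hr).1 hw
  have hcont : Continuous (fun e => -(r ^ p * √(1 - (Wf p c e r)^2))) := by
    unfold Wf; fun_prop
  rw [ftc_nn (g := fun e => -(r ^ p * √(1 - (Wf p c e r)^2))) hD.le hcont.continuousOn]
  · have e1 : Wf p c (r ^ (p+1) - c * r^2) r = 1 := by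
      have : r ^ (1-p) = r ^ (-(1+p)) * r^2 := by
        rw [← rpow_natCast, ← rpow_add hr]; congr 1; push_cast; ring
      rw [Wf, this, show -(1+p) = -(p+1) by ring, rpow_neg hr.le]; field_simp; ring
    rw [e1]; simp
  · intro e he
    have w1 : Wf p c e r < 1 := (Wf_lt_one_iff hr).2 he.2
    have w0 : 0 ≤ Wf p c e r := by
      have : 0 ≤ e := hd.trans he.1.le
      unfold Wf; positivity
    have hpos : 0 < 1 - (Wf p c e r)^2 := by nlinarith
    have d1 : HasDerivAt (fun e => Wf p c e r) (r ^ (-(1+p))) e := by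
      unfold Wf
      have := ((hasDerivAt_id e).mul_const (r ^ (-(1+p)))).const_add (c * r ^ (1-p))
      simpa using this
    have d2 := ((((d1.pow 2).const_sub 1).sqrt hpos.ne').const_mul (r^p)).neg
    refine HasDerivAt.congr_deriv d2 ?_
    have h2 : r^p * r ^ (-(1+p)) = 1/r := by
      rw [← rpow_add hr, show p + -(1+p) = -1 by ring, rpow_neg_one, one_div]
    have := (sqrt_pos.2 hpos).ne'
    have : Wf p c e r / √(1 - (Wf p c e r)^2) / r = Wf p c e r / √(1 - (Wf p c e r)^2) * (1/ r) := by ring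
    rw [this, ← h2, Pi.pow_apply]
    field_simp
    push_cast; ring
  · intro e he
    have : 0 ≤ e := hd.trans he.1.le
    have w0 : 0 ≤ Wf p c e r := by unfold Wf; positivity
    positivity

theorem lemF {p c d R : ℝ} (hp0 : 0 ≤ p) (hp1 : p < 1) (hc : 0 < c) (hd : 0 ≤ d) (hR : 0 < R) :
    ENNReal.ofReal (π * (R ^ (p+1) - c * R^2 - d)) ≤
      ∫⁻ r in {r | 0 < r ∧ Wf p c d r < 1}, ENNReal.ofReal (r ^ p * √(1 - (Wf p c d r)^2)) := by
  have mW : Measurable (fun z : ℝ × ℝ => Wf p c z.2 z.1) := by unfold Wf; fun_prop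
  have mW' : ∀ e, Measurable (fun r : ℝ => Wf p c e r) := by intro e; unfold Wf; fun_prop
  set S : Set (ℝ × ℝ) := {z | 0 < z.1 ∧ d < z.2 ∧ Wf p c z.2 z.1 < 1} with hS
  have mS : MeasurableSet S :=
    (measurableSet_lt measurable_const measurable_fst).inter
      ((measurableSet_lt measurable_const measurable_snd).inter
      (measurableSet_lt mW measurable_const))
  have mS1 : ∀ e, MeasurableSet {r | 0 < r ∧ Wf p c e r < 1} := fun e =>
    (measurableSet_lt measurable_const measurable_id).inter
      (measurableSet_lt (mW' e) measurable_const)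
  let F : ℝ × ℝ → ENNReal := S.indicator fun z =>
    ENNReal.ofReal (Wf p c z.2 z.1 / √(1 - (Wf p c z.2 z.1)^2) / z.1)
  have mF : Measurable F := by
    apply Measurable.indicator _ mS
    fun_prop
  have e1 : ∫⁻ r in {r | 0 < r ∧ Wf p c d r < 1}, ENNReal.ofReal (r ^ p * √(1 - (Wf p c d r)^2))
      = ∫⁻ r in {r | 0 < r ∧ Wf p c d r < 1}, ∫⁻ e, F (r, e) := by
    refine setLIntegral_congr_fun (mS1 d) fun r hr => ?_
    rw [← inner_F hc hd hr.1 hr.2, ← lintegral_indicator measurableSet_Ioo]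
    congr 1; ext e
    simp only [F, indicator_apply, hS, mem_ofPred_eq, hr.1, true_and, Wf_lt_one_iff hr.1, mem_Ioo]
  rw [e1]
  have e2 : ∫⁻ r in {r | 0 < r ∧ Wf p c d r < 1}, ∫⁻ e, F (r, e) = ∫⁻ r, ∫⁻ e, F (r, e) := by
    rw [← lintegral_indicator (mS1 d)]
    congr 1; ext r
    rw [indicator_apply]
    split_ifs with h
    · rfl
    · symm
      rw [lintegral_eq_zero_iff (by fun_prop)]
      refine Filter.Eventually.of_forall fun e => ?_
      simp only [F, indicator_apply, Pi.zero_apply]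
      rw [if_neg]
      rintro ⟨h1, h2, h3⟩
      apply h
      refine ⟨h1, ?_⟩
      rw [Wf_lt_one_iff h1] at h3 ⊢
      exact lt_trans h2 h3
  rw [e2, lintegral_lintegral_swap (by exact mF.aemeasurable)]
  calc ENNReal.ofReal (π * (R ^ (p+1) - c * R^2 - d))
      = ∫⁻ e in Ioo d (R ^ (p+1) - c * R^2), ENNReal.ofReal π := by
        rw [setLIntegral_const, Real.volume_Ioo, ENNReal.ofReal_mul pi_pos.le]
    _ ≤ ∫⁻ e in Ioo d (R ^ (p+1) - c * R^2), ∫⁻ r, F (r, e) := by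
        refine setLIntegral_mono' measurableSet_Ioo fun e he => ?_
        refine (sweep hp0 hp1 hc (hd.trans_lt he.1) hR ((Wf_lt_one_iff hR).2 he.2)).trans ?_
        rw [← lintegral_indicator (mS1 e)]
        apply lintegral_mono
        intro r
        by_cases h : 0 < r ∧ Wf p c e r < 1
        · simp only [F, indicator_apply, hS, mem_ofPred_eq, h, he.1, and_self, if_true, le_refl]
        · simp only [indicator_apply, mem_ofPred_eq, if_neg h, zero_le]
    _ ≤ _ := setLIntegral_le_lintegral _ _

end PartA2

section PartA3
open MeasureTheory Metric Real Set

theorem We_mono {p c e : ℝ} (hp0 : 0 ≤ p) (hp1 : p < 1) (hc : 0 < c) (he : 0 ≤ e) :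
    StrictMonoOn (Wf p c (-e)) (Ioi 0) := by
  intro a ha b hb hab
  have h1 : a ^ (1-p) < b ^ (1-p) := rpow_lt_rpow (le_of_lt ha) hab (by linarith)
  have h2 : b ^ (-(1+p)) ≤ a ^ (-(1+p)) := rpow_le_rpow_of_nonpos ha hab.le (by linarith)
  unfold Wf
  nlinarith [mul_le_mul_of_nonneg_left h2 he, mul_lt_mul_of_pos_left h1 hc]

theorem We_ex {p c e : ℝ} (hp0 : 0 ≤ p) (hp1 : p < 1) (hc : 0 < c) (he : 0 < e) {τ : ℝ}
    (h1 : -1 ≤ τ) (h2 : τ ≤ 1) : ∃ r, 0 < r ∧ Wf p c (-e) r = τ := by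
  set M := max 1 (((1+e)/c) ^ (1/(1-p)))
  set m := min 1 ((e/(1+c)) ^ (1/(1+p)))
  have hM1 : 1 ≤ M := le_max_left _ _
  have hm1 : m ≤ 1 := min_le_left _ _
  have hm0 : 0 < m := lt_min one_pos (by positivity)
  have hM : 1 ≤ Wf p c (-e) M := by
    have : (1+e)/c ≤ M ^ (1-p) := by
      calc (1+e)/c = (((1+e)/c) ^ (1/(1-p))) ^ (1-p) := by
            rw [← rpow_mul (by positivity)]
            rw [one_div_mul_cancel (by linarith), rpow_one]
        _ ≤ _ := by
          apply rpow_le_rpow (by positivity) (le_max_right _ _) (by linarith)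
    rw [div_le_iff₀ hc] at this
    have h3 : M ^ (-(1+p)) ≤ 1 := rpow_le_one_of_one_le_of_nonpos hM1 (by linarith)
    rw [Wf]; nlinarith
  have hm : Wf p c (-e) m ≤ -1 := by
    have h4 : m ^ (1+p) ≤ e/(1+c) := by
      calc m ^ (1+p) ≤ ((e/(1+c)) ^ (1/(1+p))) ^ (1+p) :=
          rpow_le_rpow hm0.le (min_le_right _ _) (by linarith)
        _ = e/(1+c) := by
            rw [← rpow_mul (by positivity)]
            rw [one_div_mul_cancel (by linarith), rpow_one]
    have h3 : m ^ (1-p) ≤ 1 := rpow_le_one hm0.le hm1 (by linarith)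
    have h5 : 1 + c ≤ e * m ^ (-(1+p)) := by
      rw [rpow_neg hm0.le, ← div_eq_mul_inv, le_div_iff₀ (by positivity)]
      rw [le_div_iff₀ (by positivity)] at h4
      linarith
    rw [Wf]; nlinarith
  obtain ⟨r, hr, e⟩ := intermediate_value_Icc (hm1.trans hM1)
    ((Wf_contOn p c (-e)).mono fun r hr => hm0.trans_le hr.1) ⟨hm.trans h1, h2.trans hM⟩
  exact ⟨r, hm0.trans_le hr.1, e⟩

theorem inner_E {w : ℝ} (hw : |w| < 1) :
    ∫⁻ τ in Ioo |w| 1, ENNReal.ofReal (τ / √(1 - τ^2)) = ENNReal.ofReal (√(1 - w^2)) := by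
  rw [ftc_nn (g := fun τ => -√(1 - τ^2)) hw.le (by fun_prop)]
  · simp
  · intro τ hτ
    have : 0 ≤ |w| := abs_nonneg w
    have hpos : 0 < 1 - τ^2 := by nlinarith [hτ.1, hτ.2]
    have d2 := (((((hasDerivAt_id τ).pow 2).const_sub 1).sqrt hpos.ne')).neg
    refine HasDerivAt.congr_deriv d2 ?_
    simp only [Pi.pow_apply, id_eq]
    have := (sqrt_pos.2 hpos).ne'
    field_simp; push_cast; ring
  · intro τ hτ
    have : 0 ≤ τ := (abs_nonneg w).trans hτ.1.le
    positivity

theorem layer_E (p c e : ℝ) :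
    ∫⁻ r in {r | 0 < r ∧ |Wf p c e r| < 1}, ENNReal.ofReal (r ^ p * √(1 - (Wf p c e r)^2)) =
    ∫⁻ τ in Ioo 0 1, ENNReal.ofReal (τ / √(1 - τ^2)) *
      ∫⁻ r in {r | 0 < r ∧ |Wf p c e r| < τ}, ENNReal.ofReal (r^p) := by
  have mW : Measurable (fun r : ℝ => |Wf p c e r|) := by
    have : Measurable (fun r : ℝ => Wf p c e r) := by unfold Wf; fun_prop
    exact this.abs
  set S : Set (ℝ × ℝ) := {z | 0 < z.1 ∧ |Wf p c e z.1| < z.2 ∧ z.2 < 1} with hS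
  have mS : MeasurableSet S :=
    (measurableSet_lt measurable_const measurable_fst).inter
      ((measurableSet_lt (mW.comp measurable_fst) measurable_snd).inter
      (measurableSet_lt measurable_snd measurable_const))
  have mS1 : ∀ τ, MeasurableSet {r | 0 < r ∧ |Wf p c e r| < τ} := fun τ =>
    (measurableSet_lt measurable_const measurable_id).inter
      (measurableSet_lt mW measurable_const)
  let F : ℝ × ℝ → ENNReal := S.indicator fun z =>
    ENNReal.ofReal (z.2 / √(1 - z.2^2)) * ENNReal.ofReal (z.1 ^ p)
  have mF : Measurable F := by
    apply Measurable.indicator _ mS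
    fun_prop
  have e1 : ∫⁻ r in {r | 0 < r ∧ |Wf p c e r| < 1}, ENNReal.ofReal (r ^ p * √(1 - (Wf p c e r)^2))
      = ∫⁻ r, ∫⁻ τ, F (r, τ) := by
    rw [← lintegral_indicator (mS1 1)]
    congr 1; ext r
    rw [indicator_apply]
    split_ifs with h
    · obtain ⟨h1, h2⟩ := h
      rw [ENNReal.ofReal_mul (by positivity), ← inner_E h2, mul_comm,
        ← lintegral_mul_const _ (by fun_prop), ← lintegral_indicator measurableSet_Ioo]
      congr 1; ext τ
      simp only [F, indicator_apply, hS, mem_ofPred_eq, h1, true_and, mem_Ioo]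
    · symm
      rw [lintegral_eq_zero_iff (by fun_prop)]
      refine Filter.Eventually.of_forall fun τ => ?_
      simp only [F, indicator_apply, Pi.zero_apply]
      rw [if_neg]
      rintro ⟨h1, h2, h3⟩
      exact h ⟨h1, h2.trans h3⟩
  rw [e1, lintegral_lintegral_swap (by exact mF.aemeasurable), ← lintegral_indicator measurableSet_Ioo]
  congr 1; ext τ
  rw [indicator_apply]
  split_ifs with h
  · rw [← lintegral_const_mul _ (by fun_prop), ← lintegral_indicator (mS1 τ)]
    congr 1; ext r
    simp only [F, indicator_apply, hS, mem_ofPred_eq, h.2, and_true]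
  · rw [lintegral_eq_zero_iff (by fun_prop)]
    refine Filter.Eventually.of_forall fun r => ?_
    simp only [F, indicator_apply, Pi.zero_apply]
    rw [if_neg]
    rintro ⟨h1, h2, h3⟩
    exact h ⟨(abs_nonneg _).trans_lt h2, h3⟩

theorem rpow_int {p a b : ℝ} (hp0 : 0 ≤ p) (ha : 0 ≤ a) (hab : a ≤ b) :
    ∫⁻ r in Ioo a b, ENNReal.ofReal (r^p) = ENNReal.ofReal (b^(p+1)/(p+1) - a^(p+1)/(p+1)) := by
  have hp : 0 < p + 1 := by linarith
  refine ftc_nn (g := fun r => r^(p+1)/(p+1)) hab ?_ ?_ ?_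
  · exact ((continuous_id.rpow_const fun x => Or.inr hp.le).div_const _).continuousOn
  · intro x hx
    have hx0 : 0 < x := ha.trans_lt hx.1
    refine HasDerivAt.congr_deriv ((Real.hasDerivAt_rpow_const (x := x) (p := p+1) (Or.inl hx0.ne')).div_const _) ?_
    rw [add_sub_cancel_right]; field_simp
  · intro x hx
    have hx0 : 0 < x := ha.trans_lt hx.1
    positivity

theorem We_eq {p c e r : ℝ} (hr : 0 < r) : r^(p+1) * Wf p c e r = c * r^2 + e := by
  have : r ^ (1-p) = r ^ (-(1+p)) * r^2 := by
    rw [← rpow_natCast, ← rpow_add hr]; congr 1; push_cast; ring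
  rw [Wf, this, show -(1+p) = -(p+1) by ring, rpow_neg hr.le]; field_simp

theorem E_alg {p c e τ ρ x y : ℝ} (hp0 : 0 ≤ p) (hp1 : p < 1) (hc : 0 < c) 
    (hτ : 0 < τ) (hρ : 0 < ρ) (hy : 0 < y) (hyx : y < x) (e0 : c * ρ^(1-p) = τ)
    (e1 : Wf p c (-e) x = τ) (e2 : Wf p c (-e) y = -τ) :
    ρ^(p+1) ≤ x^(p+1) - y^(p+1) := by
  have hx : 0 < x := hy.trans hyx
  have f1 := We_eq (p := p) (c := c) (e := -e) hx
  have f2 := We_eq (p := p) (c := c) (e := -e) hy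
  rw [e1] at f1
  rw [e2] at f2
  set s := y / x with hs
  have hs0 : 0 < s := by positivity
  have hs1 : s < 1 := (div_lt_one hx).2 hyx
  have hysx : y = s * x := by rw [hs]; field_simp
  have ht : y^(p+1) = s^(p+1) * x^(p+1) := by rw [hysx, mul_rpow hs0.le hx.le]
  set t := s^(p+1) with htd
  have ht0 : 0 < t := by positivity
  have hts : t ≤ s := by
    calc t ≤ s^(1:ℝ) := rpow_le_rpow_of_exponent_ge hs0 hs1.le (by linarith)
      _ = s := rpow_one s
  have f3 : τ * (1 + t) * x^(p+1) = c * x^2 * (1 - s^2) := by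
    rw [ht] at f2
    have : y^2 = s^2*x^2 := by rw [hysx]; ring
    rw [this] at f2
    linarith
  have hx2 : x^(1-p) * x^(p+1) = x^2 := by
    rw [← rpow_natCast, ← rpow_add hx]; congr 1; push_cast; ring
  have hx1 : 0 < x^(p+1) := by positivity
  have f4 : ρ^(1-p) * (1+t) = x^(1-p) * (1-s^2) := by
    rw [← hx2, ← e0] at f3
    have : c * x^(p+1) * (ρ^(1-p) * (1+t)) = c * x^(p+1) * (x^(1-p) * (1-s^2)) := by linarith
    exact mul_left_cancel₀ (by positivity) this
  have f5 : ρ^(1-p) ≤ x^(1-p) * (1-t) := by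
    have h1 : 0 < x^(1-p) := by positivity
    have : ρ^(1-p) * (1+t) ≤ x^(1-p) * (1-t) * (1+t) := by
      rw [f4, mul_assoc]
      apply mul_le_mul_of_nonneg_left _ h1.le
      nlinarith
    exact le_of_mul_le_mul_right this (by linarith)
  set q := ρ / x with hq
  have hq0 : 0 < q := by positivity
  have f6 : q^(1-p) ≤ 1 - t := by
    rw [hq, div_rpow hρ.le hx.le, div_le_iff₀ (by positivity)]; linarith
  have hq1 : q ≤ 1 := by
    by_contra h
    push Not at h
    have := Real.one_lt_rpow h (show 0 < 1-p by linarith)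
    linarith
  have f7 : q^(p+1) ≤ 1 - t :=
    (rpow_le_rpow_of_exponent_ge hq0 hq1 (by linarith)).trans f6
  rw [hq, div_rpow hρ.le hx.le, div_le_iff₀ (by positivity)] at f7
  rw [ht]; linarith

theorem lemE {p c e R : ℝ} (hp0 : 0 ≤ p) (hp1 : p < 1) (hc : 0 < c) (he : 0 ≤ e) (hR : 0 < R) :
    ENNReal.ofReal (π * (R ^ (p+1) - c * R^2)) ≤
      ∫⁻ r in {r | 0 < r ∧ |Wf p c (-e) r| < 1}, ENNReal.ofReal (r ^ p * √(1 - (Wf p c (-e) r)^2)) := by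
  have h0 := lemF hp0 hp1 hc le_rfl hR
  rw [sub_zero] at h0
  have hset : {r | 0 < r ∧ Wf p c 0 r < 1} = {r | 0 < r ∧ |Wf p c 0 r| < 1} := by
    ext r
    simp only [mem_ofPred_eq]
    refine and_congr_right fun hr => ?_
    rw [abs_of_nonneg]
    unfold Wf; positivity
  rw [hset, layer_E] at h0
  rw [layer_E]
  refine h0.trans (setLIntegral_mono' measurableSet_Ioo fun τ hτ => ?_)
  refine mul_le_mul_right ?_ _
  rcases he.eq_or_lt with rfl | he
  · simp
  set ρ := (τ/c)^(1/(1-p)) with hρ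
  have hτ0 := hτ.1
  have hρ0 : 0 < ρ := by positivity
  have e0 : c * ρ^(1-p) = τ := by
    rw [hρ, ← rpow_mul (by positivity), one_div_mul_cancel (by linarith), rpow_one]; field_simp
  obtain ⟨x, hx0, hx⟩ := We_ex hp0 hp1 hc he (by linarith) hτ.2.le
  obtain ⟨y, hy0, hy⟩ := We_ex hp0 hp1 hc he (τ := -τ) (by linarith [hτ.2]) (by linarith)
  have hm := We_mono hp0 hp1 hc he.le
  have hyx : y < x := (hm.lt_iff_lt hy0 hx0).1 (by rw [hx, hy]; linarith)
  calc ∫⁻ r in {r | 0 < r ∧ |Wf p c 0 r| < τ}, ENNReal.ofReal (r^p)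
      ≤ ∫⁻ r in Ioo 0 ρ, ENNReal.ofReal (r^p) := by
        apply lintegral_mono_set
        rintro r ⟨h1, h2⟩
        refine ⟨h1, ?_⟩
        have := (abs_lt.1 h2).2
        rw [Wf, zero_mul, add_zero, ← e0] at this
        have := lt_of_mul_lt_mul_left this hc.le
        exact (rpow_lt_rpow_iff h1.le hρ0.le (by linarith)).1 this
    _ = ENNReal.ofReal (ρ^(p+1)/(p+1)) := by
        rw [rpow_int hp0 le_rfl hρ0.le, zero_rpow (by linarith)]; simp
    _ ≤ ENNReal.ofReal (x^(p+1)/(p+1) - y^(p+1)/(p+1)) := by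
        apply ENNReal.ofReal_le_ofReal
        rw [← sub_div]
        have := E_alg hp0 hp1 hc hτ0 hρ0 hy0 hyx e0 hx hy
        have hp : 0 < p + 1 := by linarith
        gcongr
    _ = ∫⁻ r in Ioo y x, ENNReal.ofReal (r^p) := (rpow_int hp0 hy0.le hyx.le).symm
    _ ≤ _ := by
        apply lintegral_mono_set
        intro r hr
        have hr0 := hy0.trans hr.1
        refine ⟨hr0, abs_lt.2 ⟨?_, ?_⟩⟩
        · rw [← hy]; exact hm hy0 hr0 hr.1
        · rw [← hx]; exact hm hr0 hx0 hr.2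

end PartA3

section PartB0
open MeasureTheory Metric Real Set

/-- sweep of a set along a vector -/
def Sw (A : Set ℂ) (w : ℂ) : Set ℂ := {z | ∃ a ∈ A, ∃ τ : ℝ, 0 ≤ τ ∧ τ ≤ 1 ∧ z = a + τ * w}

theorem vol_Sw_small (S : Set ℂ) {h : ℝ} (hh : 0 ≤ h) :
    volume (Sw S h) ≤ ediam S * (ediam S + ENNReal.ofReal h) := by
  set A : Set ℝ := Complex.re '' (Sw S h)
  set B : Set ℝ := Complex.im '' S
  have hsub : Sw S h ⊆ Complex.measurableEquivRealProd ⁻¹' (A ×ˢ B) := by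
    intro z hz
    refine ⟨⟨z, hz, rfl⟩, ?_⟩
    obtain ⟨a, ha, τ, h0, h1, rfl⟩ := hz
    exact ⟨a, ha, by simp [Complex.measurableEquivRealProd]⟩
  have hA : ediam A ≤ ediam S + ENNReal.ofReal h := by
    rw [ediam_le_iff]
    rintro _ ⟨_, ⟨a, ha, τ, h0, h1, rfl⟩, rfl⟩ _ ⟨_, ⟨b, hb, σ, g0, g1, rfl⟩, rfl⟩
    have h2 : edist (a + τ * (h:ℂ)).re (b + σ * (h:ℂ)).re ≤ edist a b + ENNReal.ofReal h := by
      rw [edist_dist, edist_dist, ← ENNReal.ofReal_add dist_nonneg hh]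
      apply ENNReal.ofReal_le_ofReal
      have := Complex.abs_re_le_norm (a - b)
      rw [Real.dist_eq, Complex.dist_eq]
      simp only [Complex.add_re, Complex.mul_re, Complex.ofReal_re, Complex.ofReal_im, Complex.sub_re] at *
      rw [abs_le] at *
      constructor <;> nlinarith
    exact h2.trans (by gcongr; exact edist_le_ediam_of_mem ha hb)
  have hB : ediam B ≤ ediam S := by
    rw [ediam_le_iff]
    rintro _ ⟨a, ha, rfl⟩ _ ⟨b, hb, rfl⟩
    refine le_trans ?_ (edist_le_ediam_of_mem ha hb)
    rw [edist_dist, edist_dist]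
    apply ENNReal.ofReal_le_ofReal
    rw [Real.dist_eq, Complex.dist_eq]
    simpa using Complex.abs_im_le_norm (a - b)
  calc volume (Sw S h) ≤ volume (Complex.measurableEquivRealProd ⁻¹' (A ×ˢ B)) := measure_mono hsub
    _ = volume A * volume B := by
      rw [Complex.volume_preserving_equiv_real_prod.measure_preimage_equiv, Measure.volume_eq_prod, Measure.prod_prod]
    _ ≤ (ediam S + ENNReal.ofReal h) * ediam S := by
      gcongr
      · exact (Real.volume_le_diam A).trans hA
      · exact (Real.volume_le_diam B).trans hB
    _ = _ := mul_comm _ _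

theorem vol_Sw_real (A : Set ℂ) {h : ℝ} (hh : 0 ≤ h) (hA : μH[1] A ≠ ⊤) :
    volume (Sw A h) ≤ ENNReal.ofReal h * μH[1] A := by
  have key : ∀ r : NNReal, 0 < r → volume (Sw A h) ≤ μH[1] A * (r + ENNReal.ofReal h) := by
    intro r hr
    have hr' : (0:ENNReal) < r := by exact_mod_cast hr
    rw [← ENNReal.div_le_iff (by simp [hr.ne']) (by simp)]
    rw [Measure.hausdorffMeasure_apply]
    refine le_trans ?_ (le_iSup₂_of_le (r : ENNReal) hr' le_rfl)
    refine le_iInf fun t => le_iInf fun ht => le_iInf fun hd => ?_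
    rw [ENNReal.div_le_iff (by simp [hr.ne']) (by simp)]
    have hsub : Sw A h ⊆ ⋃ n, Sw (t n) h := by
      rintro z ⟨a, ha, τ, h⟩
      obtain ⟨n, hn⟩ := mem_iUnion.1 (ht ha)
      exact mem_iUnion.2 ⟨n, a, hn, τ, h⟩
    calc volume (Sw A h) ≤ volume (⋃ n, Sw (t n) h) := measure_mono hsub
      _ ≤ ∑' n, volume (Sw (t n) h) := measure_iUnion_le _
      _ ≤ ∑' n, (⨆ (_ : (t n).Nonempty), ediam (t n) ^ (1:ℝ)) * (r + ENNReal.ofReal h) := by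
        refine ENNReal.tsum_le_tsum fun n => ?_
        rcases (t n).eq_empty_or_nonempty with h0 | h0
        · have : Sw (t n) h = ∅ := by
            rw [h0]; ext z; simp [Sw]
          rw [this]; simp
        · simp only [h0, ciSup_unique, ENNReal.rpow_one, iSup_pos]
          exact (vol_Sw_small _ hh).trans (by gcongr; exact hd n)
      _ = _ := ENNReal.tsum_mul_right
  rw [mul_comm]
  apply ENNReal.le_of_forall_pos_le_add
  intro ε hε _
  set m := (μH[1] A).toNNReal with hm
  have hmA : μH[1] A = m := (ENNReal.coe_toNNReal hA).symm
  refine (key (ε / (m + 1)) (by positivity)).trans ?_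
  rw [mul_add, add_comm, hmA]
  gcongr
  rw [← ENNReal.coe_mul]
  norm_cast
  rw [mul_div_assoc']
  apply div_le_of_le_mul₀ (by positivity) (by positivity)
  nlinarith [mul_comm m ε, hε, show (0:NNReal) ≤ ε from bot_le]

theorem vol_Sw (A : Set ℂ) (w : ℂ) (hA : μH[1] A ≠ ⊤) :
    volume (Sw A w) ≤ ENNReal.ofReal ‖w‖ * μH[1] A := by
  obtain ⟨u, hu⟩ : ∃ u : Circle, w = (u:ℂ) * ‖w‖ := by
    by_cases hw : w = 0
    · exact ⟨1, by simp [hw]⟩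
    · refine ⟨⟨w / ‖w‖, ?_⟩, ?_⟩
      · simp [Submonoid.unitSphere, hw]
      · have : (‖w‖:ℂ) ≠ 0 := by simp [hw]
        simp only; field_simp
  have e : Sw A w = (rotation u) '' (Sw ((rotation u).symm '' A) ‖w‖) := by
    ext z; constructor
    · rintro ⟨a, ha, τ, h0, h1, rfl⟩
      refine ⟨(rotation u).symm a + τ * ‖w‖, ⟨_, mem_image_of_mem _ ha, τ, h0, h1, rfl⟩, ?_⟩
      rw [map_add, LinearIsometryEquiv.apply_symm_apply, rotation_apply]
      conv_rhs => rw [hu]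
      ring
    · rintro ⟨_, ⟨_, ⟨a, ha, rfl⟩, τ, h0, h1, rfl⟩, rfl⟩
      refine ⟨a, ha, τ, h0, h1, ?_⟩
      rw [map_add, LinearIsometryEquiv.apply_symm_apply, rotation_apply]
      conv_rhs => rw [hu]
      ring
  have e2 : μH[1] ((rotation u).symm '' A) = μH[1] A :=
    (rotation u).symm.isometry.hausdorffMeasure_image (Or.inl zero_le_one) A
  have e3 : ∀ S : Set ℂ, volume ((rotation u) '' S) = volume S := by
    intro S
    rw [LinearIsometryEquiv.image_eq_preimage_symm]
    exact (rotation u).symm.measurePreserving.measure_preimage_emb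
      (rotation u).symm.toHomeomorph.measurableEmbedding S
  rw [e, e3, ← e2]
  exact vol_Sw_real _ (norm_nonneg w) (e2 ▸ hA)

end PartB0

section PartB1
open MeasureTheory Metric Real Set Filter Topology

theorem seg_frontier {U : Set ℂ} (hU : IsOpen U) {x w : ℂ} (hx : x ∉ U) (hxw : x - w ∈ U) :
    x ∈ Sw (frontier U) w := by
  by_contra hcon
  have hpre : IsPreconnected ((fun τ : ℝ => x - τ * w) '' Icc 0 1) :=
    isPreconnected_Icc.image _ (by fun_prop)
  have hsub : ((fun τ : ℝ => x - τ * w) '' Icc 0 1) ⊆ U ∪ (closure U)ᶜ := by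
    rintro _ ⟨τ, hτ, rfl⟩
    by_cases h : x - τ * w ∈ closure U
    · left
      by_contra h2
      apply hcon
      refine ⟨x - τ*w, ?_, τ, hτ.1, hτ.2, by ring⟩
      rw [frontier, hU.interior_eq]; exact ⟨h, h2⟩
    · right; exact h
  have := hpre.subset_left_of_subset_union hU isClosed_closure.isOpen_compl
    (disjoint_compl_right.mono_left subset_closure) hsub
    ⟨x - w, ⟨1, by simp, by simp⟩, hxw⟩
  exact hx (this ⟨0, by simp, by simp⟩)

theorem Sw_compact {K : Set ℂ} (hK : IsCompact K) (w : ℂ) : IsCompact (Sw K w) := by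
  have : Sw K w = (fun z : ℂ × ℝ => z.1 + z.2 * w) '' (K ×ˢ Icc 0 1) := by
    ext z; constructor
    · rintro ⟨a, ha, τ, h0, h1, rfl⟩; exact ⟨(a, τ), ⟨ha, h0, h1⟩, rfl⟩
    · rintro ⟨⟨a, τ⟩, ⟨ha, h0, h1⟩, rfl⟩; exact ⟨a, ha, τ, h0, h1, rfl⟩
  rw [this]
  exact (hK.prod isCompact_Icc).image (by fun_prop)

theorem lint_Sw {K : Set ℂ} (hKm : μH[1] K ≠ ⊤) {φ : ℂ → ℝ} (h0 : ∀ x, 0 ≤ φ x)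
    {C : NNReal} (hL : LipschitzWith C φ) (w : ℂ) :
    ∫⁻ x in Sw K w, ENNReal.ofReal (φ x) ≤
      ENNReal.ofReal ‖w‖ * ∫⁻ x in K, ENNReal.ofReal (φ x + C * ‖w‖) ∂μH[1] := by
  have hm := hL.continuous.measurable
  rw [lintegral_eq_lintegral_meas_lt _ (Eventually.of_forall h0) hm.aemeasurable,
    lintegral_eq_lintegral_meas_lt _ (Eventually.of_forall fun x => by have := h0 x; positivity) (by fun_prop),
    ← lintegral_const_mul' _ _ ENNReal.ofReal_ne_top]
  refine lintegral_mono fun s => ?_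
  rw [Measure.restrict_apply (measurableSet_lt measurable_const hm),
    Measure.restrict_apply (measurableSet_lt measurable_const (by fun_prop))]
  refine le_trans (measure_mono ?_) (vol_Sw _ w ?_)
  · rintro z ⟨hz, a, ha, τ, t0, t1, rfl⟩
    refine ⟨a, ⟨?_, ha⟩, τ, t0, t1, rfl⟩
    have h1 := hL.dist_le_mul (a + τ * w) a
    rw [Real.dist_eq, dist_self_add_left, norm_mul, Complex.norm_real, Real.norm_of_nonneg t0] at h1
    have h2 := (abs_le.1 h1).2
    have h3 : (C:ℝ) * (τ * ‖w‖) ≤ C * ‖w‖ := by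
      apply mul_le_mul_of_nonneg_left _ C.2
      nlinarith [norm_nonneg w]
    have h4 : s < φ (a + τ * w) := hz
    show s < φ a + C * ‖w‖
    linarith
  · exact ne_top_of_le_ne_top hKm (measure_mono inter_subset_right)

theorem diff_quot {Ω : Set ℂ} (ho : IsOpen Ω) (hb : Bornology.IsBounded Ω)
    (hm : μH[1] (frontier Ω) ≠ ⊤) {φ : ℂ → ℝ} (h0 : ∀ x, 0 ≤ φ x)
    {C : NNReal} (hL : LipschitzWith C φ) (w : ℂ) :
    ∫ x in Ω, (φ (x + w) - φ x) ≤ ‖w‖ * ∫ x in frontier Ω, (φ x + C * ‖w‖) ∂μH[1] := by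
  have hφc := hL.continuous
  have hK : IsCompact (frontier Ω) := isCompact_of_isClosed_isBounded isClosed_frontier
    (hb.closure.subset frontier_subset_closure)
  have hvol : volume Ω ≠ ⊤ := hb.measure_lt_top.ne
  have hInt : ∀ (S : Set ℂ), Bornology.IsBounded S → IntegrableOn φ S := fun S hS =>
    (hφc.continuousOn.integrableOn_compact hS.isCompact_closure).mono_set subset_closure
  have i1 : ∫ x in Ω, φ (x + w) = ∫ x in (fun x => x - w) ⁻¹' Ω, φ x := by
    have := (measurePreserving_sub_right (volume : Measure ℂ) w).setIntegral_preimage_emb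
      (MeasurableEquiv.subRight w).measurableEmbedding (fun x => φ (x + w)) Ω
    rw [← this]
    simp
  have hbw : Bornology.IsBounded ((fun x => x - w) ⁻¹' Ω) := by
    have : ((fun x => x - w) ⁻¹' Ω) = (fun x => x + w) '' Ω := by
      ext z; constructor
      · intro h; exact ⟨z - w, h, by simp⟩
      · rintro ⟨a, ha, rfl⟩; simpa using ha
    rw [this]
    exact ((LipschitzWith.id.add (LipschitzWith.const w))).isBounded_image hb
  have how : IsOpen ((fun x => x - w) ⁻¹' Ω) := ho.preimage (by fun_prop)
  have i0 : IntegrableOn (fun x => φ (x + w)) Ω :=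
    ((hφc.comp (continuous_add_const w)).continuousOn.integrableOn_compact hb.isCompact_closure).mono_set
      subset_closure
  rw [integral_sub i0 (hInt _ hb), i1]
  have i2 : ∫ x in (fun x => x - w) ⁻¹' Ω, φ x ≤ ∫ x in Ω ∪ Sw (frontier Ω) w, φ x := by
    refine setIntegral_mono_set (hInt _ (hb.union (Sw_compact hK w).isBounded)) (Eventually.of_forall h0) ?_
    refine Eventually.of_forall fun x hx => ?_
    by_cases h : x ∈ Ω
    · exact Or.inl h
    · exact Or.inr (seg_frontier ho h hx)
  have i3 : ∫ x in Ω ∪ Sw (frontier Ω) w, φ x ≤ (∫ x in Ω, φ x) + ∫ x in Sw (frontier Ω) w, φ x := by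
    have j1 : Integrable φ (volume.restrict Ω) := hInt _ hb
    have j2 : Integrable φ (volume.restrict (Sw (frontier Ω) w)) := hInt _ (Sw_compact hK w).isBounded
    rw [← integral_add_measure j1 j2]
    exact integral_mono_measure (Measure.restrict_union_le _ _) (Eventually.of_forall h0)
      (j1.add_measure j2)
  have i4 : ∫ x in Sw (frontier Ω) w, φ x ≤ ‖w‖ * ∫ x in frontier Ω, (φ x + C * ‖w‖) ∂μH[1] := by
    have hfin : IsFiniteMeasure ((μH[1] : Measure ℂ).restrict (frontier Ω)) := ⟨by
      rw [Measure.restrict_apply_univ]; exact hm.lt_top⟩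
    have hI : IntegrableOn (fun x => φ x + C * ‖w‖) (frontier Ω) (μH[1] : Measure ℂ) := by
      obtain ⟨M, hM⟩ := hK.exists_bound_of_continuousOn (f := fun x => φ x + C * ‖w‖) (by fun_prop)
      exact Measure.integrableOn_of_bounded hm (by fun_prop)
        ((ae_restrict_iff' isClosed_frontier.measurableSet).2 (Eventually.of_forall hM))
    have hnn : ∀ x, 0 ≤ φ x + C * ‖w‖ := fun x => by have := h0 x; positivity
    rw [integral_eq_lintegral_of_nonneg_ae (Eventually.of_forall h0) (by fun_prop)]
    apply ENNReal.toReal_le_of_le_ofReal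
    · exact mul_nonneg (norm_nonneg _) (integral_nonneg hnn)
    · rw [ENNReal.ofReal_mul (norm_nonneg _),
        ofReal_integral_eq_lintegral_ofReal hI (Eventually.of_forall hnn)]
      exact lint_Sw hm h0 hL w
  linarith

theorem lemS {Ω : Set ℂ} (ho : IsOpen Ω) (hb : Bornology.IsBounded Ω)
    (hm : μH[1] (frontier Ω) ≠ ⊤) {φ : ℂ → ℝ} (h0 : ∀ x, 0 ≤ φ x)
    (hφ : ContDiff ℝ 1 φ) (hcs : HasCompactSupport φ) (w : ℂ) :
    ∫ x in Ω, fderiv ℝ φ x w ≤ ‖w‖ * ∫ x in frontier Ω, φ x ∂μH[1] := by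
  obtain ⟨C, hL⟩ := ContDiff.lipschitzWith_of_hasCompactSupport hcs hφ one_ne_zero
  have hφc := hL.continuous
  have hK : IsCompact (frontier Ω) := isCompact_of_isClosed_isBounded isClosed_frontier
    (hb.closure.subset frontier_subset_closure)
  have hvol : volume Ω ≠ ⊤ := hb.measure_lt_top.ne
  have hfin : IsFiniteMeasure ((volume : Measure ℂ).restrict Ω) := ⟨by
      rw [Measure.restrict_apply_univ]; exact hvol.lt_top⟩
  have hfin' : IsFiniteMeasure ((μH[1] : Measure ℂ).restrict (frontier Ω)) := ⟨by
      rw [Measure.restrict_apply_univ]; exact hm.lt_top⟩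
  have hI : IntegrableOn φ (frontier Ω) (μH[1] : Measure ℂ) := by
    obtain ⟨M, hM⟩ := hK.exists_bound_of_continuousOn (f := φ) (by fun_prop)
    exact Measure.integrableOn_of_bounded hm (by fun_prop)
      ((ae_restrict_iff' isClosed_frontier.measurableSet).2 (Eventually.of_forall hM))
  have T1 : Tendsto (fun t : ℝ => ∫ x in Ω, t⁻¹ * (φ (x + t * w) - φ x)) (𝓝[>] 0)
      (𝓝 (∫ x in Ω, fderiv ℝ φ x w)) := by
    apply tendsto_integral_filter_of_dominated_convergence (fun _ => (C:ℝ) * ‖w‖)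
    · exact Eventually.of_forall fun t => by fun_prop
    · filter_upwards [self_mem_nhdsWithin] with t ht
      refine Eventually.of_forall fun x => ?_
      have ht0 : (0:ℝ) < t := ht
      have h1 := hL.dist_le_mul (x + t * w) x
      rw [dist_eq_norm, dist_self_add_left, norm_mul, Complex.norm_real, Real.norm_of_nonneg ht0.le] at h1
      rw [norm_mul, norm_inv, Real.norm_of_nonneg ht0.le, inv_mul_le_iff₀ ht0]
      linarith
    · exact integrable_const _
    · refine Eventually.of_forall fun x => ?_
      have h1 : HasDerivAt (fun t : ℝ => φ (x + t * w)) (fderiv ℝ φ x w) 0 := by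
        have hd : HasFDerivAt φ (fderiv ℝ φ x) (x + ((0:ℝ):ℂ) * w) := by
          simpa using (hφ.differentiable one_ne_zero x).hasFDerivAt
        have hl : HasDerivAt (fun t : ℝ => x + (t:ℂ) * w) w 0 := by
          have := ((Complex.ofRealCLM.hasDerivAt (x := (0:ℝ))).mul_const w).const_add x
          simpa using this
        exact hd.comp_hasDerivAt (0:ℝ) hl
      have h2 := h1.tendsto_slope_zero_right
      simpa using h2
  have T2 : Tendsto (fun t : ℝ => ‖w‖ * ∫ x in frontier Ω, (φ x + C * (t * ‖w‖)) ∂μH[1]) (𝓝[>] 0)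
      (𝓝 (‖w‖ * ∫ x in frontier Ω, φ x ∂μH[1])) := by
    have e : ∀ t : ℝ, ∫ x in frontier Ω, (φ x + C * (t * ‖w‖)) ∂μH[1] =
        (∫ x in frontier Ω, φ x ∂μH[1]) + (μH[1] : Measure ℂ).real (frontier Ω) * (C * (t * ‖w‖)) := by
      intro t
      rw [integral_add hI (integrable_const _)]
      simp
    simp only [e]
    have : Continuous (fun t : ℝ => ‖w‖ * ((∫ x in frontier Ω, φ x ∂μH[1]) + (μH[1] : Measure ℂ).real (frontier Ω) * (C * (t * ‖w‖)))) := by fun_prop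
    have := (this.tendsto 0).mono_left (nhdsWithin_le_nhds (s := Ioi 0))
    simpa using this
  refine le_of_tendsto_of_tendsto T1 T2 ?_
  filter_upwards [self_mem_nhdsWithin] with t ht
  have ht0 : (0:ℝ) < t := ht
  have := diff_quot ho hb hm h0 hL (t * w)
  rw [norm_mul, Complex.norm_real, Real.norm_of_nonneg ht0.le] at this
  rw [integral_const_mul, inv_mul_le_iff₀ ht0]
  linarith

end PartB1

section PartB2
open MeasureTheory Metric Real Set Filter Topology

/-- divergence -/
noncomputable def dv (V : ℂ → ℂ) (x : ℂ) : ℝ := (fderiv ℝ V x 1).re + (fderiv ℝ V x Complex.I).im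

theorem fderiv_split (L : ℂ →L[ℝ] ℝ) (w : ℂ) : L w = L 1 * w.re + L Complex.I * w.im := by
  have : w = w.re • (1:ℂ) + w.im • Complex.I := by
    apply Complex.ext <;> simp
  conv_lhs => rw [this]
  rw [map_add, map_smul, map_smul]; simp only [smul_eq_mul]; ring

theorem conv_ibp {η : ℂ → ℝ} {V : ℂ → ℂ} (hη : ContDiff ℝ 1 η)
    (hV : ContDiff ℝ 1 V) (hVc : HasCompactSupport V) (x : ℂ) :
    ∫ z, fderiv ℝ η (x - z) (V z) = ∫ z, η (x - z) * dv V z := by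
  set h : ℂ → ℝ := fun z => η (x - z) with hh
  have hhc : ContDiff ℝ 1 h := hη.comp (contDiff_const.sub contDiff_id)
  have hfd : ∀ z v, fderiv ℝ h z v = - fderiv ℝ η (x - z) v := by
    intro z v
    have h1 : HasFDerivAt η (fderiv ℝ η (x - z)) (x - z) := (hη.differentiable one_ne_zero _).hasFDerivAt
    have h2 : HasFDerivAt (fun z : ℂ => x - z) (-(ContinuousLinearMap.id ℝ ℂ)) z := (hasFDerivAt_id z).const_sub x
    have h3 := (h1.comp z h2).fderiv
    have : fderiv ℝ h z = (fderiv ℝ η (x - z)).comp (-(ContinuousLinearMap.id ℝ ℂ)) := h3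
    rw [this]; simp
  set V1 : ℂ → ℝ := fun z => (V z).re with hV1
  set V2 : ℂ → ℝ := fun z => (V z).im with hV2
  have c1 : ContDiff ℝ 1 V1 := Complex.reCLM.contDiff.comp hV
  have c2 : ContDiff ℝ 1 V2 := Complex.imCLM.contDiff.comp hV
  have s1 : HasCompactSupport V1 := hVc.comp_left (g := Complex.re) rfl
  have s2 : HasCompactSupport V2 := hVc.comp_left (g := Complex.im) rfl
  have f1 : ∀ z v, fderiv ℝ V1 z v = (fderiv ℝ V z v).re := by
    intro z v
    have := (Complex.reCLM.hasFDerivAt.comp z (hV.differentiable one_ne_zero z).hasFDerivAt).fderiv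
    have : fderiv ℝ V1 z = Complex.reCLM.comp (fderiv ℝ V z) := this
    rw [this]; simp
  have f2 : ∀ z v, fderiv ℝ V2 z v = (fderiv ℝ V z v).im := by
    intro z v
    have := (Complex.imCLM.hasFDerivAt.comp z (hV.differentiable one_ne_zero z).hasFDerivAt).fderiv
    have : fderiv ℝ V2 z = Complex.imCLM.comp (fderiv ℝ V z) := this
    rw [this]; simp
  have gen : ∀ (g : ℂ → ℝ) (v : ℂ), ContDiff ℝ 1 g → HasCompactSupport g →
      Integrable (fun z => h z * fderiv ℝ g z v) ∧ Integrable (fun z => fderiv ℝ h z v * g z) ∧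
      ∫ z, h z * fderiv ℝ g z v = - ∫ z, fderiv ℝ h z v * g z := by
    intro g v hg hgs
    have k1 : Continuous (fun z => fderiv ℝ g z v) := (hg.continuous_fderiv one_ne_zero).clm_apply continuous_const
    have k2 : Continuous (fun z => fderiv ℝ h z v) := (hhc.continuous_fderiv one_ne_zero).clm_apply continuous_const
    have i1 : Integrable (fun z => h z * fderiv ℝ g z v) := by
      refine (hhc.continuous.mul k1).integrable_of_hasCompactSupport ?_
      exact (hgs.fderiv_apply ℝ v).mul_left
    have i2 : Integrable (fun z => fderiv ℝ h z v * g z) :=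
      (k2.mul hg.continuous).integrable_of_hasCompactSupport hgs.mul_left
    have i3 : Integrable (fun z => h z * g z) :=
      (hhc.continuous.mul hg.continuous).integrable_of_hasCompactSupport hgs.mul_left
    exact ⟨i1, i2, integral_mul_fderiv_eq_neg_fderiv_mul_of_integrable i2 i1 i3
      (fun z _ => hhc.differentiable one_ne_zero z) (fun z _ => hg.differentiable one_ne_zero z)⟩
  obtain ⟨a1, a2, a3⟩ := gen V1 1 c1 s1
  obtain ⟨b1, b2, b3⟩ := gen V2 Complex.I c2 s2
  have e1 : ∀ z, fderiv ℝ η (x - z) (V z) = - (fderiv ℝ h z 1 * V1 z) + -(fderiv ℝ h z Complex.I * V2 z) := by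
    intro z
    rw [fderiv_split, hfd, hfd]; ring
  have e2 : ∀ z, η (x - z) * dv V z = h z * fderiv ℝ V1 z 1 + h z * fderiv ℝ V2 z Complex.I := by
    intro z
    rw [f1, f2, dv, hh]; ring
  simp only [e1, e2]
  have a2' : Integrable (fun z => -(fderiv ℝ h z 1 * V1 z)) := a2.neg
  have b2' : Integrable (fun z => -(fderiv ℝ h z Complex.I * V2 z)) := b2.neg
  rw [integral_add a2' b2', integral_add a1 b1, a3, b3, integral_neg, integral_neg]

theorem conv_close {η : ℂ → ℝ} (h0 : ∀ x, 0 ≤ η x) (hc : Continuous η) (hs : HasCompactSupport η)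
    (h1 : ∫ y, η y = 1) {ε ω : ℝ} (hsup : ∀ y, ε ≤ ‖y‖ → η y = 0) {g : ℂ → ℝ} (hg : Continuous g)
    (x : ℂ) (hω : ∀ z, dist x z < ε → |g z - g x| ≤ ω) :
    |(∫ z, η (x - z) * g z) - g x| ≤ ω := by
  have hsx : HasCompactSupport (fun z => η (x - z)) :=
    hs.comp_homeomorph (Homeomorph.subLeft x)
  have hcx : Continuous (fun z => η (x - z)) := hc.comp (by fun_prop)
  have hI : Integrable (fun z => η (x - z) * g z) :=
    (hcx.mul hg).integrable_of_hasCompactSupport hsx.mul_right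
  have hI1 : Integrable (fun z => η (x - z)) := hcx.integrable_of_hasCompactSupport hsx
  have hx1 : ∫ z, η (x - z) = 1 := by rw [integral_sub_left_eq_self]; exact h1
  have e : (∫ z, η (x - z) * g z) - g x = ∫ z, η (x - z) * (g z - g x) := by
    simp only [mul_sub]
    rw [integral_sub hI (hI1.mul_const _), integral_mul_const, hx1, one_mul]
  rw [e]
  calc |∫ z, η (x - z) * (g z - g x)| ≤ ∫ z, η (x - z) * ω := by
        rw [← Real.norm_eq_abs]
        apply norm_integral_le_of_norm_le (hI1.mul_const ω)
        refine Eventually.of_forall fun z => ?_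
        rw [norm_mul, Real.norm_of_nonneg (h0 _)]
        by_cases h : dist x z < ε
        · exact mul_le_mul_of_nonneg_left (hω z h) (h0 _)
        · rw [dist_eq_norm] at h
          rw [hsup _ (not_lt.1 h)]; simp
    _ = ω := by rw [integral_mul_const, hx1, one_mul]

theorem swap_bdd {μ ν : Measure ℂ} [IsFiniteMeasure μ] [IsFiniteMeasure ν] {f : ℂ → ℂ → ℝ}
    (hc : Continuous (Function.uncurry f)) {M : ℝ} (hM : ∀ x z, |f x z| ≤ M) :
    ∫ x, ∫ z, f x z ∂ν ∂μ = ∫ z, ∫ x, f x z ∂μ ∂ν ∧ Integrable (fun x => ∫ z, f x z ∂ν) μ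
      ∧ Integrable (fun z => ∫ x, f x z ∂μ) ν := by
  have hI : Integrable (Function.uncurry f) (μ.prod ν) :=
    Integrable.of_bound hc.aestronglyMeasurable M (Eventually.of_forall fun z => hM z.1 z.2)
  exact ⟨integral_integral_swap hI, hI.integral_prod_left, hI.integral_prod_right⟩

theorem div_approx {Ω : Set ℂ} (ho : IsOpen Ω) (hb : Bornology.IsBounded Ω)
    (hm : μH[1] (frontier Ω) ≠ ⊤) {V : ℂ → ℂ} (hV : ContDiff ℝ 1 V) (hVc : HasCompactSupport V)
    {η : ℂ → ℝ} (h0 : ∀ x, 0 ≤ η x) (hη : ContDiff ℝ 1 η) (hs : HasCompactSupport η) :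
    IntegrableOn (fun x => ∫ z, η (x - z) * dv V z) Ω ∧
    IntegrableOn (fun x => ∫ z, η (x - z) * ‖V z‖) (frontier Ω) μH[1] ∧
    ∫ x in Ω, ∫ z, η (x - z) * dv V z ≤ ∫ x in frontier Ω, (∫ z, η (x - z) * ‖V z‖) ∂μH[1] := by
  set T := tsupport V with hT
  have hTc : IsCompact T := hVc
  have hV0 : ∀ z ∉ T, V z = 0 := fun z hz => image_eq_zero_of_notMem_tsupport hz
  have fin1 : IsFiniteMeasure ((volume : Measure ℂ).restrict Ω) := ⟨by
      rw [Measure.restrict_apply_univ]; exact hb.measure_lt_top⟩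
  have fin2 : IsFiniteMeasure ((volume : Measure ℂ).restrict T) := ⟨by
      rw [Measure.restrict_apply_univ]; exact hTc.measure_lt_top⟩
  have fin3 : IsFiniteMeasure ((μH[1] : Measure ℂ).restrict (frontier Ω)) := ⟨by
      rw [Measure.restrict_apply_univ]; exact hm.lt_top⟩
  obtain ⟨C1, hC1⟩ := hs.exists_bound_of_continuous hη.continuous
  obtain ⟨C2, hC2⟩ := (hs.fderiv ℝ).exists_bound_of_continuous (hη.continuous_fderiv one_ne_zero)
  obtain ⟨C3, hC3⟩ := hVc.exists_bound_of_continuous hV.continuous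
  have hdc := hη.continuous_fderiv one_ne_zero
  have hVcont := hV.continuous
  have hηc := hη.continuous
  obtain ⟨p1, p2, p3⟩ := swap_bdd (μ := volume.restrict Ω) (ν := volume.restrict T)
    (f := fun x z => fderiv ℝ η (x - z) (V z)) (M := C2 * C3)
    ((hdc.comp (by fun_prop)).clm_apply (by fun_prop)) (fun x z => by
      refine ((fderiv ℝ η (x - z)).le_opNorm (V z)).trans ?_
      exact mul_le_mul (hC2 _) (hC3 _) (norm_nonneg _) ((norm_nonneg _).trans (hC2 0)))
  obtain ⟨q1, q2, q3⟩ := swap_bdd (μ := (μH[1]).restrict (frontier Ω)) (ν := volume.restrict T)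
    (f := fun x z => η (x - z) * ‖V z‖) (M := C1 * C3)
    ((hηc.comp (by fun_prop)).mul (by fun_prop)) (fun x z => by
      rw [abs_mul, abs_norm]
      exact mul_le_mul (hC1 _) (hC3 _) (norm_nonneg _) ((norm_nonneg _).trans (hC1 0)))
  have r1 : ∀ x, ∫ z in T, fderiv ℝ η (x - z) (V z) = ∫ z, η (x - z) * dv V z := by
    intro x
    rw [setIntegral_eq_integral_of_forall_compl_eq_zero, conv_ibp hη hV hVc]
    intro z hz; rw [hV0 z hz]; simp
  have r2 : ∀ x, ∫ z in T, η (x - z) * ‖V z‖ = ∫ z, η (x - z) * ‖V z‖ := by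
    intro x
    rw [setIntegral_eq_integral_of_forall_compl_eq_zero]
    intro z hz; rw [hV0 z hz]; simp
  simp only [r1] at p1 p2
  simp only [r2] at q1 q2
  refine ⟨p2, q2, ?_⟩
  rw [p1, q1]
  refine integral_mono p3 q3 fun z => ?_
  simp only []
  have hφ : ContDiff ℝ 1 (fun x => η (x - z)) := hη.comp (contDiff_id.sub contDiff_const)
  have hφs : HasCompactSupport (fun x => η (x - z)) := hs.comp_homeomorph (Homeomorph.subRight z)
  have := lemS ho hb hm (fun x => h0 (x - z)) hφ hφs (V z)
  rw [integral_mul_const, mul_comm]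
  refine le_trans (le_of_eq ?_) this
  congr 1; ext x
  rw [fderiv_comp_sub]

theorem dv_cont {V : ℂ → ℂ} (hV : ContDiff ℝ 1 V) : Continuous (dv V) := by
  have := hV.continuous_fderiv one_ne_zero
  unfold dv
  exact (Complex.continuous_re.comp (this.clm_apply continuous_const)).add
    (Complex.continuous_im.comp (this.clm_apply continuous_const))

theorem intOn_frontier {Ω : Set ℂ} (hb : Bornology.IsBounded Ω)
    (hm : μH[1] (frontier Ω) ≠ ⊤) {g : ℂ → ℝ} (hg : Continuous g) :
    IntegrableOn g (frontier Ω) (μH[1] : Measure ℂ) := by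
  have hK : IsCompact (frontier Ω) := isCompact_of_isClosed_isBounded isClosed_frontier
    (hb.closure.subset frontier_subset_closure)
  obtain ⟨M, hM⟩ := hK.exists_bound_of_continuousOn (f := g) (by fun_prop)
  exact Measure.integrableOn_of_bounded hm (by fun_prop)
    ((ae_restrict_iff' isClosed_frontier.measurableSet).2 (Eventually.of_forall hM))

theorem intOn_bdd {Ω : Set ℂ} (hb : Bornology.IsBounded Ω) {g : ℂ → ℝ} (hg : Continuous g) :
    IntegrableOn g Ω :=
  (hg.continuousOn.integrableOn_compact hb.isCompact_closure).mono_set subset_closure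

theorem divIneq_cs {Ω : Set ℂ} (ho : IsOpen Ω) (hb : Bornology.IsBounded Ω)
    (hm : μH[1] (frontier Ω) ≠ ⊤) {V : ℂ → ℂ} (hV : ContDiff ℝ 1 V) (hVc : HasCompactSupport V) :
    ∫ x in Ω, dv V x ≤ ∫ x in frontier Ω, ‖V x‖ ∂μH[1] := by
  have fin1 : IsFiniteMeasure ((volume : Measure ℂ).restrict Ω) := ⟨by
      rw [Measure.restrict_apply_univ]; exact hb.measure_lt_top⟩
  have fin3 : IsFiniteMeasure ((μH[1] : Measure ℂ).restrict (frontier Ω)) := ⟨by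
      rw [Measure.restrict_apply_univ]; exact hm.lt_top⟩
  have dc := dv_cont hV
  have dcs : HasCompactSupport (dv V) := by
    have := (hVc.fderiv ℝ).comp_left (g := fun L : ℂ →L[ℝ] ℂ => (L 1).re + (L Complex.I).im) (by simp)
    exact this
  have u1 := dcs.uniformContinuous_of_continuous dc
  have u2 := (hVc.norm).uniformContinuous_of_continuous hV.continuous.norm
  set m1 := (volume : Measure ℂ).real Ω
  set m2 := (μH[1] : Measure ℂ).real (frontier Ω)
  have hm1 : 0 ≤ m1 := measureReal_nonneg
  have hm2 : 0 ≤ m2 := measureReal_nonneg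
  have key : ∀ ω : ℝ, 0 < ω → ∫ x in Ω, dv V x ≤ (∫ x in frontier Ω, ‖V x‖ ∂μH[1]) + ω * (m1 + m2) := by
    intro ω hω
    obtain ⟨ε1, hε1, H1⟩ := Metric.uniformContinuous_iff.1 u1 ω hω
    obtain ⟨ε2, hε2, H2⟩ := Metric.uniformContinuous_iff.1 u2 ω hω
    set ε := min ε1 ε2
    have hε : 0 < ε := lt_min hε1 hε2
    let f : ContDiffBump (0:ℂ) := ⟨ε/2, ε, by linarith, by linarith⟩
    set η := f.normed volume
    have hη : ContDiff ℝ 1 η := by exact_mod_cast f.contDiff_normed (n := 1)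
    have hs : HasCompactSupport η := f.hasCompactSupport_normed
    have h0 : ∀ x, 0 ≤ η x := f.nonneg_normed
    have h1 : ∫ y, η y = 1 := f.integral_normed
    have hsup : ∀ y, ε ≤ ‖y‖ → η y = 0 := by
      intro y hy
      have : y ∉ Function.support η := by
        rw [f.support_normed_eq]; simpa using hy
      simpa using this
    obtain ⟨j1, j2, j3⟩ := div_approx ho hb hm hV hVc h0 hη hs
    have k1 : ∫ x in Ω, (dv V x - ω) ≤ ∫ x in Ω, ∫ z, η (x - z) * dv V z := by
      refine integral_mono ((intOn_bdd hb dc).sub (integrable_const ω)) j1 fun x => ?_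
      have := conv_close h0 hη.continuous hs h1 hsup dc x (ω := ω) (fun z hz => by
        have := H1 (a := z) (b := x) (by rw [dist_comm]; exact hz.trans_le (min_le_left _ _))
        rw [Real.dist_eq] at this; exact this.le)
      have := (abs_le.1 this).1
      simp only []
      linarith
    have k2 : ∫ x in frontier Ω, (∫ z, η (x - z) * ‖V z‖) ∂μH[1] ≤ ∫ x in frontier Ω, (‖V x‖ + ω) ∂μH[1] := by
      refine integral_mono j2 ((intOn_frontier hb hm hV.continuous.norm).add (integrable_const ω)) fun x => ?_
      have := conv_close h0 hη.continuous hs h1 hsup hV.continuous.norm x (ω := ω) (fun z hz => by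
        have := H2 (a := z) (b := x) (by rw [dist_comm]; exact hz.trans_le (min_le_right _ _))
        rw [Real.dist_eq] at this; exact this.le)
      have := (abs_le.1 this).2
      simp only []
      linarith
    rw [integral_sub (intOn_bdd hb dc) (integrable_const ω)] at k1
    rw [integral_add (intOn_frontier hb hm hV.continuous.norm) (integrable_const ω)] at k2
    simp only [integral_const, smul_eq_mul, measureReal_restrict_apply_univ] at k1 k2
    change _ - m1 * ω ≤ _ at k1
    change _ ≤ _ + m2 * ω at k2
    linarith
  apply le_of_forall_pos_le_add
  intro δ hδ
  refine (key (δ / (m1 + m2 + 1)) (by positivity)).trans ?_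
  gcongr
  rw [div_mul_eq_mul_div]
  apply div_le_of_le_mul₀ (by positivity) hδ.le
  nlinarith

theorem divIneq {Ω : Set ℂ} (ho : IsOpen Ω) (hb : Bornology.IsBounded Ω)
    (hm : μH[1] (frontier Ω) ≠ ⊤) {V : ℂ → ℂ} (hV : ContDiff ℝ 1 V) :
    ∫ x in Ω, dv V x ≤ ∫ x in frontier Ω, ‖V x‖ ∂μH[1] := by
  obtain ⟨R, hR⟩ := hb.subset_closedBall (0:ℂ)
  set R' := max R 1
  let f : ContDiffBump (0:ℂ) := ⟨R' + 1, R' + 2, by have := le_max_right R 1; simp only [R']; linarith, by linarith⟩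
  have hf : ∀ x ∈ ball (0:ℂ) (R' + 1), f x = 1 := fun x hx =>
    f.one_of_mem_closedBall (ball_subset_closedBall hx)
  have hc : closure Ω ⊆ ball (0:ℂ) (R'+1) := by
    have : closure Ω ⊆ closedBall 0 R := closure_minimal hR isClosed_closedBall
    refine this.trans (closedBall_subset_ball ?_)
    have := le_max_left R 1
    simp only [R']; linarith
  have hfc : ContDiff ℝ 1 f := f.contDiff
  have key := divIneq_cs ho hb hm (V := fun x => f x • V x) (hfc.smul hV) (f.hasCompactSupport.smul_right)
  have e1 : ∫ x in Ω, dv (fun x => f x • V x) x = ∫ x in Ω, dv V x := by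
    refine setIntegral_congr_fun ho.measurableSet fun x hx => ?_
    have : (fun x => f x • V x) =ᶠ[𝓝 x] V := by
      filter_upwards [isOpen_ball.mem_nhds (hc (subset_closure hx))] with y hy
      rw [hf y hy, one_smul]
    simp only [dv, this.fderiv_eq]
  have e2 : ∫ x in frontier Ω, ‖f x • V x‖ ∂μH[1] = ∫ x in frontier Ω, ‖V x‖ ∂μH[1] := by
    refine setIntegral_congr_fun isClosed_frontier.measurableSet fun x hx => ?_
    simp only [hf x (hc (frontier_subset_closure hx)), one_smul]
  rw [e1, e2] at key
  exact key

end PartB2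

section PartC0
open MeasureTheory Metric Real Set Filter Topology

/-- smooth step from -1 to 1 -/
noncomputable def Tst (y : ℝ) : ℝ := 2 * Real.smoothTransition ((y + 1) / 2) - 1

theorem Tst_contDiff : ContDiff ℝ 1 Tst := by
  unfold Tst
  have : ContDiff ℝ 1 (fun y : ℝ => Real.smoothTransition ((y+1)/2)) :=
    Real.smoothTransition.contDiff.comp (by fun_prop)
  exact (contDiff_const.mul this).sub contDiff_const

theorem Tst_one {y : ℝ} (h : 1 ≤ y) : Tst y = 1 := by
  unfold Tst; rw [Real.smoothTransition.one_of_one_le (by linarith)]; norm_num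

theorem Tst_neg {y : ℝ} (h : y ≤ -1) : Tst y = -1 := by
  unfold Tst; rw [Real.smoothTransition.zero_of_nonpos (by linarith)]; norm_num

theorem Tst_abs (y : ℝ) : |Tst y| ≤ 1 := by
  unfold Tst
  have := Real.smoothTransition.nonneg ((y+1)/2)
  have := Real.smoothTransition.le_one ((y+1)/2)
  rw [abs_le]; constructor <;> linarith

theorem ang_id (θ α φ : ℝ) : (cos (θ - (α+φ)/2) - cos ((φ-α)/2))/2 = sin ((θ-α)/2) * sin ((φ-θ)/2) := by
  have e1 : θ - (α+φ)/2 = (θ-α)/2 - (φ-θ)/2 := by ring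
  have e2 : (φ-α)/2 = (θ-α)/2 + (φ-θ)/2 := by ring
  rw [e1, e2, cos_sub, cos_add]; ring

/-- the angular profile -/
noncomputable def sprof (α φ δ θ : ℝ) : ℝ := Tst ((cos (θ - (α+φ)/2) - cos ((φ-α)/2))/2/δ)

theorem sprof_contDiff (α φ δ : ℝ) : ContDiff ℝ 1 (sprof α φ δ) := by
  unfold sprof
  exact Tst_contDiff.comp (by
    refine ContDiff.div_const (ContDiff.div_const (ContDiff.sub (ContDiff.cos ?_) contDiff_const) _) _
    fun_prop)

theorem sprof_periodic (α φ δ : ℝ) : Function.Periodic (sprof α φ δ) (2*π) := by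
  intro θ
  unfold sprof
  rw [show θ + 2*π - (α+φ)/2 = θ - (α+φ)/2 + 2*π by ring, cos_add_two_pi]

theorem sin_ge_of {ε x : ℝ} (hε : 0 < ε) (h1 : ε ≤ x) (h2 : x ≤ π - ε) : sin ε ≤ sin x := by
  rcases le_total x (π/2) with h | h
  · exact sin_le_sin_of_le_of_le_pi_div_two (by linarith) h h1
  · rw [← sin_pi_sub x]
    exact sin_le_sin_of_le_of_le_pi_div_two (by linarith) (by linarith) (by linarith)

theorem sprof_deriv_zero {α φ ε θ : ℝ} (hε : 0 < sin (ε/2)) (h1 : cos (θ-α) < cos ε) (h2 : cos (θ-φ) < cos ε) :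
    deriv (sprof α φ (sin (ε/2)^2)) θ = 0 := by
  have hsq : ∀ x : ℝ, sin (x/2)^2 = (1 - cos x)/2 := by
    intro x
    have := cos_sq (x/2)
    have h := sin_sq_add_cos_sq (x/2)
    rw [show 2*(x/2) = x by ring] at this
    linarith
  have k1 : sin (ε/2)^2 < sin ((θ-α)/2)^2 := by rw [hsq, hsq]; linarith
  have k2 : sin (ε/2)^2 < sin ((φ-θ)/2)^2 := by
    rw [hsq, hsq, ← cos_neg (φ-θ), neg_sub]; linarith
  set δ := sin (ε/2)^2 with hδ
  have hδ0 : 0 < δ := by positivity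
  have hab : δ ≤ |sin ((θ-α)/2) * sin ((φ-θ)/2)| := by
    refine (le_abs_self δ).trans (sq_le_sq.1 ?_)
    have := mul_lt_mul'' k1 k2 hδ0.le hδ0.le
    rw [mul_pow, sq]; exact this.le
  have hle : ∀ t, |sprof α φ δ t| ≤ 1 := fun t => Tst_abs _
  rcases le_abs'.1 hab with h | h
  · have : sprof α φ δ θ = -1 := by
      unfold sprof; rw [ang_id]; apply Tst_neg
      rw [div_le_iff₀ hδ0]; linarith
    apply IsLocalMin.deriv_eq_zero
    refine Eventually.of_forall fun t => ?_
    rw [this]; exact (abs_le.1 (hle t)).1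
  · have : sprof α φ δ θ = 1 := by
      unfold sprof; rw [ang_id]; apply Tst_one
      rw [le_div_iff₀ hδ0]; linarith
    apply IsLocalMax.deriv_eq_zero
    refine Eventually.of_forall fun t => ?_
    rw [this]; exact (abs_le.1 (hle t)).2

theorem sprof_int {α φ ε : ℝ} (hε : 0 < ε) (h1 : 2*ε < φ - α) (h2 : φ - α + 2*ε < 2*π) :
    ∫ θ in Ioo (-π) π, (if cos ε ≤ cos (θ-α) then deriv (sprof α φ (sin (ε/2)^2)) θ else 0) = 2 := by
  have hs : 0 < sin (ε/2) := sin_pos_of_pos_of_lt_pi (by linarith) (by linarith)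
  set δ := sin (ε/2)^2 with hδ
  have hδ0 : 0 < δ := by positivity
  set k : ℝ → ℝ := fun θ => (if cos ε ≤ cos (θ-α) then deriv (sprof α φ δ) θ else 0) with hk
  have hdc : Continuous (deriv (sprof α φ δ)) := (sprof_contDiff α φ δ).continuous_deriv le_rfl
  have hper : Function.Periodic k (2*π) := by
    intro θ
    have : deriv (sprof α φ δ) (θ + 2*π) = deriv (sprof α φ δ) θ := by
      rw [← deriv_comp_add_const]
      congr 1; funext t; exact sprof_periodic α φ δ t
    simp only [hk, this]
    rw [show θ + 2*π - α = θ - α + 2*π by ring, cos_add_two_pi]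
  have e0 : ∫ θ in Ioo (-π) π, k θ = ∫ θ in (-π)..π, k θ := by
    rw [intervalIntegral.integral_of_le (by linarith [pi_pos]), integral_Ioc_eq_integral_Ioo]
  have e1 : ∫ θ in (-π)..π, k θ = ∫ θ in (α-ε)..(α-ε+2*π), k θ := by
    have := hper.intervalIntegral_add_eq (-π) (α-ε)
    rw [← this]; congr 1; ring
  have c1 : EqOn k (deriv (sprof α φ δ)) (Icc (α-ε) (α+ε)) := by
    intro θ hθ
    have : cos ε ≤ cos (θ-α) := by
      rw [← cos_abs (θ-α)]
      apply cos_le_cos_of_nonneg_of_le_pi (abs_nonneg _) (by linarith)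
      rw [abs_le]; constructor <;> linarith [hθ.1, hθ.2]
    simp only [hk, this, if_true]
  have c2 : ∀ θ ∈ Ioo (α+ε) (α-ε+2*π), k θ = 0 := by
    intro θ hθ
    have : cos (θ-α) < cos ε := by
      rcases le_total (θ-α) π with h | h
      · exact cos_lt_cos_of_nonneg_of_le_pi hε.le h (by linarith [hθ.1])
      · rw [← cos_two_pi_sub]
        exact cos_lt_cos_of_nonneg_of_le_pi hε.le (by linarith) (by linarith [hθ.2])
    simp only [hk, not_le.2 this, if_false]
  have i1 : IntervalIntegrable k volume (α-ε) (α+ε) := by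
    refine (hdc.intervalIntegrable _ _).congr ?_
    intro θ hθ
    rw [uIoc_of_le (by linarith)] at hθ
    exact (c1 (Ioc_subset_Icc_self hθ)).symm
  have z2 : ∀ᵐ θ, θ ∈ uIoc (α+ε) (α-ε+2*π) → k θ = 0 := by
    rw [uIoc_of_le (by linarith)]
    have : ∀ᵐ θ : ℝ, θ ≠ α-ε+2*π := by simp [ae_iff]
    filter_upwards [this] with θ hne hθ
    exact c2 θ ⟨hθ.1, lt_of_le_of_ne hθ.2 hne⟩
  have i2 : IntervalIntegrable k volume (α+ε) (α-ε+2*π) := by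
    refine (intervalIntegrable_const (c := (0:ℝ))).congr_ae ?_
    rw [Filter.EventuallyEq, ae_restrict_iff' measurableSet_uIoc]
    filter_upwards [z2] with θ h hθ
    exact (h hθ).symm
  have e2 : ∫ θ in (α-ε)..(α+ε), k θ = 2 := by
    rw [intervalIntegral.integral_congr (g := deriv (sprof α φ δ))
      (by rw [uIcc_of_le (by linarith)]; exact c1)]
    rw [intervalIntegral.integral_deriv_eq_sub
      (fun x _ => (sprof_contDiff α φ δ).differentiable one_ne_zero x) (hdc.intervalIntegrable _ _)]
    have a1 : sprof α φ δ (α+ε) = 1 := by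
      unfold sprof; rw [ang_id]; apply Tst_one
      rw [le_div_iff₀ hδ0, hδ, one_mul, sq, show α + ε - α = ε by ring]
      exact mul_le_mul_of_nonneg_left (sin_ge_of (by linarith) (by linarith) (by linarith)) hs.le
    have a2 : sprof α φ δ (α-ε) = -1 := by
      unfold sprof; rw [ang_id]; apply Tst_neg
      rw [div_le_iff₀ hδ0, hδ, sq, show (α - ε - α)/2 = -(ε/2) by ring, sin_neg]
      have := mul_le_mul_of_nonneg_left (sin_ge_of (ε := ε/2) (x := (φ - (α-ε))/2) (by linarith) (by linarith) (by linarith)) hs.le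
      linarith
    rw [a1, a2]; norm_num
  have e3 : ∫ θ in (α+ε)..(α-ε+2*π), k θ = 0 := by
    rw [intervalIntegral.integral_congr_ae (g := fun _ => (0:ℝ)) z2]; simp
  rw [e0, e1, ← intervalIntegral.integral_add_adjacent_intervals i1 i2, e2, e3]; norm_num

end PartC0

section PartC1
open MeasureTheory Metric Real Set Filter Topology

/-- point in polar coordinates -/
noncomputable def pol (r θ : ℝ) : ℂ := r * Complex.exp (θ * Complex.I)

theorem pol_norm {r θ : ℝ} (hr : 0 < r) : ‖pol r θ‖ = r := by
  unfold pol; rw [norm_mul, Complex.norm_exp_ofReal_mul_I]; simp [abs_of_pos hr]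

theorem pol_hasDeriv (r θ : ℝ) : HasDerivAt (pol r) (Complex.I * pol r θ) θ := by
  unfold pol
  have h1 : HasDerivAt (fun θ : ℝ => (θ:ℂ) * Complex.I) (1 * Complex.I) θ :=
    (Complex.ofRealCLM.hasDerivAt (x := θ)).mul_const Complex.I
  have := (h1.cexp).const_mul (r:ℂ)
  refine this.congr_deriv ?_
  ring

theorem polar_split (f : ℂ → ℝ) (u v : ℝ → ℝ)
    (h : ∀ r, 0 < r → ∀ θ, r * f (pol r θ) = u r * v θ) :
    ∫ x, f x = (∫ r in Ioi 0, u r) * ∫ θ in Ioo (-π) π, v θ := by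
  rw [← Complex.integral_comp_polarCoord_symm, polarCoord_target, ← setIntegral_prod_mul]
  rw [← Measure.volume_eq_prod]
  refine setIntegral_congr_fun (measurableSet_Ioi.prod measurableSet_Ioo) ?_
  rintro ⟨r, θ⟩ ⟨hr, -⟩
  have := h r hr θ
  simp only [pol, Complex.exp_mul_I] at this
  simp only [Complex.polarCoord_symm_apply, smul_eq_mul]
  rw [← this]; push_cast; rfl

theorem angular_single {Ω : Set ℂ} (ho : IsOpen Ω) {J : Set ℝ} (hJ : J ⊆ Ioi 0) {α φ ε : ℝ}
    (hε : 0 < ε) (h1 : 2*ε < φ - α) (h2 : φ - α + 2*ε < 2*π)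
    (hin : ∀ r ∈ J, ∀ θ, cos ε ≤ cos (θ - α) → pol r θ ∈ Ω)
    (hout : ∀ r ∈ J, ∀ θ, cos ε ≤ cos (θ - φ) → pol r θ ∉ Ω)
    {H : ℝ → ℝ} (hH : ContDiff ℝ 1 H) (hsub : tsupport H ⊆ J) (h0 : ∀ r, 0 ≤ H r) :
    ∃ B : ℂ → ℝ, ContDiff ℝ 1 B ∧ (∀ x, |B x| ≤ H ‖x‖) ∧
      ∫ x in Ω, fderiv ℝ B x (Complex.I * x) = 2 * ∫ r in Ioi 0, r * H r := by
  have hs : 0 < sin (ε/2) := sin_pos_of_pos_of_lt_pi (by linarith) (by linarith)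
  set δ := sin (ε/2)^2 with hδ
  set m := (α+φ)/2 with hm
  set k := cos ((φ-α)/2) with hk
  set S : ℂ → ℝ := fun x => Tst (((x * Complex.exp (-(m:ℂ) * Complex.I)).re / ‖x‖ - k)/2/δ) with hS
  set B : ℂ → ℝ := fun x => H ‖x‖ * S x with hB
  have hBc : ContDiff ℝ 1 B := by
    rw [contDiff_iff_contDiffAt]
    intro x
    by_cases hx : x = 0
    · have h00 : (0:ℝ) ∉ tsupport H := fun h => lt_irrefl (0:ℝ) (mem_Ioi.1 (hJ (hsub h)))
      have hev : ∀ᶠ r in 𝓝 (0:ℝ), H r = 0 := notMem_tsupport_iff_eventuallyEq.1 h00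
      have : Tendsto (fun y : ℂ => ‖y‖) (𝓝 x) (𝓝 0) := by
        rw [hx]; have := (continuous_norm (E := ℂ)).tendsto 0; simpa using this
      refine (contDiffAt_const (c := (0:ℝ))).congr_of_eventuallyEq ?_
      filter_upwards [this.eventually hev] with y hy
      simp only [hB, hy, zero_mul]
    · have n1 : ContDiffAt ℝ 1 (fun y : ℂ => ‖y‖) x := contDiffAt_norm ℝ hx
      refine ContDiffAt.mul (hH.contDiffAt.comp x n1) ?_
      refine Tst_contDiff.contDiffAt.comp x ?_
      refine ContDiffAt.div_const (ContDiffAt.div_const (ContDiffAt.sub (ContDiffAt.div ?_ n1 (norm_ne_zero_iff.2 hx)) contDiffAt_const) _) _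
      exact (Complex.reCLM.contDiff.comp (contDiff_id.mul contDiff_const)).contDiffAt
  have hBpol : ∀ r, 0 < r → ∀ θ, B (pol r θ) = H r * sprof α φ δ θ := by
    intro r hr θ
    have : (pol r θ * Complex.exp (-(m:ℂ) * Complex.I)).re / ‖pol r θ‖ = cos (θ - m) := by
      rw [pol_norm hr]
      unfold pol
      rw [mul_assoc, ← Complex.exp_add, show (θ:ℂ) * Complex.I + -(m:ℂ)*Complex.I = ((θ - m : ℝ):ℂ) * Complex.I by push_cast; ring,
        Complex.re_ofReal_mul, Complex.exp_ofReal_mul_I_re]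
      field_simp
    simp only [hB, hS, this, sprof]
    rw [pol_norm hr]
  have hD : ∀ r, 0 < r → ∀ θ, fderiv ℝ B (pol r θ) (Complex.I * pol r θ) = H r * deriv (sprof α φ δ) θ := by
    intro r hr θ
    have d1 : HasDerivAt (fun t => B (pol r t)) (fderiv ℝ B (pol r θ) (Complex.I * pol r θ)) θ :=
      (hBc.differentiable one_ne_zero (pol r θ)).hasFDerivAt.comp_hasDerivAt θ (pol_hasDeriv r θ)
    have d2 : HasDerivAt (fun t => H r * sprof α φ δ t) (H r * deriv (sprof α φ δ) θ) θ :=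
      (((sprof_contDiff α φ δ).differentiable one_ne_zero θ).hasDerivAt).const_mul _
    have e : (fun t => B (pol r t)) = fun t => H r * sprof α φ δ t := funext fun t => hBpol r hr t
    rw [e] at d1
    exact d1.unique d2
  refine ⟨B, hBc, ?_, ?_⟩
  · intro x
    simp only [hB, abs_mul, abs_of_nonneg (h0 _)]
    exact mul_le_of_le_one_right (h0 _) (Tst_abs _)
  · rw [← integral_indicator ho.measurableSet]
    rw [polar_split _ (fun r => r * H r) (fun θ => if cos ε ≤ cos (θ-α) then deriv (sprof α φ δ) θ else 0), hδ,
      sprof_int hε h1 h2, mul_comm]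
    intro r hr θ
    by_cases hrJ : r ∈ J
    · by_cases c1 : cos ε ≤ cos (θ-α)
      · rw [if_pos c1, indicator_of_mem (hin r hrJ θ c1), hD r hr]; ring
      · rw [if_neg c1, mul_zero]
        by_cases c2 : cos ε ≤ cos (θ-φ)
        · rw [indicator_of_notMem (hout r hrJ θ c2), mul_zero]
        · have : deriv (sprof α φ δ) θ = 0 := sprof_deriv_zero hs (not_le.1 c1) (not_le.1 c2)
          by_cases hO : pol r θ ∈ Ω
          · rw [indicator_of_mem hO, hD r hr, this]; simp
          · rw [indicator_of_notMem hO, mul_zero]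
    · have : H r = 0 := image_eq_zero_of_notMem_tsupport fun h => hrJ (hsub h)
      rw [this]
      by_cases hO : pol r θ ∈ Ω
      · rw [indicator_of_mem hO, hD r hr, this]; simp
      · rw [indicator_of_notMem hO]; simp

theorem sector {U : Set ℂ} (hU : IsOpen U) {z : ℂ} (hz : z ∈ U) :
    ∃ η0 > 0, ∀ η, 0 < η → η ≤ η0 → ∀ r, |r - ‖z‖| < η → ∀ θ, cos η ≤ cos (θ - z.arg) → pol r θ ∈ U := by
  obtain ⟨ρ, hρ, hball⟩ := Metric.isOpen_iff.1 hU z hz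
  refine ⟨ρ/(2*(1+‖z‖)), by positivity, ?_⟩
  intro η hη hηρ r hr θ hθ
  apply hball
  rw [mem_ball, dist_eq_norm]
  have hz' : z = pol ‖z‖ z.arg := (Complex.norm_mul_exp_arg_mul_I z).symm
  have e : pol r θ - z = ((r - ‖z‖ : ℝ):ℂ) * Complex.exp (θ * Complex.I) +
      (‖z‖:ℂ) * (Complex.exp (θ * Complex.I) - Complex.exp (z.arg * Complex.I)) := by
    conv_lhs => rw [hz']
    unfold pol; push_cast; ring
  have hch : ‖Complex.exp (θ * Complex.I) - Complex.exp (z.arg * Complex.I)‖ ≤ η := by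
    apply le_of_sq_le_sq _ hη.le
    rw [Complex.sq_norm, Complex.normSq_apply]
    simp only [Complex.sub_re, Complex.sub_im, Complex.exp_ofReal_mul_I_re, Complex.exp_ofReal_mul_I_im]
    have := one_sub_sq_div_two_le_cos (x := η)
    rw [cos_sub] at hθ
    nlinarith [sin_sq_add_cos_sq θ, sin_sq_add_cos_sq z.arg]
  rw [e]
  calc _ ≤ |r - ‖z‖| * 1 + ‖z‖ * η := by
        refine (norm_add_le _ _).trans ?_
        rw [norm_mul, norm_mul, Complex.norm_exp_ofReal_mul_I]
        simp only [Complex.norm_real, Real.norm_eq_abs, abs_norm]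
        gcongr
    _ < η * (1 + ‖z‖) := by nlinarith
    _ ≤ ρ/(2*(1+‖z‖)) * (1+‖z‖) := by gcongr
    _ < ρ := by
        have : (0:ℝ) < 1 + ‖z‖ := by positivity
        field_simp; linarith

end PartC1

section PartC2
open MeasureTheory Metric Real Set Filter Topology

theorem local_ang {Ω : Set ℂ} (ho : IsOpen Ω) {z y : ℂ} (hz : z ∈ Ω) (hy : y ∈ (closure Ω)ᶜ)
    (hzy : ‖z‖ = ‖y‖) (h0 : 0 < ‖z‖) :
    ∃ J : Set ℝ, IsOpen J ∧ ‖z‖ ∈ J ∧ ∀ H : ℝ → ℝ, ContDiff ℝ 1 H → tsupport H ⊆ J → (∀ r, 0 ≤ H r) →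
      ∃ B : ℂ → ℝ, ContDiff ℝ 1 B ∧ (∀ x, |B x| ≤ H ‖x‖) ∧
      ∫ x in Ω, fderiv ℝ B x (Complex.I * x) = 2 * ∫ r in Ioi 0, r * H r := by
  obtain ⟨η1, hη1, k1⟩ := sector ho hz
  obtain ⟨η2, hη2, k2⟩ := sector isClosed_closure.isOpen_compl hy
  have hne : z.arg ≠ y.arg := by
    intro h
    have : z = y := Complex.ext_norm_arg hzy h
    exact hy (this ▸ subset_closure hz)
  obtain ⟨φ, hφ1, hφ2, hφ⟩ : ∃ φ : ℝ, z.arg < φ ∧ φ - z.arg < 2*π ∧ ∀ θ, cos (θ - φ) = cos (θ - y.arg) := by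
    have a1 := Complex.neg_pi_lt_arg z
    have a2 := Complex.arg_le_pi z
    have b1 := Complex.neg_pi_lt_arg y
    have b2 := Complex.arg_le_pi y
    rcases lt_or_gt_of_ne hne with h | h
    · exact ⟨y.arg, h, by linarith, fun _ => rfl⟩
    · refine ⟨y.arg + 2*π, by linarith, by linarith, fun θ => ?_⟩
      rw [← cos_sub_two_pi (θ - y.arg)]; congr 1; ring
  set η := min (min η1 η2) (min (min ((φ - z.arg)/3) ((2*π - (φ - z.arg))/3)) ‖z‖) with hη
  have hη0 : 0 < η := by
    refine lt_min (lt_min hη1 hη2) (lt_min (lt_min ?_ ?_) h0) <;> linarith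
  have l1 : η ≤ η1 := (min_le_left _ _).trans (min_le_left _ _)
  have l2 : η ≤ η2 := (min_le_left _ _).trans (min_le_right _ _)
  have l3 : η ≤ (φ - z.arg)/3 := (min_le_right _ _).trans ((min_le_left _ _).trans (min_le_left _ _))
  have l4 : η ≤ (2*π - (φ - z.arg))/3 := (min_le_right _ _).trans ((min_le_left _ _).trans (min_le_right _ _))
  have l5 : η ≤ ‖z‖ := (min_le_right _ _).trans (min_le_right _ _)
  refine ⟨Ioo (‖z‖ - η) (‖z‖ + η), isOpen_Ioo, ⟨by linarith, by linarith⟩, ?_⟩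
  intro H hH hsub hH0
  have habs : ∀ r ∈ Ioo (‖z‖ - η) (‖z‖ + η), |r - ‖z‖| < η := by
    intro r hr; rw [abs_lt]; constructor <;> linarith [hr.1, hr.2]
  refine angular_single ho (J := Ioo (‖z‖ - η) (‖z‖ + η)) (α := z.arg) (φ := φ) (ε := η) ?_ hη0 (by linarith) (by linarith) ?_ ?_ hH hsub hH0
  · intro r hr; exact lt_of_le_of_lt (by linarith) hr.1
  · intro r hr θ hθ
    exact k1 η hη0 l1 r (habs r hr) θ hθ
  · intro r hr θ hθ hmem
    rw [hφ] at hθ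
    exact k2 η hη0 l2 r (by rw [← hzy]; exact habs r hr) θ hθ (subset_closure hmem)

theorem angular {Ω : Set ℂ} (ho : IsOpen Ω) (hb : Bornology.IsBounded Ω) {G : ℝ → ℝ}
    (hG : ContDiff ℝ 1 G) (hGs : HasCompactSupport G) (h0 : ∀ r, 0 ≤ G r)
    (hsub : ∀ r ∈ tsupport G, 0 < r ∧ (∃ z ∈ Ω, ‖z‖ = r) ∧ ∃ y ∈ (closure Ω)ᶜ, ‖y‖ = r) :
    ∃ B : ℂ → ℝ, ContDiff ℝ 1 B ∧ (∀ x, |B x| ≤ G ‖x‖) ∧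
      ∫ x in Ω, fderiv ℝ B x (Complex.I * x) = 2 * ∫ r in Ioi 0, r * G r := by
  have hloc : ∀ r ∈ tsupport G, ∃ J : Set ℝ, IsOpen J ∧ r ∈ J ∧ ∀ H : ℝ → ℝ, ContDiff ℝ 1 H → tsupport H ⊆ J → (∀ r, 0 ≤ H r) →
      ∃ B : ℂ → ℝ, ContDiff ℝ 1 B ∧ (∀ x, |B x| ≤ H ‖x‖) ∧
      ∫ x in Ω, fderiv ℝ B x (Complex.I * x) = 2 * ∫ r in Ioi 0, r * H r := by
    intro r hr
    obtain ⟨hr0, ⟨z, hz, hzr⟩, y, hy, hyr⟩ := hsub r hr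
    obtain ⟨J, hJ⟩ := local_ang ho hz hy (hzr.trans hyr.symm) (hzr ▸ hr0)
    rw [hzr] at hJ
    exact ⟨J, hJ⟩
  choose! J hJo hrJ hJ using hloc
  obtain ⟨t, ht, hcov⟩ := hGs.isCompact.elim_nhds_subcover J (fun r hr => (hJo r hr).mem_nhds (hrJ r hr))
  obtain ⟨f, hf⟩ := SmoothPartitionOfUnity.exists_isSubordinate (modelWithCornersSelf ℝ ℝ) (s := tsupport G) (isClosed_tsupport G)
    (fun i : t => J i) (fun i => hJo i (ht i i.2)) (by
      intro r hr
      obtain ⟨i, hi, h⟩ := mem_iUnion₂.1 (hcov hr)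
      exact mem_iUnion.2 ⟨⟨i, hi⟩, h⟩)
  have hfc : ∀ i, ContDiff ℝ 1 (f i) := fun i => (f i).contMDiff.contDiff.of_le (by simp)
  set H : t → ℝ → ℝ := fun i r => f i r * G r with hH
  have hHc : ∀ i, ContDiff ℝ 1 (H i) := fun i => (hfc i).mul hG
  have hHs : ∀ i, tsupport (H i) ⊆ J i := fun i => (tsupport_mul_subset_left).trans (hf i)
  have hH0 : ∀ i r, 0 ≤ H i r := fun i r => mul_nonneg (f.nonneg i r) (h0 r)
  have hsum : ∀ r, ∑ i, H i r = G r := by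
    intro r
    simp only [hH, ← Finset.sum_mul]
    by_cases hr : r ∈ tsupport G
    · have := f.sum_eq_one hr
      rw [finsum_eq_sum_of_fintype] at this
      rw [this, one_mul]
    · rw [image_eq_zero_of_notMem_tsupport hr, mul_zero]
  have hex := fun i : t => hJ i (ht i i.2) (H i) (hHc i) (hHs i) (hH0 i)
  choose B hBc hBa hBi using hex
  refine ⟨fun x => ∑ i, B i x, ContDiff.sum fun i _ => hBc i, ?_, ?_⟩
  · intro x
    rw [← hsum]
    exact (Finset.abs_sum_le_sum_abs _ _).trans (Finset.sum_le_sum fun i _ => hBa i x)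
  · have e1 : ∀ x, fderiv ℝ (fun x => ∑ i, B i x) x (Complex.I * x) = ∑ i, fderiv ℝ (B i) x (Complex.I * x) := by
      intro x
      rw [fderiv_fun_sum (fun i _ => (hBc i).differentiable one_ne_zero x)]
      simp
    have e2 : ∀ r, r * G r = ∑ i, r * H i r := by
      intro r; rw [← Finset.mul_sum, hsum]
    simp only [e1, e2]
    rw [integral_finsetSum, integral_finsetSum, Finset.mul_sum]
    · exact Finset.sum_congr rfl fun i _ => hBi i
    · intro i _
      refine Integrable.integrableOn ?_
      refine Continuous.integrable_of_hasCompactSupport (continuous_id.mul (hHc i).continuous) ?_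
      exact HasCompactSupport.mul_left (HasCompactSupport.mul_left hGs)
    · intro i _
      apply intOn_bdd hb
      exact ((hBc i).continuous_fderiv one_ne_zero).clm_apply (by fun_prop)

end PartC2

section PartC3
open MeasureTheory Metric Real Set Filter Topology

theorem dv_add {V W : ℂ → ℂ} {x : ℂ} (hV : DifferentiableAt ℝ V x) (hW : DifferentiableAt ℝ W x) :
    dv (fun x => V x + W x) x = dv V x + dv W x := by
  unfold dv
  rw [fderiv_fun_add hV hW]; simp; ring

theorem dv_smul {f : ℂ → ℝ} {W : ℂ → ℂ} {x : ℂ} (hf : DifferentiableAt ℝ f x) (hW : DifferentiableAt ℝ W x) :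
    dv (fun x => f x • W x) x = f x * dv W x + fderiv ℝ f x (W x) := by
  unfold dv
  rw [fderiv_fun_smul hf hW, fderiv_split (fderiv ℝ f x) (W x)]; simp; ring

theorem dv_id (x : ℂ) : dv (fun x => x) x = 2 := by
  unfold dv; simp; norm_num

theorem dv_rot (x : ℂ) : dv (fun x => Complex.I * x) x = 0 := by
  unfold dv
  have : fderiv ℝ (fun x : ℂ => Complex.I * x) x = (ContinuousLinearMap.mul ℝ ℂ Complex.I) :=
    (ContinuousLinearMap.mul ℝ ℂ Complex.I).fderiv
  rw [this]; simp

theorem lemG0 {Ω : Set ℂ} (ho : IsOpen Ω) (hb : Bornology.IsBounded Ω)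
    (hm : μH[1] (frontier Ω) ≠ ⊤) {A : ℝ → ℝ} (hA : ContDiff ℝ 1 A) {G : ℝ → ℝ}
    (hG : ContDiff ℝ 1 G) (hGs : HasCompactSupport G) (h0 : ∀ r, 0 ≤ G r)
    (hsub : ∀ r ∈ tsupport G, 0 < r ∧ (∃ z ∈ Ω, ‖z‖ = r) ∧ ∃ y ∈ (closure Ω)ᶜ, ‖y‖ = r)
    {N : ℂ → ℝ} (hN : Continuous N) (hN0 : ∀ x, 0 ≤ N x)
    (hbd : ∀ x ∈ frontier Ω, ‖x‖^2 * (A (‖x‖^2)^2 + G ‖x‖^2) ≤ N x^2) :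
    (∫ x in Ω, (2 * A (‖x‖^2) + 2 * (‖x‖^2 * deriv A (‖x‖^2)))) + 2 * ∫ r in Ioi 0, r * G r
      ≤ ∫ x in frontier Ω, N x ∂μH[1] := by
  obtain ⟨B, hBc, hBa, hBi⟩ := angular ho hb hG hGs h0 hsub
  have hsq : ContDiff ℝ 1 (fun x : ℂ => ‖x‖^2) := contDiff_norm_sq ℝ
  have hAc : ContDiff ℝ 1 (fun x : ℂ => A (‖x‖^2)) := hA.comp hsq
  have hr : ContDiff ℝ 1 (fun x : ℂ => Complex.I * x) := contDiff_const.mul contDiff_id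
  set V : ℂ → ℂ := fun x => A (‖x‖^2) • x + B x • (Complex.I * x) with hV
  have hV1 : ContDiff ℝ 1 (fun x : ℂ => A (‖x‖^2) • x) := hAc.smul contDiff_id
  have hV2 : ContDiff ℝ 1 (fun x : ℂ => B x • (Complex.I * x)) := hBc.smul hr
  have hVc : ContDiff ℝ 1 V := hV1.add hV2
  have hdv : ∀ x, dv V x = (2 * A (‖x‖^2) + 2 * (‖x‖^2 * deriv A (‖x‖^2))) + fderiv ℝ B x (Complex.I * x) := by
    intro x
    rw [hV, dv_add (hV1.differentiable one_ne_zero x) (hV2.differentiable one_ne_zero x),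
      dv_smul (W := fun x => x) (hAc.differentiable one_ne_zero x) differentiableAt_fun_id,
      dv_smul (hBc.differentiable one_ne_zero x) (hr.differentiable one_ne_zero x), dv_id, dv_rot]
    have : fderiv ℝ (fun x : ℂ => A (‖x‖^2)) x x = 2 * (‖x‖^2 * deriv A (‖x‖^2)) := by
      have h1 := ((hA.differentiable one_ne_zero (‖x‖^2)).hasDerivAt).comp_hasFDerivAt x
        (hasStrictFDerivAt_norm_sq x).hasFDerivAt
      have h2 : fderiv ℝ (fun x : ℂ => A (‖x‖^2)) x = _ := h1.fderiv
      rw [h2]; simp; ring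
    rw [this]; ring
  have key := divIneq ho hb hm hVc
  have hVn : ∀ x ∈ frontier Ω, ‖V x‖ ≤ N x := by
    intro x hx
    apply le_of_sq_le_sq _ (hN0 x)
    refine le_trans ?_ (hbd x hx)
    have e : ‖V x‖^2 = ‖x‖^2 * (A (‖x‖^2)^2 + B x^2) := by
      rw [hV]
      simp only [Complex.sq_norm, Complex.normSq_apply]
      simp; ring
    rw [e]
    have := sq_le_sq' (abs_le.1 (hBa x)).1 (abs_le.1 (hBa x)).2
    gcongr
  have k2 : ∫ x in frontier Ω, ‖V x‖ ∂μH[1] ≤ ∫ x in frontier Ω, N x ∂μH[1] :=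
    setIntegral_mono_on (intOn_frontier hb hm hVc.continuous.norm) (intOn_frontier hb hm hN)
      isClosed_frontier.measurableSet hVn
  refine le_trans (le_of_eq ?_) (key.trans k2)
  simp only [hdv]
  have i1 : IntegrableOn (fun x : ℂ => 2 * A (‖x‖^2) + 2 * (‖x‖^2 * deriv A (‖x‖^2))) Ω := by
    apply intOn_bdd hb
    have := hA.continuous_deriv le_rfl
    have := hA.continuous
    fun_prop
  have i2 : IntegrableOn (fun x : ℂ => fderiv ℝ B x (Complex.I * x)) Ω := by
    apply intOn_bdd hb
    exact (hBc.continuous_fderiv one_ne_zero).clm_apply (by fun_prop)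
  rw [integral_add i1 i2, hBi]

end PartC3

section PartC4
open MeasureTheory Metric Real Set Filter Topology

theorem exA {a c d : ℝ} (ha : 0 ≤ a) (had : a = 0 → d = 0) :
    ∃ A : ℝ → ℝ, ContDiff ℝ 1 A ∧ (∀ v, a^2 ≤ v → 0 < v → A v = c + d / v) ∧
      ∀ (Ω : Set ℂ) (κ : ℝ), IsOpen Ω → Bornology.IsBounded Ω →
        ((ball 0 a ⊆ Ω ∧ κ = 2*π*d) ∨ (Disjoint (ball 0 a) Ω ∧ κ = 0)) →
        ∫ x in Ω, (2 * A (‖x‖^2) + 2 * (‖x‖^2 * deriv A (‖x‖^2))) = 2 * c * volume.real Ω + κ := by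
  rcases ha.eq_or_lt with h | ha0
  · have hd := had h.symm
    refine ⟨fun _ => c, contDiff_const, fun v _ _ => by simp [hd], ?_⟩
    intro Ω κ ho hb hκ
    have : κ = 0 := by rcases hκ with h | h <;> simp [h.2, hd]
    simp [this]; ring
  · set χ : ℝ → ℝ := fun v => Real.smoothTransition (2*v/a^2 - 1) with hχ
    have hχc : ContDiff ℝ 1 χ := Real.smoothTransition.contDiff.comp (by fun_prop)
    have χ0 : ∀ v, v ≤ a^2/2 → χ v = 0 := by
      intro v hv; apply Real.smoothTransition.zero_of_nonpos
      rw [sub_nonpos, div_le_one (by positivity)]; linarith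
    have χ1 : ∀ v, a^2 ≤ v → χ v = 1 := by
      intro v hv; apply Real.smoothTransition.one_of_one_le
      rw [le_sub_iff_add_le, le_div_iff₀ (by positivity)]; linarith
    have a2 : 0 < a^2 := by positivity
    set A : ℝ → ℝ := fun v => c + d * (χ v / v) with hA
    have hAc : ContDiff ℝ 1 A := by
      refine contDiff_const.add (contDiff_const.mul ?_)
      rw [contDiff_iff_contDiffAt]
      intro v
      by_cases hv : v = 0
      · refine (contDiffAt_const (c := (0:ℝ))).congr_of_eventuallyEq ?_
        have : ∀ᶠ w in 𝓝 v, w < a^2/2 := gt_mem_nhds (by rw [hv]; positivity)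
        filter_upwards [this] with w hw
        rw [χ0 w hw.le, zero_div]
      · exact hχc.contDiffAt.div contDiffAt_id hv
    refine ⟨A, hAc, fun v hv hv0 => by simp only [hA, χ1 v hv]; ring, ?_⟩
    intro Ω κ ho hb hκ
    have hχd : Continuous (deriv χ) := hχc.continuous_deriv le_rfl
    have e1 : ∀ v, 2 * A v + 2 * (v * deriv A v) = 2 * c + 2 * d * deriv χ v := by
      intro v
      have d1 : HasDerivAt (fun v => v * A v) (1 * A v + v * deriv A v) v :=
        (hasDerivAt_id v).mul (hAc.differentiable one_ne_zero v).hasDerivAt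
      have d2 : HasDerivAt (fun v => c * v + d * χ v) (c * 1 + d * deriv χ v) v :=
        ((hasDerivAt_id v).const_mul c).add ((hχc.differentiable one_ne_zero v).hasDerivAt.const_mul d)
      have e : (fun v => v * A v) = fun v => c * v + d * χ v := by
        funext v
        simp only [hA]
        by_cases hv : v = 0
        · rw [hv, χ0 0 (by positivity)]; simp
        · field_simp
      rw [e] at d1
      linarith [d1.unique d2]
    have χd : ∀ v, a^2 ≤ v → deriv χ v = 0 := by
      intro v hv
      apply IsLocalMax.deriv_eq_zero
      refine Eventually.of_forall fun t => ?_
      rw [χ1 v hv]; exact Real.smoothTransition.le_one _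
    have χdn : ∀ x : ℂ, x ∉ ball (0:ℂ) a → deriv χ (‖x‖^2) = 0 := by
      intro x hx
      rw [mem_ball_zero_iff, not_lt] at hx
      exact χd _ (by gcongr)
    have i2 : IntegrableOn (fun x : ℂ => 2 * d * deriv χ (‖x‖^2)) Ω := by
      apply intOn_bdd hb; fun_prop
    have i1 : IntegrableOn (fun x : ℂ => 2 * c) Ω := by
      apply intOn_bdd hb; fun_prop
    simp only [e1]
    rw [integral_add i1 i2, setIntegral_const, smul_eq_mul, integral_const_mul (2*d)]
    have key : 2 * d * ∫ x in Ω, deriv χ (‖x‖^2) = κ := by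
      rcases hκ with ⟨h, hκ⟩ | ⟨h, hκ⟩
      · rw [setIntegral_eq_integral_of_forall_compl_eq_zero (fun x hx => χdn x fun hb => hx (h hb))]
        rw [polar_split _ (fun r => r * deriv χ (r^2)) (fun _ => 1)]
        · have : ∫ r in Ioi (0:ℝ), r * deriv χ (r^2) = 1/2 := by
            have hd : ∀ r ∈ Ici (0:ℝ), HasDerivAt (fun r => χ (r^2) / 2) (r * deriv χ (r^2)) r := by
              intro r _
              have := ((hχc.differentiable one_ne_zero (r^2)).hasDerivAt.comp r (hasDerivAt_pow 2 r)).div_const 2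
              refine this.congr_deriv ?_
              simp; ring
            have hcs : HasCompactSupport (fun r : ℝ => r * deriv χ (r^2)) := by
              apply HasCompactSupport.intro (isCompact_Icc (a := -a) (b := a))
              intro r hr
              rw [χd, mul_zero]
              by_contra hlt
              push Not at hlt
              exact hr (abs_le.1 (abs_le_of_sq_le_sq hlt.le ha))
            have := integral_Ioi_of_hasDerivAt_of_tendsto' (m := 1/2) hd
              ((by fun_prop : Continuous (fun r : ℝ => r * deriv χ (r^2))).integrable_of_hasCompactSupport hcs).integrableOn
              (tendsto_const_nhds.congr' (by
                filter_upwards [eventually_ge_atTop a] with r hr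
                rw [χ1 _ (by gcongr)]))
            rw [this]
            simp [χ0 0 (by positivity)]
          rw [this, setIntegral_const, hκ]
          simp only [Measure.real, Real.volume_Ioo]
          rw [ENNReal.toReal_ofReal (by linarith [pi_pos])]
          simp; ring
        · intro r hr θ
          rw [pol_norm hr, mul_one]
      · rw [setIntegral_eq_zero_of_forall_eq_zero (fun x hx => χdn x fun hb => disjoint_left.1 h hb hx), hκ, mul_zero]
    rw [key]; ring

end PartC4

section PartC5
open MeasureTheory Metric Real Set Filter Topology

theorem radii_open {U : Set ℂ} (hU : IsOpen U) : IsOpen {r : ℝ | 0 < r ∧ ∃ z ∈ U, ‖z‖ = r} := by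
  rw [isOpen_iff_mem_nhds]
  rintro r ⟨hr, z, hz, rfl⟩
  obtain ⟨η, hη, h⟩ := sector hU hz
  have h1 : ∀ᶠ s in 𝓝 ‖z‖, |s - ‖z‖| < η := by
    have := Metric.ball_mem_nhds ‖z‖ hη
    filter_upwards [this] with s hs
    exact hs
  filter_upwards [h1, lt_mem_nhds hr] with s hs hs0
  refine ⟨hs0, pol s z.arg, h η hη le_rfl s hs z.arg ?_, pol_norm hs0⟩
  simp [cos_le_one]

theorem lemG_K {Ω : Set ℂ} (ho : IsOpen Ω) (hb : Bornology.IsBounded Ω)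
    (hm : μH[1] (frontier Ω) ≠ ⊤) {p a c d κ : ℝ} (hp0 : 0 ≤ p) (ha : 0 ≤ a) (had : a = 0 → d = 0)
    (hfa : ∀ x ∈ frontier Ω, a ≤ ‖x‖) (hfw : ∀ x ∈ frontier Ω, 0 < ‖x‖ → |Wf p c d ‖x‖| ≤ 1)
    (hκ : (ball 0 a ⊆ Ω ∧ κ = 2*π*d) ∨ (Disjoint (ball 0 a) Ω ∧ κ = 0))
    {f : ℝ → ℝ} (hf : ContDiff ℝ 1 f) (hfs : HasCompactSupport f) (hf0 : ∀ r, 0 ≤ f r) (hf1 : ∀ r, f r ≤ 1)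
    (hsub : ∀ r ∈ tsupport f, 0 < r ∧ |Wf p c d r| < 1 ∧ (∃ z ∈ Ω, ‖z‖ = r) ∧ ∃ y ∈ (closure Ω)ᶜ, ‖y‖ = r) :
    2 * c * volume.real Ω + κ + 2 * ∫ r in Ioi 0, f r * (r^p * √(1 - (Wf p c d r)^2)) ≤
      ∫ x in frontier Ω, ‖x‖^p ∂μH[1] := by
  obtain ⟨A, hAc, hA1, hA2⟩ := exA (c := c) ha had
  set G : ℝ → ℝ := fun r => f r * (r^(p-1) * √(1 - (Wf p c d r)^2)) with hG
  have hGc : ContDiff ℝ 1 G := by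
    rw [contDiff_iff_contDiffAt]
    intro r
    by_cases hr : r ∈ tsupport f
    · obtain ⟨hr0, hw, -⟩ := hsub r hr
      refine hf.contDiffAt.mul (ContDiffAt.mul (contDiffAt_id.rpow_const_of_ne hr0.ne') ?_)
      refine ContDiffAt.sqrt ?_ ?_
      · refine contDiffAt_const.sub (ContDiffAt.pow ?_ 2)
        unfold Wf
        exact (contDiffAt_const.mul (contDiffAt_id.rpow_const_of_ne hr0.ne')).add
          (contDiffAt_const.mul (contDiffAt_id.rpow_const_of_ne hr0.ne'))
      · have := (sq_lt_one_iff_abs_lt_one _).2 hw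
        linarith
    · refine (contDiffAt_const (c := (0:ℝ))).congr_of_eventuallyEq ?_
      have := notMem_tsupport_iff_eventuallyEq.1 hr
      filter_upwards [this] with s hs
      simp only [hG, hs]; simp
  have hGs : HasCompactSupport G := hfs.mul_right
  have hG0 : ∀ r, 0 ≤ r → 0 ≤ G r := fun r hr => by
    have := hf0 r; simp only [hG]; positivity
  have hGz : ∀ r, r ∉ tsupport f → G r = 0 := fun r hr => by
    simp only [hG, image_eq_zero_of_notMem_tsupport hr, zero_mul]
  have hG0' : ∀ r, 0 ≤ G r := by
    intro r
    by_cases hr : r ∈ tsupport f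
    · exact hG0 r (hsub r hr).1.le
    · rw [hGz r hr]
  have hN : Continuous (fun x : ℂ => ‖x‖^p) := continuous_norm.rpow_const fun _ => Or.inr hp0
  have := lemG0 ho hb hm hAc hGc hGs hG0' (fun r hr => by
    obtain ⟨h1, -, h2⟩ := hsub r (tsupport_mul_subset_left hr)
    exact ⟨h1, h2⟩) hN (fun x => by positivity) ?_
  · rw [hA2 Ω κ ho hb hκ] at this
    refine le_trans (le_of_eq ?_) this
    congr 2
    refine setIntegral_congr_fun measurableSet_Ioi ?_
    intro r hr
    simp only [hG]
    have : r^p = r * r^(p-1) := by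
      rw [mul_comm, ← rpow_add_one (ne_of_gt hr)]; congr 1; ring
    rw [this]; ring
  · intro x hx
    rcases (norm_nonneg x).eq_or_lt with h | h
    · rw [← h]; simp only [ne_eq, OfNat.ofNat_ne_zero, not_false_eq_true, zero_pow, zero_mul]; positivity
    · have w1 := hfw x hx h
      set r := ‖x‖ with hr
      rw [hA1 (r^2) (by have := hfa x hx; gcongr) (by positivity)]
      set w := Wf p c d r with hw
      have e1 : r^2 * (c + d/r^2)^2 = (r^p)^2 * w^2 := by
        have h1 : r^(p+1) * w = c*r^2 + d := We_eq h
        rw [rpow_add_one h.ne'] at h1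
        have h2 : r^2 * (c + d/r^2)^2 = (c*r^2+d)^2/r^2 := by field_simp
        rw [h2, ← h1]; field_simp
      have hw2 : w^2 ≤ 1 := (sq_le_one_iff_abs_le_one _).2 w1
      have e2 : r^2 * G r^2 = f r^2 * ((r^p)^2 * (1 - w^2)) := by
        simp only [hG, mul_pow]
        rw [sq_sqrt (by rw [← hw]; linarith)]
        have : r^p = r * r^(p-1) := by
          rw [mul_comm, ← rpow_add_one h.ne']; congr 1; ring
        rw [this]; ring
      rw [mul_add, e1, e2]
      have f1 : f r^2 ≤ 1 := by have := hf0 r; have := hf1 r; nlinarith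
      have : 0 ≤ (r^p)^2 * (1 - w^2) := mul_nonneg (by positivity) (by linarith)
      nlinarith

theorem lemG {Ω : Set ℂ} (ho : IsOpen Ω) (hb : Bornology.IsBounded Ω)
    (hm : μH[1] (frontier Ω) ≠ ⊤) {p a c d κ : ℝ} (hp0 : 0 ≤ p) (ha : 0 ≤ a) (had : a = 0 → d = 0)
    (hfa : ∀ x ∈ frontier Ω, a ≤ ‖x‖) (hfw : ∀ x ∈ frontier Ω, 0 < ‖x‖ → |Wf p c d ‖x‖| ≤ 1)
    (hκ : (ball 0 a ⊆ Ω ∧ κ = 2*π*d) ∨ (Disjoint (ball 0 a) Ω ∧ κ = 0))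
    (hcr : ∀ᵐ r : ℝ, 0 < r → |Wf p c d r| < 1 → (∃ z ∈ Ω, ‖z‖ = r) ∧ ∃ y ∈ (closure Ω)ᶜ, ‖y‖ = r) :
    0 ≤ ((∫ x in frontier Ω, ‖x‖^p ∂μH[1]) - 2 * c * volume.real Ω - κ)/2 ∧
    ∫⁻ r in {r | 0 < r ∧ |Wf p c d r| < 1}, ENNReal.ofReal (r^p * √(1 - (Wf p c d r)^2)) ≤
      ENNReal.ofReal (((∫ x in frontier Ω, ‖x‖^p ∂μH[1]) - 2 * c * volume.real Ω - κ)/2) := by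
  set X := ((∫ x in frontier Ω, ‖x‖^p ∂μH[1]) - 2 * c * volume.real Ω - κ)/2 with hX
  constructor
  · have := lemG_K ho hb hm hp0 ha had hfa hfw hκ (f := fun _ => 0) contDiff_const HasCompactSupport.zero
      (fun _ => le_rfl) (fun _ => zero_le_one) (by
        intro r hr; exfalso
        have h : (fun _ : ℝ => (0:ℝ)) = 0 := rfl
        rw [h, tsupport_zero] at hr; exact hr)
    simp only [zero_mul, integral_zero] at this
    rw [hX]; linarith
  set F : ℝ → ENNReal := fun r => ENNReal.ofReal (r^p * √(1 - (Wf p c d r)^2)) with hF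
  set D : Set ℝ := {r | 0 < r ∧ |Wf p c d r| < 1} with hD
  have hDo : IsOpen D := by
    have : D = Ioi 0 ∩ (fun r => |Wf p c d r|) ⁻¹' (Iio 1) := by ext; simp [hD]
    rw [this]
    exact (Wf_contOn p c d).abs.isOpen_inter_preimage isOpen_Ioi isOpen_Iio
  set O : Set ℝ := D ∩ ({r : ℝ | 0 < r ∧ ∃ z ∈ Ω, ‖z‖ = r} ∩ {r : ℝ | 0 < r ∧ ∃ z ∈ (closure Ω)ᶜ, ‖z‖ = r}) with hO
  have hOo : IsOpen O := hDo.inter ((radii_open ho).inter (radii_open isClosed_closure.isOpen_compl))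
  have hOb : Bornology.IsBounded O := by
    obtain ⟨M, hM⟩ := hb.exists_norm_le
    refine (Metric.isBounded_Icc 0 M).subset ?_
    rintro r ⟨-, ⟨h0, z, hz, rfl⟩, -⟩
    exact ⟨h0.le, hM z hz⟩
  have hae : (volume.restrict D) = volume.restrict O := by
    apply Measure.restrict_congr_set
    filter_upwards [hcr] with r hr
    apply propext
    constructor
    · intro h
      obtain ⟨h1, h2⟩ := hr h.1 h.2
      exact ⟨h, ⟨h.1, h1⟩, h.1, h2⟩
    · intro h; exact h.1
  rw [hae]
  obtain ⟨K, hKc, hKO, hKU, hKm⟩ := hOo.exists_iUnion_isClosed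
  rw [← hKU, setLIntegral_iUnion_of_directed F hKm.directed_le]
  refine iSup_le fun n => ?_
  obtain ⟨f, hf⟩ := SmoothPartitionOfUnity.exists_isSubordinate (modelWithCornersSelf ℝ ℝ) (hKc n)
    (fun _ : Unit => O) (fun _ => hOo) (by intro r hr; exact mem_iUnion.2 ⟨(), hKO n hr⟩)
  have hfc : ContDiff ℝ 1 (f ()) := (f ()).contMDiff.contDiff.of_le (by simp)
  have hfK : ∀ r ∈ K n, f () r = 1 := by
    intro r hr
    have := f.sum_eq_one hr
    rw [finsum_eq_sum_of_fintype] at this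
    simpa using this
  have hfO : tsupport (f ()) ⊆ O := hf ()
  have hfs : HasCompactSupport (f ()) :=
    isCompact_of_isClosed_isBounded (isClosed_tsupport _) (hOb.subset hfO)
  have key := lemG_K ho hb hm hp0 ha had hfa hfw hκ hfc hfs (f.nonneg ()) (f.le_one ()) (by
    intro r hr
    obtain ⟨h1, h2, h3⟩ := hfO hr
    exact ⟨h1.1, h1.2, h2.2, h3.2⟩)
  set g : ℝ → ℝ := fun r => f () r * (r^p * √(1 - (Wf p c d r)^2)) with hg
  have hgi : IntegrableOn g (Ioi 0) := by
    have hgc : Continuous g := by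
      rw [continuous_iff_continuousAt]
      intro r
      by_cases hr : r ∈ tsupport (f ())
      · have h0 := (hfO hr).1.1
        have : ContinuousAt (Wf p c d) r := (Wf_contOn p c d).continuousAt (Ioi_mem_nhds h0)
        exact hfc.continuous.continuousAt.mul ((continuousAt_id.rpow_const (Or.inl (ne_of_gt h0))).mul
          ((continuousAt_const.sub (this.pow 2)).sqrt))
      · have := notMem_tsupport_iff_eventuallyEq.1 hr
        refine (continuousAt_const (y := (0:ℝ))).congr ?_
        filter_upwards [this] with s hs
        simp only [hg, hs]; simp
    exact (hgc.integrable_of_hasCompactSupport hfs.mul_right).integrableOn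
  have hg0 : 0 ≤ᵐ[volume.restrict (Ioi 0)] g := by
    rw [Filter.EventuallyLE, ae_restrict_iff' measurableSet_Ioi]
    refine Eventually.of_forall fun r hr => ?_
    have := f.nonneg () r
    have : 0 < r := hr
    simp only [hg, Pi.zero_apply]; positivity
  calc ∫⁻ r in K n, F r = ∫⁻ r in K n, ENNReal.ofReal (g r) := by
        refine setLIntegral_congr_fun (hKc n).measurableSet ?_
        intro r hr
        simp only [hF, hg, hfK r hr, one_mul]
    _ ≤ ∫⁻ r in Ioi 0, ENNReal.ofReal (g r) :=
        lintegral_mono_set fun r hr => (hKO n hr).1.1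
    _ = ENNReal.ofReal (∫ r in Ioi 0, g r) := (ofReal_integral_eq_lintegral_ofReal hgi hg0).symm
    _ ≤ ENNReal.ofReal X := by
        apply ENNReal.ofReal_le_ofReal
        rw [hX]; linarith

end PartC5

section PartD0
open MeasureTheory Metric Real Set Filter Topology

theorem vol_ball_real (a : ℂ) {r : ℝ} (hr : 0 ≤ r) : volume.real (ball a r) = π * r^2 := by
  rw [Measure.real, Complex.volume_ball, ENNReal.toReal_mul, ENNReal.toReal_pow, ENNReal.toReal_ofReal hr]
  simp [mul_comm]

theorem bathtub {Ω : Set ℂ} (ho : IsOpen Ω) (hb : Bornology.IsBounded Ω) {k : ℂ → ℝ} (hk : Continuous k)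
    {R : ℝ} (h1 : ∀ x, ‖x‖ < R → k x ≤ 0) (h2 : ∀ x, R ≤ ‖x‖ → 0 ≤ k x) :
    ∫ x in ball 0 R, k x ≤ ∫ x in Ω, k x := by
  have iΩ := intOn_bdd hb hk
  have iB := intOn_bdd (isBounded_ball (x := (0:ℂ)) (r := R)) hk
  rw [← integral_indicator measurableSet_ball, ← integral_indicator ho.measurableSet]
  refine integral_mono (iB.integrable_indicator measurableSet_ball) (iΩ.integrable_indicator ho.measurableSet) ?_
  intro x
  by_cases hx : ‖x‖ < R
  · have := h1 x hx
    rw [indicator_of_mem (by simpa using hx)]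
    by_cases hO : x ∈ Ω
    · rw [indicator_of_mem hO]
    · rw [indicator_of_notMem hO]; exact this
  · have := h2 x (not_lt.1 hx)
    rw [indicator_of_notMem (by simpa using hx)]
    by_cases hO : x ∈ Ω
    · rw [indicator_of_mem hO]; exact this
    · rw [indicator_of_notMem hO]

theorem ball_int {A : ℝ → ℝ} (hA : ContDiff ℝ 1 A) {R : ℝ} (hR : 0 ≤ R) :
    ∫ x in ball (0:ℂ) R, (2 * A (‖x‖^2) + 2 * (‖x‖^2 * deriv A (‖x‖^2))) = 2 * π * (R^2 * A (R^2)) := by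
  have hc := hA.continuous
  have hd := hA.continuous_deriv le_rfl
  rw [← integral_indicator measurableSet_ball]
  rw [polar_split _ ((Iio R).indicator (fun r => r * (2 * A (r^2) + 2 * (r^2 * deriv A (r^2))))) (fun _ => 1)]
  · rw [setIntegral_indicator measurableSet_Iio, Ioi_inter_Iio, ← integral_Ioc_eq_integral_Ioo,
      ← intervalIntegral.integral_of_le hR]
    rw [intervalIntegral.integral_eq_sub_of_hasDerivAt (f := fun r => r^2 * A (r^2))]
    · rw [setIntegral_const]
      simp only [Measure.real, Real.volume_Ioo]
      rw [ENNReal.toReal_ofReal (by linarith [pi_pos])]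
      simp; ring
    · intro r _
      have := (hasDerivAt_pow 2 r).mul ((hA.differentiable one_ne_zero (r^2)).hasDerivAt.comp r (hasDerivAt_pow 2 r))
      refine this.congr_deriv ?_
      simp; ring
    · exact Continuous.intervalIntegrable (by fun_prop) _ _
  · intro r hr θ
    by_cases h : r < R
    · rw [indicator_of_mem (by simpa [pol_norm hr] using h), indicator_of_mem (mem_Iio.2 h), pol_norm hr, mul_one]
    · rw [indicator_of_notMem (by simpa [pol_norm hr] using h), indicator_of_notMem (by simpa using h)]; simp

theorem ge1_eps {Ω : Set ℂ} (ho : IsOpen Ω) (hb : Bornology.IsBounded Ω)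
    (hm : μH[1] (frontier Ω) ≠ ⊤) {p ε : ℝ} (hp : 1 ≤ p) (hε : 0 < ε) :
    2 * π * (volume.real Ω / π * ((volume.real Ω / π)^2 + ε)^((p-1)/4)) ≤
      ∫ x in frontier Ω, (‖x‖^4 + ε)^(p/4) ∂μH[1] := by
  set s := volume.real Ω / π with hs
  have hs0 : 0 ≤ s := by positivity
  set R := √s with hR
  have hR0 : 0 ≤ R := sqrt_nonneg _
  have hR2 : R^2 = s := sq_sqrt hs0
  set q := (p-1)/4 with hq
  have hq0 : 0 ≤ q := by rw [hq]; linarith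
  have hpos : ∀ v : ℝ, 0 < v^2 + ε := fun v => by positivity
  set A : ℝ → ℝ := fun v => (v^2+ε)^q with hA
  have hAc : ContDiff ℝ 1 A := ContDiff.rpow_const_of_ne (by fun_prop) fun v => (hpos v).ne'
  have hAd : ∀ v, deriv A v = 2 * v * q * (v^2+ε)^(q-1) := by
    intro v
    have : HasDerivAt (fun v : ℝ => v^2 + ε) (2*v) v := by
      have := (hasDerivAt_pow 2 v).add_const ε
      refine this.congr_deriv ?_
      simp
    exact (this.rpow_const (Or.inl (hpos v).ne')).deriv
  set h : ℝ → ℝ := fun v => 2 * A v + 2 * (v * deriv A v) with hh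
  have hform : ∀ v, h v = 2 * (v^2+ε)^q * (1 + 2 * q * (1 - ε/(v^2+ε))) := by
    intro v
    simp only [hh, hAd]
    simp only [hA]
    rw [rpow_sub_one (hpos v).ne']
    have := (hpos v).ne'
    field_simp; ring
  have hmono : ∀ v w, 0 ≤ v → v ≤ w → h v ≤ h w := by
    intro v w hv hvw
    rw [hform, hform]
    have a1 := hpos v
    have a2 := hpos w
    have a3 : v^2 + ε ≤ w^2 + ε := by gcongr
    have a4 : (v^2+ε)^q ≤ (w^2+ε)^q := rpow_le_rpow a1.le a3 hq0
    have a5 : ε/(w^2+ε) ≤ ε/(v^2+ε) := by gcongr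
    have a6 : ε/(v^2+ε) ≤ 1 := by rw [div_le_one a1]; nlinarith
    have a7 : 0 ≤ 1 + 2 * q * (1 - ε/(v^2+ε)) := by
      have : 0 ≤ 1 - ε/(v^2+ε) := by linarith
      positivity
    apply mul_le_mul _ _ a7 (by positivity)
    · linarith
    · gcongr
  have hcont : Continuous (fun x : ℂ => h (‖x‖^2)) := by
    have := hAc.continuous
    have := hAc.continuous_deriv le_rfl
    simp only [hh]; fun_prop
  have hvol : volume.real (ball (0:ℂ) R) = volume.real Ω := by
    rw [vol_ball_real _ hR0, hR2, hs]; field_simp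
  have key := bathtub ho hb (k := fun x => h (‖x‖^2) - h (R^2)) (by fun_prop) (R := R)
    (fun x hx => sub_nonpos.2 (hmono _ _ (by positivity) (by gcongr)))
    (fun x hx => sub_nonneg.2 (hmono _ _ (by positivity) (by gcongr)))
  rw [integral_sub (intOn_bdd isBounded_ball hcont) (intOn_bdd isBounded_ball continuous_const),
    integral_sub (intOn_bdd hb hcont) (intOn_bdd hb continuous_const), setIntegral_const, setIntegral_const,
    hvol] at key
  have hball : ∫ x in ball (0:ℂ) R, h (‖x‖^2) = 2 * π * (R^2 * A (R^2)) := ball_int hAc hR0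
  have hN : Continuous (fun x : ℂ => (‖x‖^4 + ε)^(p/4)) :=
    Continuous.rpow_const (by fun_prop) fun x => Or.inr (by linarith)
  have main := lemG0 ho hb hm hAc (G := fun _ => 0) contDiff_const HasCompactSupport.zero
    (fun _ => le_rfl) (by
        intro r hr; exfalso
        have h : (fun _ : ℝ => (0:ℝ)) = 0 := rfl
        rw [h, tsupport_zero] at hr; exact hr) hN (fun x => by positivity) (by
      intro x _
      have e0 : 0 < ‖x‖^4 + ε := by positivity
      have e1 : (((‖x‖^4+ε)^(p/4))^2 : ℝ) = (‖x‖^4+ε)^((1:ℝ)/2) * ((‖x‖^4+ε)^q)^2 := by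
        generalize ‖x‖^4 + ε = y at e0
        rw [← rpow_natCast, ← rpow_natCast, ← rpow_mul e0.le, ← rpow_mul e0.le, ← rpow_add e0]
        congr 1; rw [hq]; push_cast; ring
      rw [e1]
      simp only [hA]
      rw [show (‖x‖^2)^2 = ‖x‖^4 by ring, zero_pow two_ne_zero, add_zero]
      gcongr
      rw [← sqrt_eq_rpow]
      apply le_sqrt_of_sq_le
      nlinarith)
  simp only [mul_zero, integral_zero, add_zero] at main
  have main' : ∫ x in Ω, h (‖x‖^2) ≤ ∫ x in frontier Ω, (‖x‖^4 + ε)^(p/4) ∂μH[1] := main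
  rw [hR2] at hball
  simp only [hA] at hball
  linarith

theorem case_ge1 {Ω : Set ℂ} (ho : IsOpen Ω) (hb : Bornology.IsBounded Ω)
    (hm : μH[1] (frontier Ω) ≠ ⊤) {p : ℝ} (hp : 1 ≤ p) :
    2 * π * (volume.real Ω / π)^((p+1)/2) ≤ ∫ x in frontier Ω, ‖x‖^p ∂μH[1] := by
  set s := volume.real Ω / π with hs
  have hs0 : 0 ≤ s := by positivity
  have t1 : Tendsto (fun ε : ℝ => 2 * π * (s * (s^2 + ε)^((p-1)/4))) (𝓝[>] 0)
      (𝓝 (2 * π * (s * (s^2+0)^((p-1)/4)))) := by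
    have : Continuous (fun ε : ℝ => 2 * π * (s * (s^2 + ε)^((p-1)/4))) := by
      refine continuous_const.mul (continuous_const.mul ?_)
      exact Continuous.rpow_const (by fun_prop) fun x => Or.inr (by linarith)
    exact (this.tendsto 0).mono_left nhdsWithin_le_nhds
  obtain ⟨M, hM⟩ := (hb.closure.subset frontier_subset_closure : Bornology.IsBounded (frontier Ω)).exists_norm_le
  have t2 : Tendsto (fun ε : ℝ => ∫ x in frontier Ω, (‖x‖^4 + ε)^(p/4) ∂μH[1]) (𝓝[>] 0)
      (𝓝 (∫ x in frontier Ω, ‖x‖^p ∂μH[1])) := by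
    refine tendsto_integral_filter_of_dominated_convergence (fun _ => (M^4+1)^(p/4)) ?_ ?_ ?_ ?_
    · filter_upwards with ε
      exact (Continuous.rpow_const (by fun_prop) fun x => Or.inr (by linarith)).aestronglyMeasurable
    · filter_upwards [Ioo_mem_nhdsGT (zero_lt_one' ℝ)] with ε hε
      rw [ae_restrict_iff' isClosed_frontier.measurableSet]
      refine Eventually.of_forall fun x hx => ?_
      have h0 : 0 ≤ ‖x‖^4 + ε := by have := hε.1; positivity
      rw [Real.norm_of_nonneg (rpow_nonneg h0 _)]
      apply rpow_le_rpow h0 _ (by linarith)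
      have := hM x hx
      have := hε.2.le
      gcongr
    · exact intOn_frontier hb hm continuous_const
    · refine Eventually.of_forall fun x => ?_
      have : Continuous (fun ε : ℝ => (‖x‖^4 + ε)^(p/4)) :=
        Continuous.rpow_const (by fun_prop) fun x => Or.inr (by linarith)
      have h := (this.tendsto 0).mono_left (nhdsWithin_le_nhds (s := Ioi 0))
      have e : (‖x‖^4 + 0)^(p/4) = ‖x‖^p := by
        rw [add_zero, ← rpow_natCast, ← rpow_mul (norm_nonneg _)]; congr 1; push_cast; ring
      rw [e] at h; exact h
  have hle := le_of_tendsto_of_tendsto t1 t2 (by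
    filter_upwards [self_mem_nhdsWithin] with ε hε
    exact ge1_eps ho hb hm hp hε)
  have e : s * (s^2+0)^((p-1)/4) = s^((p+1)/2) := by
    rw [add_zero, ← rpow_natCast s 2, ← rpow_mul hs0]
    rw [show (p+1)/2 = 1 + (p-1)/2 by ring, rpow_one_add' hs0 (by linarith)]
    congr 2; push_cast; ring
  rwa [e] at hle

end PartD0

section PartD1
open MeasureTheory Metric Real Set Filter Topology

theorem concave_chord {f : ℝ → ℝ} (hf : ConcaveOn ℝ (Ici 0) f) {u v c d x : ℝ} (hu : 0 ≤ u) (huv : u < v)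
    (h1 : f u = c * u + d) (h2 : f v = c * v + d) (hx : 0 ≤ x) :
    (u ≤ x → x ≤ v → c * x + d ≤ f x) ∧ (c * x + d < f x → u < x ∧ x < v) := by
  set g : ℝ → ℝ := fun x => f x + (-c * x - d) with hg
  have hgc : ConcaveOn ℝ (Ici 0) g := by
    refine hf.add ⟨convex_Ici 0, ?_⟩
    intro x _ y _ α β _ _ hαβ
    simp only [smul_eq_mul]
    refine le_of_eq ?_
    linear_combination (-d) * hαβ
  have g1 : g u = 0 := by simp only [hg, h1]; ring
  have g2 : g v = 0 := by simp only [hg, h2]; ring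
  have hv : 0 ≤ v := hu.trans huv.le
  constructor
  · intro a b
    have := hgc.min_le_of_mem_Icc (mem_Ici.2 hu) (mem_Ici.2 hv) ⟨a, b⟩
    rw [g1, g2, min_self] at this
    simp only [hg] at this; linarith
  · intro h
    have hgx : 0 < g x := by simp only [hg]; linarith
    constructor
    · by_contra hc
      push Not at hc
      rcases hc.eq_or_lt with h | h
      · rw [h, g1] at hgx; exact lt_irrefl _ hgx
      · have := hgc.slope_anti_adjacent (mem_Ici.2 hx) (mem_Ici.2 hv) h huv
        rw [g1, g2, sub_zero, zero_div, le_div_iff₀ (by linarith)] at this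
        linarith
    · by_contra hc
      push Not at hc
      rcases hc.eq_or_lt with h | h
      · rw [← h, g2] at hgx; exact lt_irrefl _ hgx
      · have := hgc.slope_anti_adjacent (mem_Ici.2 hu) (mem_Ici.2 hx) huv h
        rw [g1, g2, sub_zero, sub_zero, zero_div, div_le_iff₀ (by linarith)] at this
        linarith

theorem sq_rpow_half {r p : ℝ} (hr : 0 ≤ r) : (r^2)^((p+1)/2) = r^(p+1) := by
  rw [← rpow_natCast, ← rpow_mul hr]; congr 1; push_cast; ring

theorem Wf_le_one_iff {p c d r : ℝ} (hr : 0 < r) : Wf p c d r ≤ 1 ↔ c * r^2 + d ≤ r^(p+1) := by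
  have := We_eq (p := p) (c := c) (e := d) hr
  have h : 0 < r^(p+1) := by positivity
  rw [← this]
  constructor
  · intro h1; exact mul_le_of_le_one_right h.le h1
  · intro h1; by_contra hc; push Not at hc
    have := lt_mul_of_one_lt_right h hc
    linarith

theorem Wf_nonneg {p c d r : ℝ} (hc : 0 ≤ c) (hd : 0 ≤ d) (hr : 0 < r) : 0 ≤ Wf p c d r := by
  unfold Wf; positivity

section
variable {Ω : Set ℂ} {p a b : ℝ}

theorem baseF (ho : IsOpen Ω) (hb : Bornology.IsBounded Ω)
    (hm : μH[1] (frontier Ω) ≠ ⊤) (hp0 : 0 ≤ p) (hp1 : p < 1) (hV : 0 < volume.real Ω) (ha : 0 ≤ a) (hab : a < b)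
    (hfr : ∀ x ∈ frontier Ω, a ≤ ‖x‖ ∧ ‖x‖ ≤ b)
    (hball : ball 0 a ⊆ Ω)
    (hcr : ∀ᵐ r : ℝ, a < r → r < b → (∃ z ∈ Ω, ‖z‖ = r) ∧ ∃ y ∈ (closure Ω)ᶜ, ‖y‖ = r) :
    2 * π * (volume.real Ω / π)^((p+1)/2) ≤ ∫ x in frontier Ω, ‖x‖^p ∂μH[1] := by
  have hb0 : 0 < b := ha.trans_lt hab
  have hb2 : a^2 < b^2 := by gcongr
  have hden : 0 < b^2 - a^2 := by linarith
  have hpw : a^(p+1) < b^(p+1) := rpow_lt_rpow ha hab (by linarith)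
  set c := (b^(p+1) - a^(p+1))/(b^2 - a^2) with hc
  have hc0 : 0 < c := div_pos (by linarith) hden
  set d := a^(p+1) - c * a^2 with hd
  have hda : a = 0 → d = 0 := by
    intro h; rw [hd, h, zero_rpow (by linarith)]; ring
  have hcb : b^(p+1) = c * b^2 + d := by
    rw [hd, hc]; field_simp; ring
  have hconc : ConcaveOn ℝ (Ici 0) (fun v : ℝ => v^((p+1)/2)) :=
    Real.concaveOn_rpow (by linarith) (by linarith)
  have hch := fun {x : ℝ} (hx : 0 ≤ x) => concave_chord hconc (u := a^2) (v := b^2) (c := c) (d := d) (x := x) (by positivity) hb2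
    (by rw [sq_rpow_half ha, hd]; ring) (by rw [sq_rpow_half hb0.le, hcb]) hx
  have hd0 : 0 ≤ d := by
    by_contra hneg
    push Not at hneg
    rcases ha.eq_or_lt with h | h
    · rw [hda h.symm] at hneg; exact lt_irrefl _ hneg
    · have := (hch (x := 0) le_rfl).2 (by
        rw [zero_rpow (by linarith)]; linarith)
      have h2 := this.1
      have : 0 < a^2 := by positivity
      linarith
  have hW1 : ∀ r, 0 < r → a ≤ r → r ≤ b → |Wf p c d r| ≤ 1 := by
    intro r hr h1 h2
    rw [abs_of_nonneg (Wf_nonneg hc0.le hd0 hr), Wf_le_one_iff hr, ← sq_rpow_half hr.le]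
    exact (hch (by positivity)).1 (by gcongr) (by gcongr)
  have hW2 : ∀ r, 0 < r → |Wf p c d r| < 1 → a < r ∧ r < b := by
    intro r hr h
    rw [abs_of_nonneg (Wf_nonneg hc0.le hd0 hr), Wf_lt_one_iff hr, ← sq_rpow_half hr.le] at h
    obtain ⟨h1, h2⟩ := (hch (x := r^2) (by positivity)).2 (by linarith)
    exact ⟨lt_of_pow_lt_pow_left₀ 2 hr.le h1, lt_of_pow_lt_pow_left₀ 2 hb0.le h2⟩
  obtain ⟨k1, k2⟩ := lemG ho hb hm hp0 ha hda (fun x hx => (hfr x hx).1)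
    (fun x hx h => hW1 _ h (hfr x hx).1 (hfr x hx).2) (Or.inl ⟨hball, rfl⟩) (by
      filter_upwards [hcr] with r hr h0 h1
      exact hr (hW2 r h0 h1).1 (hW2 r h0 h1).2)
  set s := volume.real Ω / π with hs
  have hs0 : 0 < s := by positivity
  have hR : 0 < √s := sqrt_pos.2 hs0
  have k3 := lemF hp0 hp1 hc0 hd0 hR
  have hset : {r : ℝ | 0 < r ∧ Wf p c d r < 1} = {r | 0 < r ∧ |Wf p c d r| < 1} := by
    ext r
    constructor
    · rintro ⟨h1, h2⟩; exact ⟨h1, by rwa [abs_of_nonneg (Wf_nonneg hc0.le hd0 h1)]⟩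
    · rintro ⟨h1, h2⟩; exact ⟨h1, (le_abs_self _).trans_lt h2⟩
  rw [hset] at k3
  have k4 := (ENNReal.ofReal_le_ofReal_iff k1).1 (k3.trans k2)
  have e1 : √s^(p+1) = s^((p+1)/2) := by rw [← sq_rpow_half hR.le, sq_sqrt hs0.le]
  rw [e1, sq_sqrt hs0.le] at k4
  have e2 : volume.real Ω = π * s := by rw [hs]; field_simp
  rw [e2] at k4
  linarith

theorem baseE (ho : IsOpen Ω) (hb : Bornology.IsBounded Ω)
    (hm : μH[1] (frontier Ω) ≠ ⊤) (hp0 : 0 ≤ p) (hp1 : p < 1) (hV : 0 < volume.real Ω) (ha : 0 < a) (hab : a < b)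
    (hfr : ∀ x ∈ frontier Ω, a ≤ ‖x‖ ∧ ‖x‖ ≤ b)
    (hball : Disjoint (ball 0 a) Ω)
    (hcr : ∀ᵐ r : ℝ, a < r → r < b → (∃ z ∈ Ω, ‖z‖ = r) ∧ ∃ y ∈ (closure Ω)ᶜ, ‖y‖ = r) :
    2 * π * (volume.real Ω / π)^((p+1)/2) ≤ ∫ x in frontier Ω, ‖x‖^p ∂μH[1] := by
  have hb0 : 0 < b := ha.trans hab
  have hb2 : a^2 < b^2 := by gcongr
  have hden : 0 < b^2 - a^2 := by linarith
  set c := (b^(p+1) + a^(p+1))/(b^2 - a^2) with hc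
  have hc0 : 0 < c := div_pos (by positivity) hden
  set e := c * a^2 + a^(p+1) with he
  have he0 : 0 ≤ e := by positivity
  have hmono := We_mono hp0 hp1 hc0 he0
  have hWa : Wf p c (-e) a = -1 := by
    have := We_eq (p := p) (c := c) (e := -e) ha
    have h : 0 < a^(p+1) := by positivity
    have : a^(p+1) * Wf p c (-e) a = a^(p+1) * (-1) := by rw [this, he]; ring
    exact mul_left_cancel₀ h.ne' this
  have hWb : Wf p c (-e) b = 1 := by
    have := We_eq (p := p) (c := c) (e := -e) hb0
    have h : 0 < b^(p+1) := by positivity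
    have : b^(p+1) * Wf p c (-e) b = b^(p+1) * 1 := by
      rw [this, he, hc]; field_simp; ring
    exact mul_left_cancel₀ h.ne' this
  have hW1 : ∀ r, a ≤ r → r ≤ b → |Wf p c (-e) r| ≤ 1 := by
    intro r h1 h2
    have hr : 0 < r := ha.trans_le h1
    have m1 := hmono.monotoneOn (mem_Ioi.2 ha) (mem_Ioi.2 hr) h1
    have m2 := hmono.monotoneOn (mem_Ioi.2 hr) (mem_Ioi.2 hb0) h2
    rw [hWa] at m1
    rw [hWb] at m2
    exact abs_le.2 ⟨m1, m2⟩
  have hW2 : ∀ r, 0 < r → |Wf p c (-e) r| < 1 → a < r ∧ r < b := by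
    intro r hr h
    rw [abs_lt] at h
    constructor
    · by_contra hcon
      have := hmono.monotoneOn (mem_Ioi.2 hr) (mem_Ioi.2 ha) (not_lt.1 hcon)
      linarith
    · by_contra hcon
      have := hmono.monotoneOn (mem_Ioi.2 hb0) (mem_Ioi.2 hr) (not_lt.1 hcon)
      linarith
  obtain ⟨k1, k2⟩ := lemG (d := -e) ho hb hm hp0 ha.le (fun h => absurd h ha.ne') (fun x hx => (hfr x hx).1)
    (fun x hx h => hW1 _ (hfr x hx).1 (hfr x hx).2) (Or.inr ⟨hball, rfl⟩) (by
      filter_upwards [hcr] with r hr h0 h1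
      exact hr (hW2 r h0 h1).1 (hW2 r h0 h1).2)
  set s := volume.real Ω / π with hs
  have hs0 : 0 < s := by positivity
  have hR : 0 < √s := sqrt_pos.2 hs0
  have k3 := lemE hp0 hp1 hc0 he0 hR
  have k4 := (ENNReal.ofReal_le_ofReal_iff k1).1 (k3.trans k2)
  have e1 : √s^(p+1) = s^((p+1)/2) := by rw [← sq_rpow_half hR.le, sq_sqrt hs0.le]
  rw [e1, sq_sqrt hs0.le] at k4
  have e2 : volume.real Ω = π * s := by rw [hs]; field_simp
  rw [e2] at k4
  linarith

theorem baseD (ho : IsOpen Ω) (hb : Bornology.IsBounded Ω)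
    (hm : μH[1] (frontier Ω) ≠ ⊤) (hp0 : 0 ≤ p) (ha : 0 < a)
    (hfr : ∀ x ∈ frontier Ω, ‖x‖ = a) (hball : ball 0 a ⊆ Ω) (hball2 : Ω ⊆ closedBall 0 a) :
    2 * π * (volume.real Ω / π)^((p+1)/2) ≤ ∫ x in frontier Ω, ‖x‖^p ∂μH[1] := by
  have hvol : volume.real Ω = π * a^2 := by
    rw [← vol_ball_real 0 ha.le]
    apply le_antisymm
    · rw [← Measure.addHaar_real_closedBall_eq_addHaar_real_ball]
      exact measureReal_mono hball2 measure_closedBall_lt_top.ne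
    · exact measureReal_mono hball hb.measure_lt_top.ne
  have := lemG_K ho hb hm (c := a^(p-1)) (d := 0) (a := a) hp0 ha.le (fun _ => rfl) (fun x hx => (hfr x hx).ge)
    (fun x hx _ => by
      rw [hfr x hx, Wf, ← rpow_add ha]; simp) (Or.inl ⟨hball, rfl⟩) (f := fun _ => 0) contDiff_const HasCompactSupport.zero
      (fun _ => le_rfl) (fun _ => zero_le_one) (by
        intro r hr; exfalso
        have h : (fun _ : ℝ => (0:ℝ)) = 0 := rfl
        rw [h, tsupport_zero] at hr; exact hr)
  simp only [zero_mul, integral_zero, mul_zero, add_zero] at this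
  refine le_trans (le_of_eq ?_) this
  rw [hvol, mul_div_cancel_left₀ _ pi_ne_zero, sq_rpow_half ha.le]
  have : a^(p+1) = a^(p-1) * a^2 := by
    rw [← rpow_natCast a 2, ← rpow_add ha]; congr 1; push_cast; ring
  rw [this]; ring
end

theorem base {Ω : Set ℂ} {p a b : ℝ} (ho : IsOpen Ω) (hb : Bornology.IsBounded Ω)
    (hm : μH[1] (frontier Ω) ≠ ⊤) (hp0 : 0 ≤ p) (hp1 : p < 1) (ha : 0 ≤ a) (hab : a ≤ b)
    (hΩb : ∀ z ∈ Ω, ‖z‖ ≤ b) (hball : ball 0 a ⊆ Ω ∨ Disjoint (ball 0 a) Ω)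
    (hext : ∀ r, a < r → ∃ y ∈ (closure Ω)ᶜ, ‖y‖ = r)
    (hmeet : ∀ᵐ r : ℝ, a < r → r < b → ∃ z ∈ Ω, ‖z‖ = r) :
    2 * π * (volume.real Ω / π)^((p+1)/2) ≤ ∫ x in frontier Ω, ‖x‖^p ∂μH[1] := by
  rcases (measureReal_nonneg (μ := volume) (s := Ω)).eq_or_lt with h0 | hV
  · rw [← h0, zero_div, zero_rpow (by linarith), mul_zero]
    exact integral_nonneg fun x => by positivity
  have hcl : closure Ω ⊆ closedBall 0 b :=
    closure_minimal (fun z hz => mem_closedBall_zero_iff.2 (hΩb z hz)) isClosed_closedBall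
  have hfr : ∀ x ∈ frontier Ω, a ≤ ‖x‖ ∧ ‖x‖ ≤ b := by
    intro x hx
    refine ⟨?_, mem_closedBall_zero_iff.1 (hcl hx.1)⟩
    by_contra hlt
    have hxb : x ∈ ball (0:ℂ) a := mem_ball_zero_iff.2 (not_le.1 hlt)
    rcases hball with h | h
    · rw [ho.frontier_eq] at hx; exact hx.2 (h hxb)
    · exact disjoint_left.1 (h.closure_right isOpen_ball) hxb hx.1
  have hcr : ∀ᵐ r : ℝ, a < r → r < b → (∃ z ∈ Ω, ‖z‖ = r) ∧ ∃ y ∈ (closure Ω)ᶜ, ‖y‖ = r := by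
    filter_upwards [hmeet] with r hr h1 h2
    exact ⟨hr h1 h2, hext r h1⟩
  rcases hab.eq_or_lt with h | hlt
  · subst h
    rcases ha.eq_or_lt with h | ha0
    · exfalso
      subst h
      have : Ω ⊆ {0} := by
        intro z hz; have := hΩb z hz; simpa using this
      have h1 : volume.real Ω ≤ volume.real ({0}:Set ℂ) := measureReal_mono this (by simp)
      simp [Measure.real] at h1 hV
      linarith
    · rcases hball with h | h
      · exact baseD ho hb hm hp0 ha0 (fun x hx => le_antisymm (hfr x hx).2 (hfr x hx).1) h (subset_closure.trans hcl)
      · exfalso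
        have : Ω ⊆ sphere 0 a := by
          intro z hz
          rw [mem_sphere_zero_iff_norm]
          refine le_antisymm (hΩb z hz) ?_
          by_contra hc
          exact disjoint_left.1 h (mem_ball_zero_iff.2 (not_le.1 hc)) hz
        have h2 : volume Ω = 0 := measure_mono_null this (Measure.addHaar_sphere _ _ _)
        rw [Measure.real, h2] at hV
        simp at hV
  · rcases hball with h | h
    · exact baseF ho hb hm hp0 hp1 hV ha hlt hfr h hcr
    · rcases ha.eq_or_lt with h' | ha0
      · exact baseF ho hb hm hp0 hp1 hV ha hlt hfr (by rw [← h']; simp) hcr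
      · exact baseE ho hb hm hp0 hp1 hV ha0 hlt hfr h hcr

end PartD1

section PartD2
open MeasureTheory Metric Real Set Filter Topology

theorem frontier_sub_of_compl_split {X : Type*} [TopologicalSpace X] {Ω U F : Set X} (ho : IsOpen Ω)
    (hU : IsOpen U) (hF : IsClosed F) (hUF : U ⊆ F) (h : Ω ∩ F ⊆ U) :
    frontier (Ω ∩ U) ⊆ frontier Ω ∩ F := by
  intro x hx
  rw [(ho.inter hU).frontier_eq] at hx
  have h1 : x ∈ closure Ω := closure_mono inter_subset_left hx.1
  have h2 : x ∈ F := closure_minimal (inter_subset_right.trans hUF) hF hx.1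
  refine ⟨?_, h2⟩
  rw [ho.frontier_eq]
  exact ⟨h1, fun h3 => hx.2 ⟨h3, h ⟨h3, h2⟩⟩⟩

theorem wt_cont {p : ℝ} (hp : 0 ≤ p) : Continuous (fun x : ℂ => ‖x‖^p) :=
  continuous_norm.rpow_const (fun _ => Or.inr hp)

theorem split_step {Ω : Set ℂ} {p t : ℝ} (ho : IsOpen Ω) (hb : Bornology.IsBounded Ω)
    (hm : μH[1] (frontier Ω) ≠ ⊤) (hp0 : 0 ≤ p) (hp1 : p < 1)
    (ht : ∀ z ∈ Ω, ‖z‖ ≠ t) (hs : μH[1] (frontier Ω ∩ sphere 0 t) = 0)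
    (T1 : μH[1] (frontier (Ω ∩ ball 0 t)) ≠ ⊤ → 2 * π * (volume.real (Ω ∩ ball 0 t) / π)^((p+1)/2) ≤ ∫ x in frontier (Ω ∩ ball 0 t), ‖x‖^p ∂μH[1])
    (T2 : μH[1] (frontier (Ω ∩ (closedBall 0 t)ᶜ)) ≠ ⊤ → 2 * π * (volume.real (Ω ∩ (closedBall 0 t)ᶜ) / π)^((p+1)/2) ≤ ∫ x in frontier (Ω ∩ (closedBall 0 t)ᶜ), ‖x‖^p ∂μH[1]) :
    2 * π * (volume.real Ω / π)^((p+1)/2) ≤ ∫ x in frontier Ω, ‖x‖^p ∂μH[1] := by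
  have f1 : frontier (Ω ∩ ball 0 t) ⊆ frontier Ω ∩ closedBall 0 t := by
    refine frontier_sub_of_compl_split ho isOpen_ball isClosed_closedBall ball_subset_closedBall ?_
    rintro x ⟨h1, h2⟩
    exact mem_ball_zero_iff.2 (lt_of_le_of_ne (mem_closedBall_zero_iff.1 h2) (ht x h1))
  have f2 : frontier (Ω ∩ (closedBall 0 t)ᶜ) ⊆ frontier Ω ∩ (ball 0 t)ᶜ := by
    refine frontier_sub_of_compl_split ho isClosed_closedBall.isOpen_compl isOpen_ball.isClosed_compl
      (compl_subset_compl.2 ball_subset_closedBall) ?_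
    rintro x ⟨h1, h2⟩ h3
    exact h2 (mem_ball_zero_iff.2 (lt_of_le_of_ne (mem_closedBall_zero_iff.1 h3) (ht x h1)))
  have hvol : volume.real Ω = volume.real (Ω ∩ ball 0 t) + volume.real (Ω ∩ (closedBall 0 t)ᶜ) := by
    have : Ω ∩ ball 0 t = Ω ∩ closedBall 0 t := by
      ext x
      refine ⟨fun h => ⟨h.1, ball_subset_closedBall h.2⟩, fun h => ⟨h.1, ?_⟩⟩
      exact mem_ball_zero_iff.2 (lt_of_le_of_ne (mem_closedBall_zero_iff.1 h.2) (ht x h.1))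
    rw [this, ← sdiff_eq]
    exact (measureReal_inter_add_sdiff measurableSet_closedBall hb.measure_lt_top.ne).symm
  have k1 := T1 ((measure_mono (f1.trans inter_subset_left)).trans_lt hm.lt_top).ne
  have k2 := T2 ((measure_mono (f2.trans inter_subset_left)).trans_lt hm.lt_top).ne
  have hInt : IntegrableOn (fun x : ℂ => ‖x‖^p) (frontier Ω) μH[1] := intOn_frontier hb hm (wt_cont hp0)
  have hnn : ∀ S : Set ℂ, 0 ≤ᵐ[μH[1].restrict S] fun x : ℂ => ‖x‖^p := fun S =>
    ae_of_all _ fun x => by positivity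
  have m1 := setIntegral_mono_set (hInt.mono_set inter_subset_left) (hnn _) f1.eventuallyLE
  have m2 : ∫ x in frontier (Ω ∩ (closedBall 0 t)ᶜ), ‖x‖^p ∂μH[1] ≤ ∫ x in frontier Ω \ closedBall 0 t, ‖x‖^p ∂μH[1] := by
    refine setIntegral_mono_set (hInt.mono_set sdiff_subset) (hnn _) ?_
    have : frontier (Ω ∩ (closedBall 0 t)ᶜ) ⊆ (frontier Ω \ closedBall 0 t) ∪ (frontier Ω ∩ sphere 0 t) := by
      intro x hx
      obtain ⟨h1, h2⟩ := f2 hx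
      by_cases h3 : x ∈ closedBall (0:ℂ) t
      · refine Or.inr ⟨h1, ?_⟩
        rw [mem_sphere_zero_iff_norm]
        rw [mem_closedBall_zero_iff] at h3
        rw [mem_compl_iff, mem_ball_zero_iff] at h2
        linarith
      · exact Or.inl ⟨h1, h3⟩
    refine this.eventuallyLE.trans ?_
    exact (union_ae_eq_left_of_ae_eq_empty (ae_eq_empty.2 hs)).le
  have hsum : ∫ x in frontier Ω ∩ closedBall 0 t, ‖x‖^p ∂μH[1] + ∫ x in frontier Ω \ closedBall 0 t, ‖x‖^p ∂μH[1] = ∫ x in frontier Ω, ‖x‖^p ∂μH[1] :=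
    integral_inter_add_sdiff measurableSet_closedBall hInt
  rw [hvol, add_div]
  have := Real.rpow_add_le_add_rpow (p := (p+1)/2) (a := volume.real (Ω ∩ ball 0 t) / π) (b := volume.real (Ω ∩ (closedBall 0 t)ᶜ) / π)
    (by positivity) (by positivity) (by linarith) (by linarith)
  have h2 := mul_le_mul_of_nonneg_left this two_pi_pos.le
  rw [mul_add] at h2
  linarith

theorem induct {p : ℝ} (hp0 : 0 ≤ p) (hp1 : p < 1) : ∀ (n : ℕ) (Ω : Set ℂ) (r₁ : ℝ) (s : Finset (Set ℝ)),
    s.card ≤ n → IsOpen Ω → Bornology.IsBounded Ω → μH[1] (frontier Ω) ≠ ⊤ → 0 ≤ r₁ →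
    ball 0 r₁ ⊆ Ω → (∀ r, r₁ < r → ∃ y ∈ (closure Ω)ᶜ, ‖y‖ = r) →
    (∀ C ∈ s, IsPreconnected C) → norm '' Ω = ⋃₀ (s : Set (Set ℝ)) →
    2 * π * (volume.real Ω / π)^((p+1)/2) ≤ ∫ x in frontier Ω, ‖x‖^p ∂μH[1] := by
  classical
  intro n
  induction n with
  | zero =>
    intro Ω r₁ s hs ho hb hm hr hball hext hC hrad
    have : s = ∅ := by simpa using hs
    subst this
    have : Ω = ∅ := by simpa using hrad
    subst this
    simp only [measureReal_empty, zero_div]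
    rw [zero_rpow (by linarith), mul_zero]
    exact integral_nonneg fun x => by positivity
  | succ n ih =>
    intro Ω r₁ s hs ho hb hm hr hball hext hC hrad
    rcases Ω.eq_empty_or_nonempty with rfl | hne
    · simp only [measureReal_empty, zero_div]
      rw [zero_rpow (by linarith), mul_zero]
      exact integral_nonneg fun x => by positivity
    have hRne : (norm '' Ω).Nonempty := hne.image _
    have hRb : BddAbove (norm '' Ω) := by
      obtain ⟨M, hM⟩ := hb.exists_norm_le
      exact ⟨M, by rintro _ ⟨z, hz, rfl⟩; exact hM z hz⟩
    have hRbb : BddBelow (norm '' Ω) := ⟨0, by rintro _ ⟨z, hz, rfl⟩; exact norm_nonneg z⟩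
    set b := sSup (norm '' Ω) with hbdef
    have hΩb : ∀ z ∈ Ω, ‖z‖ ≤ b := fun z hz => le_csSup hRb ⟨z, hz, rfl⟩
    obtain ⟨a, har, hab, hball', hlow⟩ : ∃ a, r₁ ≤ a ∧ a ≤ b ∧ (ball 0 a ⊆ Ω ∨ Disjoint (ball 0 a) Ω) ∧
        ∀ t, a < t → ∃ z ∈ Ω, ‖z‖ < t := by
      rcases hr.eq_or_lt with h | h
      · refine ⟨sInf (norm '' Ω), ?_, csInf_le_csSup hRne hRbb hRb, Or.inr ?_, ?_⟩
        · rw [← h]; apply Real.sInf_nonneg; rintro _ ⟨z, hz, rfl⟩; exact norm_nonneg z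
        · rw [disjoint_left]
          intro z hz hz2
          have := csInf_le hRbb (mem_image_of_mem norm hz2)
          rw [mem_ball_zero_iff] at hz
          linarith
        · intro t ht
          obtain ⟨_, ⟨z, hz, rfl⟩, h2⟩ := exists_lt_of_csInf_lt hRne ht
          exact ⟨z, hz, h2⟩
      · refine ⟨r₁, le_rfl, ?_, Or.inl hball, ?_⟩
        · refine le_of_forall_lt_imp_le_of_dense ?_
          intro x hx
          rcases lt_or_ge x 0 with h0 | h0
          · obtain ⟨z, hz⟩ := hne
            have := hΩb z hz
            have := norm_nonneg z
            linarith
          · have := hΩb (x : ℂ) (hball (by simpa [abs_of_nonneg h0] using hx))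
            simpa [abs_of_nonneg h0] using this
        · intro t ht
          exact ⟨0, hball (by simpa using h), by simpa using h.trans ht⟩
    have ha : 0 ≤ a := hr.trans har
    by_cases hmeet : ∀ᵐ r : ℝ, a < r → r < b → ∃ z ∈ Ω, ‖z‖ = r
    · exact base ho hb hm hp0 hp1 ha hab hΩb hball' (fun r h => hext r (har.trans_lt h)) hmeet
    have hcount : {t : ℝ | 0 < μH[1] (frontier Ω ∩ sphere (0:ℂ) t)}.Countable := by
      refine Measure.countable_meas_pos_of_disjoint_of_meas_iUnion_ne_top μH[1]
        (As := fun t : ℝ => frontier Ω ∩ sphere (0:ℂ) t) (fun t => isClosed_frontier.measurableSet.inter isClosed_sphere.measurableSet) ?_ ?_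
      · intro u v huv
        rw [Function.onFun, disjoint_left]
        rintro x ⟨_, h1⟩ ⟨_, h2⟩
        rw [mem_sphere_zero_iff_norm] at h1 h2
        exact huv (h1.symm.trans h2)
      · exact ((measure_mono (iUnion_subset fun t => inter_subset_left)).trans_lt hm.lt_top).ne
    have hae : ∀ᵐ t : ℝ, μH[1] (frontier Ω ∩ sphere (0:ℂ) t) = 0 := by
      rw [ae_iff]
      refine measure_mono_null ?_ (hcount.measure_zero volume)
      intro t ht
      exact pos_iff_ne_zero.2 ht
    obtain ⟨t, hat, htb, htR, hts⟩ : ∃ t, a < t ∧ t < b ∧ (∀ z ∈ Ω, ‖z‖ ≠ t) ∧ μH[1] (frontier Ω ∩ sphere (0:ℂ) t) = 0 := by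
      by_contra hcon
      push Not at hcon
      refine hmeet ?_
      filter_upwards [hae] with t h0 h1 h2
      by_contra h3
      push Not at h3
      exact hcon t h1 h2 h3 h0
    have ht0 : 0 < t := ha.trans_lt hat
    have hcov : ∀ C ∈ s, C ⊆ Iio t ∨ C ⊆ Ioi t := by
      intro C hCs
      refine IsPreconnected.subset_or_subset isOpen_Iio isOpen_Ioi ?_ ?_ (hC C hCs)
      · exact disjoint_left.2 fun x h1 h2 => lt_asymm (mem_Iio.1 h1) (mem_Ioi.1 h2)
      · intro x hx
        have : x ∈ norm '' Ω := by rw [hrad]; exact ⟨C, hCs, hx⟩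
        obtain ⟨z, hz, rfl⟩ := this
        exact lt_or_gt_of_ne (htR z hz)
    obtain ⟨z₁, hz₁, hz₁t⟩ := hlow t hat
    obtain ⟨_, ⟨z₂, hz₂, rfl⟩, hz₂t⟩ := exists_lt_of_lt_csSup hRne htb
    obtain ⟨C₁, hC₁, hzC₁⟩ : ∃ C ∈ s, ‖z₁‖ ∈ C := by
      have : ‖z₁‖ ∈ norm '' Ω := ⟨_, hz₁, rfl⟩
      rw [hrad] at this; exact this
    obtain ⟨C₂, hC₂, hzC₂⟩ : ∃ C ∈ s, ‖z₂‖ ∈ C := by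
      have : ‖z₂‖ ∈ norm '' Ω := ⟨_, hz₂, rfl⟩
      rw [hrad] at this; exact this
    have hcard1 : (s.filter (· ⊆ Iio t)).card < s.card := by
      refine Finset.card_lt_card (Finset.filter_ssubset.2 ⟨C₂, hC₂, fun h => ?_⟩)
      exact lt_asymm hz₂t (h hzC₂)
    have hcard2 : (s.filter (· ⊆ Ioi t)).card < s.card := by
      refine Finset.card_lt_card (Finset.filter_ssubset.2 ⟨C₁, hC₁, fun h => ?_⟩)
      exact lt_asymm hz₁t (h hzC₁)
    refine split_step ho hb hm hp0 hp1 htR hts ?_ ?_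
    · intro hm1
      refine ih _ r₁ (s.filter (· ⊆ Iio t)) (by omega) (ho.inter isOpen_ball) (hb.subset inter_subset_left) hm1 hr
        (subset_inter hball (ball_subset_ball (har.trans hat.le))) ?_ (fun C h => hC C (Finset.mem_filter.1 h).1) ?_
      · intro r h
        obtain ⟨y, hy, hyr⟩ := hext r h
        exact ⟨y, fun h => hy (closure_mono inter_subset_left h), hyr⟩
      · ext x
        constructor
        · rintro ⟨z, ⟨hz, hzt⟩, rfl⟩
          have : ‖z‖ ∈ norm '' Ω := ⟨_, hz, rfl⟩
          rw [hrad] at this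
          obtain ⟨C, hCs, hzC⟩ := this
          refine ⟨C, ?_, hzC⟩
          rw [Finset.mem_coe, Finset.mem_filter]
          refine ⟨hCs, (hcov C hCs).resolve_right fun h => ?_⟩
          exact lt_asymm (mem_ball_zero_iff.1 hzt) (h hzC)
        · rintro ⟨C, hCs, hx⟩
          rw [Finset.mem_coe, Finset.mem_filter] at hCs
          have : x ∈ norm '' Ω := by rw [hrad]; exact ⟨C, hCs.1, hx⟩
          obtain ⟨z, hz, rfl⟩ := this
          exact ⟨z, ⟨hz, mem_ball_zero_iff.2 (hCs.2 hx)⟩, rfl⟩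
    · intro hm1
      refine ih _ 0 (s.filter (· ⊆ Ioi t)) (by omega) (ho.inter isClosed_closedBall.isOpen_compl) (hb.subset inter_subset_left) hm1 le_rfl
        (by simp) ?_ (fun C h => hC C (Finset.mem_filter.1 h).1) ?_
      · intro r h
        rcases lt_or_ge r₁ r with h1 | h1
        · obtain ⟨y, hy, hyr⟩ := hext r h1
          exact ⟨y, fun h => hy (closure_mono inter_subset_left h), hyr⟩
        · refine ⟨(r : ℂ), ?_, by simp [abs_of_pos h]⟩
          intro hc
          have h2 : closure (Ω ∩ (closedBall (0:ℂ) t)ᶜ) ⊆ (ball 0 t)ᶜ :=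
            closure_minimal (inter_subset_right.trans (compl_subset_compl.2 ball_subset_closedBall)) isOpen_ball.isClosed_compl
          refine h2 hc (mem_ball_zero_iff.2 ?_)
          simp only [Complex.norm_real, norm_eq_abs, abs_of_pos h]
          linarith
      · ext x
        constructor
        · rintro ⟨z, ⟨hz, hzt⟩, rfl⟩
          have : ‖z‖ ∈ norm '' Ω := ⟨_, hz, rfl⟩
          rw [hrad] at this
          obtain ⟨C, hCs, hzC⟩ := this
          refine ⟨C, ?_, hzC⟩
          rw [Finset.mem_coe, Finset.mem_filter]
          refine ⟨hCs, (hcov C hCs).resolve_left fun h => ?_⟩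
          exact hzt (mem_closedBall_zero_iff.2 (le_of_lt (h hzC)))
        · rintro ⟨C, hCs, hx⟩
          rw [Finset.mem_coe, Finset.mem_filter] at hCs
          have : x ∈ norm '' Ω := by rw [hrad]; exact ⟨C, hCs.1, hx⟩
          obtain ⟨z, hz, rfl⟩ := this
          refine ⟨z, ⟨hz, fun h => ?_⟩, rfl⟩
          exact absurd (hCs.2 hx) (not_lt.2 (mem_closedBall_zero_iff.1 h))

end PartD2

section PartD3
open MeasureTheory Metric Real Set Filter Topology

theorem fin_case {p : ℝ} (hp0 : 0 ≤ p) (hp1 : p < 1) {Ω : Set ℂ} (s : Finset (Set ℝ)) (ho : IsOpen Ω)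
    (hb : Bornology.IsBounded Ω) (hm : μH[1] (frontier Ω) ≠ ⊤)
    (hC : ∀ C ∈ s, IsPreconnected C) (hrad : norm '' Ω = ⋃₀ (s : Set (Set ℝ))) :
    2 * π * (volume.real Ω / π)^((p+1)/2) ≤ ∫ x in frontier Ω, ‖x‖^p ∂μH[1] := by
  classical
  set S : Set ℝ := {0} ∪ (Ici 0 ∩ ⋂ u : sphere (0:ℂ) 1, {r : ℝ | (r : ℂ) * u ∈ closure Ω}) with hS
  obtain ⟨M, hM⟩ := hb.closure.exists_norm_le
  have hScl : IsClosed S := by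
    refine isClosed_singleton.union (isClosed_Ici.inter (isClosed_iInter fun u => ?_))
    exact isClosed_closure.preimage (by fun_prop : Continuous fun r : ℝ => (r : ℂ) * (u : ℂ))
  have hScpt : IsCompact S := by
    refine isCompact_of_isClosed_isBounded hScl ((isBounded_Icc 0 (max M 0)).subset ?_)
    rintro r (hr | ⟨hr, hr2⟩)
    · rw [mem_singleton_iff.1 hr]; exact ⟨le_rfl, le_max_right _ _⟩
    · refine ⟨hr, le_max_of_le_left ?_⟩
      have h := mem_iInter.1 hr2 ⟨1, by simp⟩
      have := hM _ h
      simpa [abs_of_nonneg (mem_Ici.1 hr)] using this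
  obtain ⟨r₁, hr₁S, hr₁max⟩ := hScpt.exists_isGreatest ⟨0, Or.inl rfl⟩
  have hr0 : 0 ≤ r₁ := hr₁max (Or.inl rfl)
  have hmemS : ∀ r, 0 < r → (∀ y : ℂ, ‖y‖ = r → y ∈ closure Ω) → r ∈ S := by
    intro r hr h
    refine Or.inr ⟨hr.le, mem_iInter.2 fun u => h _ ?_⟩
    have := mem_sphere_zero_iff_norm.1 u.2
    simp [this, abs_of_pos hr]
  have hsph : ∀ y : ℂ, 0 < r₁ → ‖y‖ = r₁ → y ∈ closure Ω := by
    intro y h hy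
    rcases hr₁S with h0 | ⟨_, h2⟩
    · exact absurd (mem_singleton_iff.1 h0) h.ne'
    · have hy0 : (r₁ : ℂ) ≠ 0 := by exact_mod_cast h.ne'
      have := mem_iInter.1 h2 ⟨y / r₁, by
        rw [mem_sphere_zero_iff_norm, norm_div, hy, Complex.norm_real, norm_eq_abs, abs_of_pos h, div_self h.ne']⟩
      simp only [mem_ofPred_eq] at this
      rwa [mul_div_cancel₀ _ hy0] at this
  set Ω₁ := Ω ∪ ball 0 r₁ with hΩ₁
  have ho1 : IsOpen Ω₁ := ho.union isOpen_ball
  have hb1 : Bornology.IsBounded Ω₁ := hb.union isBounded_ball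
  have hcl1 : closure Ω₁ ⊆ closure Ω ∪ closedBall 0 r₁ := by
    rw [hΩ₁, closure_union]
    exact union_subset_union_right _ closure_ball_subset_closedBall
  have hfr : frontier Ω₁ ⊆ frontier Ω := by
    intro x hx
    rw [ho1.frontier_eq] at hx
    rw [ho.frontier_eq]
    refine ⟨?_, fun h => hx.2 (Or.inl h)⟩
    rcases hcl1 hx.1 with h | h
    · exact h
    · have h1 : ‖x‖ = r₁ := by
        refine le_antisymm (mem_closedBall_zero_iff.1 h) (not_lt.1 fun h' => hx.2 (Or.inr (mem_ball_zero_iff.2 h')))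
      rcases hr0.eq_or_lt with h0 | h0
      · have : ball (0:ℂ) r₁ = ∅ := by rw [← h0]; exact ball_zero
        rw [hΩ₁, this, union_empty] at hx
        exact hx.1
      · exact hsph x h0 h1
  have hm1 : μH[1] (frontier Ω₁) ≠ ⊤ := ((measure_mono hfr).trans_lt hm.lt_top).ne
  have key := induct hp0 hp1 (insert (Ico 0 r₁) s).card Ω₁ r₁ (insert (Ico 0 r₁) s) le_rfl ho1 hb1 hm1 hr0
    subset_union_right (by
      intro r hr
      by_contra hcon
      push Not at hcon
      have h0 : 0 < r := hr0.trans_lt hr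
      have : r ∈ S := by
        refine hmemS r h0 fun y hy => ?_
        by_contra hyc
        refine hcon y (fun hy2 => ?_) hy
        rcases hcl1 hy2 with h | h
        · exact hyc h
        · have := mem_closedBall_zero_iff.1 h; linarith
      have := hr₁max this
      linarith) (by
      intro C h
      rcases Finset.mem_insert.1 h with rfl | h
      · exact isPreconnected_Ico
      · exact hC C h) (by
      rw [hΩ₁, image_union, hrad, Finset.coe_insert, sUnion_insert, union_comm]
      congr 1
      ext x
      constructor
      · rintro ⟨z, hz, rfl⟩; exact ⟨norm_nonneg z, mem_ball_zero_iff.1 hz⟩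
      · rintro ⟨h1, h2⟩
        exact ⟨x, by simpa [abs_of_nonneg h1] using h2, by simp [abs_of_nonneg h1]⟩)
  have hInt : IntegrableOn (fun x : ℂ => ‖x‖^p) (frontier Ω) μH[1] := intOn_frontier hb hm (wt_cont hp0)
  have m1 := setIntegral_mono_set hInt (ae_of_all _ fun x => by positivity) hfr.eventuallyLE
  have hv : volume.real Ω ≤ volume.real Ω₁ := measureReal_mono subset_union_left hb1.measure_lt_top.ne
  refine le_trans ?_ (key.trans m1)
  gcongr

theorem approx_case {p : ℝ} (hp0 : 0 ≤ p) (hp1 : p < 1) {Ω : Set ℂ} (ho : IsOpen Ω)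
    (hb : Bornology.IsBounded Ω) (hm : μH[1] (frontier Ω) ≠ ⊤) {v : ℝ} (hv0 : 0 ≤ v) (hv : v < volume.real Ω) :
    2 * π * (v / π)^((p+1)/2) ≤ ∫ x in frontier Ω, ‖x‖^p ∂μH[1] := by
  classical
  obtain ⟨K, hKΩ, hK, hvK⟩ := ho.exists_lt_isCompact (μ := volume) (r := ENNReal.ofReal v) (by
    rw [ENNReal.ofReal_lt_iff_lt_toReal hv0 hb.measure_lt_top.ne]; exact hv)
  set R := norm '' Ω with hR
  have hnear : ∀ z ∈ Ω, ∀ᶠ w in 𝓝 z, w ∈ Ω ∧ ‖w‖ ∈ connectedComponentIn R ‖z‖ := by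
    intro z hz
    obtain ⟨ε, hε, hball⟩ := Metric.isOpen_iff.1 ho z hz
    filter_upwards [ball_mem_nhds z hε] with w hw
    refine ⟨hball hw, ?_⟩
    have : norm '' ball z ε ⊆ connectedComponentIn R ‖z‖ := by
      refine IsPreconnected.subset_connectedComponentIn ?_ (mem_image_of_mem _ (mem_ball_self hε)) (image_mono hball)
      exact ((convex_ball z ε).isPreconnected).image _ continuous_norm.continuousOn
    exact this (mem_image_of_mem _ hw)
  obtain ⟨t, htK, hKt⟩ := hK.elim_nhds_subcover (fun z => {w | w ∈ Ω ∧ ‖w‖ ∈ connectedComponentIn R ‖z‖})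
    (fun z hz => hnear z (hKΩ hz))
  set s : Finset (Set ℝ) := t.image (fun z => connectedComponentIn R ‖z‖) with hs
  set Ω' : Set ℂ := {w | w ∈ Ω ∧ ‖w‖ ∈ ⋃₀ (s : Set (Set ℝ))} with hΩ'
  have hsub : Ω' ⊆ Ω := fun w h => h.1
  have hiff : ∀ z ∈ Ω, ∀ᶠ w in 𝓝 z, (w ∈ Ω' ↔ z ∈ Ω') := by
    intro z hz
    filter_upwards [hnear z hz] with w hw
    have heq := connectedComponentIn_eq hw.2
    constructor
    · rintro ⟨h1, C, hC, h2⟩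
      refine ⟨hz, C, hC, ?_⟩
      obtain ⟨y, hy, rfl⟩ := Finset.mem_image.1 hC
      rw [connectedComponentIn_eq h2, ← heq]
      exact mem_connectedComponentIn ⟨z, hz, rfl⟩
    · rintro ⟨h1, C, hC, h2⟩
      refine ⟨hw.1, C, hC, ?_⟩
      obtain ⟨y, hy, rfl⟩ := Finset.mem_image.1 hC
      rw [connectedComponentIn_eq h2]
      exact hw.2
  have ho' : IsOpen Ω' := by
    rw [isOpen_iff_mem_nhds]
    intro z hz
    filter_upwards [hiff z hz.1] with w hw
    exact hw.2 hz
  have hfr : frontier Ω' ⊆ frontier Ω := by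
    intro x hx
    rw [ho'.frontier_eq] at hx
    rw [ho.frontier_eq]
    refine ⟨closure_mono hsub hx.1, fun h => ?_⟩
    obtain ⟨w, hw1, hw2⟩ := ((mem_closure_iff_frequently.1 hx.1).and_eventually (hiff x h)).exists
    exact hx.2 (hw2.1 hw1)
  have hm' : μH[1] (frontier Ω') ≠ ⊤ := ((measure_mono hfr).trans_lt hm.lt_top).ne
  have hb' := hb.subset hsub
  have key := fin_case hp0 hp1 s ho' hb' hm' (by
    intro C hC
    obtain ⟨y, hy, rfl⟩ := Finset.mem_image.1 hC
    exact isPreconnected_connectedComponentIn) (by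
    ext x
    constructor
    · rintro ⟨z, hz, rfl⟩; exact hz.2
    · rintro ⟨C, hC, hx⟩
      obtain ⟨y, hy, rfl⟩ := Finset.mem_image.1 hC
      obtain ⟨z, hz, rfl⟩ := connectedComponentIn_subset _ _ hx
      exact ⟨z, ⟨hz, _, hC, hx⟩, rfl⟩)
  have hInt : IntegrableOn (fun x : ℂ => ‖x‖^p) (frontier Ω) μH[1] := intOn_frontier hb hm (wt_cont hp0)
  have m1 := setIntegral_mono_set hInt (ae_of_all _ fun x => by positivity) hfr.eventuallyLE
  have hKΩ' : K ⊆ Ω' := by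
    intro z hz
    obtain ⟨y, hy, h⟩ := mem_iUnion₂.1 (hKt hz)
    exact ⟨h.1, _, Finset.mem_coe.2 (Finset.mem_image_of_mem _ hy), h.2⟩
  have hv' : v ≤ volume.real Ω' := by
    have : ENNReal.ofReal v ≤ volume Ω' := hvK.le.trans (measure_mono hKΩ')
    exact (ENNReal.ofReal_le_iff_le_toReal hb'.measure_lt_top.ne).1 this
  refine le_trans ?_ (key.trans m1)
  gcongr

theorem case_lt1 {p : ℝ} (hp0 : 0 ≤ p) (hp1 : p < 1) {Ω : Set ℂ} (ho : IsOpen Ω)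
    (hb : Bornology.IsBounded Ω) (hm : μH[1] (frontier Ω) ≠ ⊤) :
    2 * π * (volume.real Ω / π)^((p+1)/2) ≤ ∫ x in frontier Ω, ‖x‖^p ∂μH[1] := by
  rcases (measureReal_nonneg (μ := volume) (s := Ω)).eq_or_lt with h0 | hV
  · rw [← h0, zero_div, zero_rpow (by linarith), mul_zero]
    exact integral_nonneg fun x => by positivity
  have hc : Continuous fun v : ℝ => 2 * π * (v / π)^((p+1)/2) := by
    refine continuous_const.mul (Continuous.rpow_const (by fun_prop) fun _ => Or.inr (by linarith))
  refine le_of_tendsto (hc.continuousWithinAt (s := Iio (volume.real Ω)) (x := volume.real Ω)) ?_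
  filter_upwards [self_mem_nhdsWithin, mem_nhdsWithin_of_mem_nhds (lt_mem_nhds hV)] with v h1 h2
  exact approx_case hp0 hp1 ho hb hm (le_of_lt h2) h1

theorem main_C {p : ℝ} (hp0 : 0 ≤ p) {Ω : Set ℂ} (ho : IsOpen Ω)
    (hb : Bornology.IsBounded Ω) (hm : μH[1] (frontier Ω) ≠ ⊤) :
    2 * π * (volume.real Ω / π)^((p+1)/2) ≤ ∫ x in frontier Ω, ‖x‖^p ∂μH[1] := by
  rcases lt_or_ge p 1 with h | h
  · exact case_lt1 hp0 h ho hb hm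
  · exact case_ge1 ho hb hm h

theorem curve_finite {E : Type*} [NormedAddCommGroup E] [NormedSpace ℝ E] [MeasurableSpace E] [BorelSpace E]
    {γ : ℝ → E} (h : ContDiff ℝ 1 γ) : μH[1] (γ '' Icc (0:ℝ) 1) < ⊤ := by
  obtain ⟨K, hK⟩ := h.contDiffOn.exists_lipschitzOnWith (s := Icc (0:ℝ) 1) one_ne_zero (convex_Icc 0 1) isCompact_Icc
  refine (hK.hausdorffMeasure_image_le zero_le_one).trans_lt ?_
  rw [hausdorffMeasure_real]
  exact ENNReal.mul_lt_top (by simp) (by simp)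

end PartD3

section PartD4
open MeasureTheory Metric Real Set Filter Topology

theorem main_E {p : ℝ} (hp0 : 0 ≤ p) {Ω : Set (EuclideanSpace ℝ (Fin 2))} (ho : IsOpen Ω)
    (hb : Bornology.IsBounded Ω) (hm : μH[1] (frontier Ω) ≠ ⊤) :
    2 * π * (volume.real Ω / π)^((p+1)/2) ≤ ∫ x in frontier Ω, ‖x‖^p ∂μH[1] := by
  let e : ℂ ≃ₗᵢ[ℝ] EuclideanSpace ℝ (Fin 2) := Complex.orthonormalBasisOneI.repr
  have hfr : frontier (e ⁻¹' Ω) = e ⁻¹' (frontier Ω) := (e.toHomeomorph.preimage_frontier Ω).symm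
  have hmp : MeasurePreserving e.toIsometryEquiv (μH[1] : Measure ℂ) (μH[1] : Measure (EuclideanSpace ℝ (Fin 2))) :=
    e.toIsometryEquiv.measurePreserving_hausdorffMeasure 1
  have hemb : MeasurableEmbedding e.toIsometryEquiv := e.toHomeomorph.measurableEmbedding
  have hvol : volume.real (e ⁻¹' Ω) = volume.real Ω :=
    (e.measurePreserving).measureReal_preimage ho.measurableSet.nullMeasurableSet
  have h1 : μH[1] (frontier (e ⁻¹' Ω)) ≠ ⊤ := by
    rw [hfr]
    have := hmp.measure_preimage (s := frontier Ω) isClosed_frontier.measurableSet.nullMeasurableSet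
    exact ne_of_eq_of_ne this hm
  have hb' : Bornology.IsBounded (e ⁻¹' Ω) := by
    obtain ⟨M, hM⟩ := hb.exists_norm_le
    refine isBounded_iff_forall_norm_le.2 ⟨M, fun z hz => ?_⟩
    rw [← e.norm_map]; exact hM _ hz
  have key := main_C hp0 (ho.preimage e.continuous) hb' h1
  rw [hvol, hfr] at key
  have := hmp.setIntegral_preimage_emb hemb (fun x => ‖x‖^p) (frontier Ω)
  refine key.trans (le_of_eq ?_)
  rw [← this]
  refine integral_congr_ae (ae_of_all _ fun x => ?_)
  change ‖x‖^p = ‖e x‖^p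
  rw [e.norm_map]

end PartD4

/-- Theorem 2.1 (ii): weighted isoperimetric inequality for arbitrary bounded
open sets, for `p ≥ 0`. -/
theorem weighted_isoperimetric
    (p : ℝ) (hp : 0 ≤ p)
    (Ω : Set (EuclideanSpace ℝ (Fin 2)))
    (hopen : IsOpen Ω) (hbdd : Bornology.IsBounded Ω)
    (hbry : HasPiecewiseC1Boundary Ω) :
    ((volume Ω).toReal / π) ^ ((p + 1) / 2) ≤
      (1 / (2 * π)) * ∫ x in frontier Ω, ‖x‖ ^ p ∂μH[1] := by
  obtain ⟨n, γ, hγ, hfr⟩ := hbry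
  have hm : μH[1] (frontier Ω) ≠ ⊤ := by
    rw [hfr]
    refine ((measure_iUnion_le _).trans_lt ?_).ne
    rw [tsum_fintype]
    exact ENNReal.sum_lt_top.2 fun i _ => curve_finite (hγ i)
  have key := main_E hp hopen hbdd hm
  rw [one_div, ← div_eq_inv_mul, le_div_iff₀ (by positivity), mul_comm]
  exact key
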